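/- For every real r > 0 there exist a constant ε(r) > 0 and a threshold n₀(r) such that for every n ≥ n₀(r), every matchstick graph on n vertices all of whose vertices are contained in a closed disk of radius r has at most (2 - ε(r))·n edges. (Asymptotic form of the upper bound of Theorem 3.) -/

import Mathlib

/-- A *matchstick embedding* (drawing) of a simple graph `G`: the vertices are
represented by distinct points of the Euclidean plane, every edge is a
straight-line segment of unit length, two segments representing distinct edges
intersect in at most a common endpoint, and no vertex point lies in the
relative interior (open segment) of any edge segment. A graph admitting such an
embedding is a *matchstick graph*. -/
structure MatchstickEmbedding {V : Type*} (G : SimpleGraph V) where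
  /-- the position of each vertex in the plane -/
  pos : V → EuclideanSpace ℝ (Fin 2)
  /-- the vertex points are distinct -/
  inj : Function.Injective pos
  /-- every edge has unit length -/
  unit : ∀ u v : V, G.Adj u v → dist (pos u) (pos v) = 1
  /-- no vertex lies in the relative interior of an edge segment -/
  noVertexInterior : ∀ w u v : V, G.Adj u v → pos w ∉ openSegment ℝ (pos u) (pos v)
  /-- segments of distinct edges intersect in at most a common endpoint -/
  noncross : ∀ u v a b : V, G.Adj u v → G.Adj a b → s(u, v) ≠ s(a, b) →
    segment ℝ (pos u) (pos v) ∩ segment ℝ (pos a) (pos b) ⊆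
      ({pos u, pos v} ∩ {pos a, pos b} : Set (EuclideanSpace ℝ (Fin 2)))


namespace MS

/-- cross product -/
def cr (p q : ℝ × ℝ) : ℝ := p.1 * q.2 - p.2 * q.1
/-- dot product -/
def dt (p q : ℝ × ℝ) : ℝ := p.1 * q.1 + p.2 * q.2

lemma cr_frame {e : ℝ × ℝ} (he : dt e e = 1) (p q : ℝ × ℝ) :
    cr p q = dt e p * cr e q - cr e p * dt e q := by
  simp only [cr, dt] at *
  linear_combination (-(p.1 * q.2 - p.2 * q.1)) * he

lemma dt_frame {e : ℝ × ℝ} (he : dt e e = 1) (p q : ℝ × ℝ) :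
    dt p q = dt e p * dt e q + cr e p * cr e q := by
  simp only [cr, dt] at *
  linear_combination (-(p.1 * q.1 + p.2 * q.2)) * he

lemma unit_frame {e p : ℝ × ℝ} (he : dt e e = 1) (hp : dt p p = 1) :
    dt e p ^ 2 + cr e p ^ 2 = 1 := by
  have := dt_frame he p p
  nlinarith

lemma cr_self (p : ℝ × ℝ) : cr p p = 0 := by simp only [cr]; ring
lemma cr_comm (p q : ℝ × ℝ) : cr p q = - cr q p := by simp only [cr]; ring
lemma dt_comm (p q : ℝ × ℝ) : dt p q = dt q p := by simp only [dt]; ring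
lemma cr_add_l (p q r : ℝ × ℝ) : cr (p + q) r = cr p r + cr q r := by
  simp only [cr, Prod.fst_add, Prod.snd_add]; ring
lemma cr_add_r (p q r : ℝ × ℝ) : cr r (p + q) = cr r p + cr r q := by
  simp only [cr, Prod.fst_add, Prod.snd_add]; ring
lemma cr_sub_l (p q r : ℝ × ℝ) : cr (p - q) r = cr p r - cr q r := by
  simp only [cr, Prod.fst_sub, Prod.snd_sub]; ring
lemma cr_sub_r (p q r : ℝ × ℝ) : cr r (p - q) = cr r p - cr r q := by
  simp only [cr, Prod.fst_sub, Prod.snd_sub]; ring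
lemma cr_neg_l (p r : ℝ × ℝ) : cr (-p) r = - cr p r := by
  simp only [cr, Prod.fst_neg, Prod.snd_neg]; ring
lemma cr_neg_r (p r : ℝ × ℝ) : cr r (-p) = - cr r p := by
  simp only [cr, Prod.fst_neg, Prod.snd_neg]; ring
lemma cr_smul_l (s : ℝ) (p r : ℝ × ℝ) : cr (s • p) r = s * cr p r := by
  simp only [cr, Prod.smul_fst, Prod.smul_snd, smul_eq_mul]; ring
lemma cr_smul_r (s : ℝ) (p r : ℝ × ℝ) : cr r (s • p) = s * cr r p := by
  simp only [cr, Prod.smul_fst, Prod.smul_snd, smul_eq_mul]; ring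
lemma dt_add_l (p q r : ℝ × ℝ) : dt (p + q) r = dt p r + dt q r := by
  simp only [dt, Prod.fst_add, Prod.snd_add]; ring
lemma dt_add_r (p q r : ℝ × ℝ) : dt r (p + q) = dt r p + dt r q := by
  simp only [dt, Prod.fst_add, Prod.snd_add]; ring
lemma dt_sub_l (p q r : ℝ × ℝ) : dt (p - q) r = dt p r - dt q r := by
  simp only [dt, Prod.fst_sub, Prod.snd_sub]; ring
lemma dt_sub_r (p q r : ℝ × ℝ) : dt r (p - q) = dt r p - dt r q := by
  simp only [dt, Prod.fst_sub, Prod.snd_sub]; ring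
lemma dt_neg_l (p r : ℝ × ℝ) : dt (-p) r = - dt p r := by
  simp only [dt, Prod.fst_neg, Prod.snd_neg]; ring
lemma dt_neg_r (p r : ℝ × ℝ) : dt r (-p) = - dt r p := by
  simp only [dt, Prod.fst_neg, Prod.snd_neg]; ring
lemma dt_smul_l (s : ℝ) (p r : ℝ × ℝ) : dt (s • p) r = s * dt p r := by
  simp only [dt, Prod.smul_fst, Prod.smul_snd, smul_eq_mul]; ring
lemma dt_smul_r (s : ℝ) (p r : ℝ × ℝ) : dt r (s • p) = s * dt r p := by
  simp only [dt, Prod.smul_fst, Prod.smul_snd, smul_eq_mul]; ring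

lemma unit_le_one {x y : ℝ} (h : x ^ 2 + y ^ 2 = 1) : -1 ≤ x ∧ x ≤ 1 ∧ -1 ≤ y ∧ y ≤ 1 := by
  refine ⟨?_, ?_, ?_, ?_⟩ <;> nlinarith [sq_nonneg x, sq_nonneg y]

/-- if two unit vectors have zero cross product and positive dot product they agree -/
lemma eq_of_cr_zero {p q : ℝ × ℝ} (hp : dt p p = 1) (hq : dt q q = 1) (h : cr p q = 0)
    (h' : 0 < dt p q) : p = q := by
  have h1 := unit_frame hp hq
  rw [h] at h1
  have h2 : dt p q = 1 := by nlinarith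
  have h3 : dt (p - q) (p - q) = 0 := by
    rw [dt_sub_l, dt_sub_r, dt_sub_r, hp, hq, dt_comm q p, h2]; ring
  simp only [dt, Prod.fst_sub, Prod.snd_sub] at h3
  ext <;> nlinarith [sq_nonneg (p.1 - q.1), sq_nonneg (p.2 - q.2)]

/-- A matchstick configuration, with an angular threshold. -/
structure Cfg (V : Type) where
  P : V → ℝ × ℝ
  adj : V → V → Prop
  η : ℝ
  hη0 : 0 < η
  hη1 : η ≤ 1 / 10000
  symm : ∀ {u v}, adj u v → adj v u
  unit : ∀ {u v}, adj u v → dt (P v - P u) (P v - P u) = 1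
  inj : ∀ {u v}, P u = P v → u = v
  nv : ∀ {w u v}, adj u v → ∀ s : ℝ, 0 < s → s < 1 → P w = P u + s • (P v - P u) → False
  nc : ∀ {u v a b}, adj u v → adj a b → ¬ (u = a ∧ v = b) → ¬ (u = b ∧ v = a) →
    ∀ s t : ℝ, 0 ≤ s → s ≤ 1 → 0 ≤ t → t ≤ 1 →
      P u + s • (P v - P u) = P a + t • (P b - P a) → (s = 0 ∨ s = 1) ∧ (t = 0 ∨ t = 1)

namespace Cfg

variable {V : Type} (C : Cfg V)

def d (v a : V) : ℝ × ℝ := C.P a - C.P v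
def near (u w : ℝ × ℝ) : Prop := 1 - C.η < dt u w
def R (v a : V) : Prop :=
  ∃ x, C.adj v x ∧ C.near (C.d v a) (C.d v x) ∧ cr (C.d v a) (C.d v x) < 0
def L (v a : V) : Prop :=
  ∃ x, C.adj v x ∧ C.near (C.d v a) (C.d v x) ∧ 0 < cr (C.d v a) (C.d v x)
def NR (v a : V) : Prop := C.adj v a ∧ ¬ C.R v a
def NL (v a : V) : Prop := C.adj v a ∧ ¬ C.L v a
def W (v a : V) : Prop := C.adj v a ∧ ¬ C.R v a ∧ ¬ C.L a v
def X (v : V) : Prop := ∃ x y z, C.adj v x ∧ C.adj v y ∧ C.adj v z ∧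
  ¬ C.near (C.d v x) (C.d v y) ∧ ¬ C.near (C.d v x) (C.d v z) ∧ ¬ C.near (C.d v y) (C.d v z)
def Gap (t a c : V) : Prop := C.adj t a ∧ C.adj t c ∧ C.near (C.d t a) (C.d t c) ∧
  0 < cr (C.d t a) (C.d t c) ∧
  ∀ x, C.adj t x → 0 < cr (C.d t a) (C.d t x) → 0 < cr (C.d t x) (C.d t c) → False
/-- the point `z` lies in the interior of the triangle `t a c` -/
def In (t a c : V) (z : ℝ × ℝ) : Prop :=
  0 < cr (C.d t a) (z - C.P t) ∧ 0 < cr (z - C.P t) (C.d t c) ∧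
  cr (C.d t a) (z - C.P t) + cr (z - C.P t) (C.d t c) < cr (C.d t a) (C.d t c)
def Low (v : V) : Prop := ¬ C.X v ∧ ((¬ ∃ x y, x ≠ y ∧ C.NL v x ∧ C.NL v y) ∨
  (¬ ∃ x y, x ≠ y ∧ C.NR v x ∧ C.NR v y))
def B0 (v : V) : Prop := C.X v ∨ C.Low v ∨ ∃ a, C.W v a ∨ C.W a v
def Bent (v : V) : Prop := ∃ q t, C.NL v q ∧ C.NR v t ∧ 0 < cr (C.d v q) (C.d v t) ∧
  -0.95 ≤ dt (C.d v q) (C.d v t)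
def B (v : V) : Prop := C.B0 v ∨ C.Bent v

variable {C}

lemma ud {v a : V} (h : C.adj v a) : dt (C.d v a) (C.d v a) = 1 := C.unit h
lemma d_neg (v a : V) : C.d a v = - C.d v a := by simp [d]
lemma ne_of_adj {v a : V} (h : C.adj v a) : v ≠ a := by
  rintro rfl
  have := C.unit h
  simp [dt] at this
lemma eq_of_d {v a b : V} (h : C.d v a = C.d v b) : a = b := by
  apply C.inj
  simpa [d] using h
lemma near_symm {u w : ℝ × ℝ} (h : C.near u w) : C.near w u := by
  unfold near at *; rwa [dt_comm]
lemma near_neg {u w : ℝ × ℝ} (h : C.near u w) : C.near (-u) (-w) := by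
  unfold near at *; rwa [dt_neg_l, dt_neg_r, neg_neg]

/-- strict crossing criterion -/
lemma nox {v x a b : V} (h1 : C.adj v x) (h2 : C.adj a b)
    (hD : 0 < cr (C.d v x) (C.d a b))
    (s0 : 0 < cr (C.d v a) (C.d a b)) (s1 : cr (C.d v a) (C.d a b) < cr (C.d v x) (C.d a b))
    (t0 : 0 ≤ cr (C.d v a) (C.d v x)) (t1 : cr (C.d v a) (C.d v x) ≤ cr (C.d v x) (C.d a b)) :
    False := by
  set D := cr (C.d v x) (C.d a b) with hDdef
  have hne := hD.ne'
  have key := C.nc h1 h2 ?_ ?_ (cr (C.d v a) (C.d a b) / D) (cr (C.d v a) (C.d v x) / D)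
    (by positivity) (by rw [div_le_one hD]; exact s1.le) (by positivity)
    (by rw [div_le_one hD]; exact t1) ?_
  · rcases key.1 with h | h
    · rw [div_eq_zero_iff] at h
      rcases h with h | h <;> linarith
    · rw [div_eq_one_iff_eq hne] at h; linarith
  · rintro ⟨rfl, rfl⟩
    rw [hDdef, cr_self] at hD; exact lt_irrefl _ hD
  · rintro ⟨rfl, rfl⟩
    rw [hDdef, d_neg, cr_neg_l, cr_self] at hD; simp at hD
  · have hx : (C.P v).1 + cr (C.d v a) (C.d a b) / D * ((C.P x).1 - (C.P v).1) =
        (C.P a).1 + cr (C.d v a) (C.d v x) / D * ((C.P b).1 - (C.P a).1) := by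
      field_simp
      simp only [hDdef, cr, d, Prod.fst_sub, Prod.snd_sub]; ring
    have hy : (C.P v).2 + cr (C.d v a) (C.d a b) / D * ((C.P x).2 - (C.P v).2) =
        (C.P a).2 + cr (C.d v a) (C.d v x) / D * ((C.P b).2 - (C.P a).2) := by
      field_simp
      simp only [hDdef, cr, d, Prod.fst_sub, Prod.snd_sub]; ring
    ext
    · simpa using hx
    · simpa using hy

/-- strict crossing criterion, negative orientation -/
lemma nox' {v x a b : V} (h1 : C.adj v x) (h2 : C.adj a b)
    (hD : cr (C.d v x) (C.d a b) < 0)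
    (s0 : cr (C.d v a) (C.d a b) < 0) (s1 : cr (C.d v x) (C.d a b) < cr (C.d v a) (C.d a b))
    (t0 : cr (C.d v a) (C.d v x) ≤ 0) (t1 : cr (C.d v x) (C.d a b) ≤ cr (C.d v a) (C.d v x)) :
    False := by
  set D := cr (C.d v x) (C.d a b) with hDdef
  have hne := hD.ne
  have key := C.nc h1 h2 ?_ ?_ (cr (C.d v a) (C.d a b) / D) (cr (C.d v a) (C.d v x) / D)
    (div_nonneg_of_nonpos s0.le hD.le) (by rw [div_le_one_of_neg hD]; exact s1.le)
    (div_nonneg_of_nonpos t0 hD.le)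
    (by rw [div_le_one_of_neg hD]; exact t1) ?_
  · rcases key.1 with h | h
    · rw [div_eq_zero_iff] at h
      rcases h with h | h <;> linarith
    · rw [div_eq_one_iff_eq hne] at h; linarith
  · rintro ⟨rfl, rfl⟩
    rw [hDdef, cr_self] at hD; exact lt_irrefl _ hD
  · rintro ⟨rfl, rfl⟩
    rw [hDdef, d_neg, cr_neg_l, cr_self] at hD; simp at hD
  · have hx : (C.P v).1 + cr (C.d v a) (C.d a b) / D * ((C.P x).1 - (C.P v).1) =
        (C.P a).1 + cr (C.d v a) (C.d v x) / D * ((C.P b).1 - (C.P a).1) := by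
      field_simp
      simp only [hDdef, cr, d, Prod.fst_sub, Prod.snd_sub]; ring
    have hy : (C.P v).2 + cr (C.d v a) (C.d a b) / D * ((C.P x).2 - (C.P v).2) =
        (C.P a).2 + cr (C.d v a) (C.d v x) / D * ((C.P b).2 - (C.P a).2) := by
      field_simp
      simp only [hDdef, cr, d, Prod.fst_sub, Prod.snd_sub]; ring
    ext
    · simpa using hx
    · simpa using hy

/-- mirror image -/
def mir (C : Cfg V) : Cfg V where
  P v := ((C.P v).1, -(C.P v).2)
  adj := C.adj
  η := C.η
  hη0 := C.hη0
  hη1 := C.hη1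
  symm := C.symm
  unit := by
    intro u v h
    have := C.unit h
    simp only [dt, Prod.fst_sub, Prod.snd_sub] at *
    linarith
  inj := by
    intro u v h
    apply C.inj
    simp only [Prod.mk.injEq, neg_inj] at h
    ext
    · exact h.1
    · exact h.2
  nv := by
    intro w u v h s h0 h1 h2
    refine C.nv (w := w) h s h0 h1 ?_
    simp only [Prod.ext_iff, Prod.fst_add, Prod.snd_add, Prod.smul_fst, Prod.smul_snd,
      Prod.fst_sub, Prod.snd_sub, smul_eq_mul] at *
    refine ⟨h2.1, ?_⟩
    linarith [h2.2]
  nc := by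
    intro u v a b h1 h2 n1 n2 s t s0 s1 t0 t1 h
    refine C.nc h1 h2 n1 n2 s t s0 s1 t0 t1 ?_
    simp only [Prod.ext_iff, Prod.fst_add, Prod.snd_add, Prod.smul_fst, Prod.smul_snd,
      Prod.fst_sub, Prod.snd_sub, smul_eq_mul] at *
    refine ⟨h.1, ?_⟩
    linarith [h.2]

lemma mir_adj {v a : V} : C.mir.adj v a ↔ C.adj v a := Iff.rfl
lemma mir_cr (v a w b : V) : cr (C.mir.d v a) (C.mir.d w b) = - cr (C.d v a) (C.d w b) := by
  simp only [cr, d, mir, Prod.fst_sub, Prod.snd_sub]; ring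
lemma mir_dt (v a w b : V) : dt (C.mir.d v a) (C.mir.d w b) = dt (C.d v a) (C.d w b) := by
  simp only [dt, d, mir, Prod.fst_sub, Prod.snd_sub]; ring
lemma mir_near (v a w b : V) : C.mir.near (C.mir.d v a) (C.mir.d w b) ↔
    C.near (C.d v a) (C.d w b) := by
  unfold near; rw [mir_dt]; rfl
lemma mir_R (v a : V) : C.mir.R v a ↔ C.L v a := by
  unfold R L; simp only [mir_near, mir_cr, mir_adj, Left.neg_neg_iff]
lemma mir_L (v a : V) : C.mir.L v a ↔ C.R v a := by
  unfold R L; simp only [mir_near, mir_cr, mir_adj, Left.neg_pos_iff]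
lemma mir_NR (v a : V) : C.mir.NR v a ↔ C.NL v a := by
  unfold NR NL; rw [mir_R, mir_adj]
lemma mir_NL (v a : V) : C.mir.NL v a ↔ C.NR v a := by
  unfold NR NL; rw [mir_L, mir_adj]
lemma mir_W (v a : V) : C.mir.W v a ↔ C.W a v := by
  unfold W; rw [mir_L, mir_R, mir_adj]
  constructor
  · rintro ⟨h1, h2, h3⟩; exact ⟨C.symm h1, h3, h2⟩
  · rintro ⟨h1, h2, h3⟩; exact ⟨C.symm h1, h3, h2⟩
lemma mir_X (v : V) : C.mir.X v ↔ C.X v := by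
  unfold X; simp only [mir_near, mir_adj]
lemma mir_Gap (t a c : V) : C.mir.Gap t a c ↔ C.Gap t c a := by
  unfold Gap; simp only [mir_near, mir_adj, mir_cr]
  constructor
  · rintro ⟨h1, h2, h3, h4, h5⟩
    refine ⟨h2, h1, near_symm h3, by rw [cr_comm]; exact h4, ?_⟩
    intro x hx g1 g2
    refine h5 x hx ?_ ?_
    · rw [← cr_comm]; exact g2
    · rw [← cr_comm]; exact g1
  · rintro ⟨h1, h2, h3, h4, h5⟩
    refine ⟨h2, h1, near_symm h3, by rw [← cr_comm]; exact h4, ?_⟩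
    intro x hx g1 g2
    refine h5 x hx ?_ ?_
    · rw [cr_comm]; exact g2
    · rw [cr_comm]; exact g1
lemma mir_In (t a c z : V) : C.mir.In t a c (C.mir.P z) ↔ C.In t c a (C.P z) := by
  have e1 : C.mir.P z - C.mir.P t = C.mir.d t z := rfl
  have e2 : C.P z - C.P t = C.d t z := rfl
  unfold In
  rw [e1, e2, mir_cr, mir_cr, mir_cr, cr_comm (C.d t c) (C.d t a), cr_comm (C.d t c) (C.d t z),
    cr_comm (C.d t z) (C.d t a)]
  constructor
  · rintro ⟨h1, h2, h3⟩; exact ⟨h2, h1, by linarith⟩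
  · rintro ⟨h1, h2, h3⟩; exact ⟨h2, h1, by linarith⟩
lemma mir_Low (v : V) : C.mir.Low v ↔ C.Low v := by
  unfold Low; simp only [mir_X, mir_NL, mir_NR]
  exact and_congr_right fun _ => or_comm
lemma mir_B0 (v : V) : C.mir.B0 v ↔ C.B0 v := by
  unfold B0; simp only [mir_X, mir_Low, mir_W]
  constructor
  · rintro (h | h | ⟨a, h | h⟩)
    · exact Or.inl h
    · exact Or.inr (Or.inl h)
    · exact Or.inr (Or.inr ⟨a, Or.inr h⟩)
    · exact Or.inr (Or.inr ⟨a, Or.inl h⟩)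
  · rintro (h | h | ⟨a, h | h⟩)
    · exact Or.inl h
    · exact Or.inr (Or.inl h)
    · exact Or.inr (Or.inr ⟨a, Or.inr h⟩)
    · exact Or.inr (Or.inr ⟨a, Or.inl h⟩)
lemma mir_Bent (v : V) : C.mir.Bent v ↔ C.Bent v := by
  unfold Bent; simp only [mir_NL, mir_NR, mir_cr, mir_dt]
  constructor
  · rintro ⟨q, t, h1, h2, h3, h4⟩
    exact ⟨t, q, h2, h1, by rw [cr_comm]; exact h3, by rw [dt_comm]; exact h4⟩
  · rintro ⟨q, t, h1, h2, h3, h4⟩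
    exact ⟨t, q, h2, h1, by rw [← cr_comm]; exact h3, by rw [dt_comm]; exact h4⟩
lemma mir_B (v : V) : C.mir.B v ↔ C.B v := by
  unfold B; rw [mir_B0, mir_Bent]

/-- coordinates of a near unit vector -/
lemma near_coord {e u : ℝ × ℝ} (he : dt e e = 1) (hu : dt u u = 1) (h : C.near e u) :
    0.9999 < dt e u ∧ dt e u ≤ 1 ∧ -0.015 < cr e u ∧ cr e u < 0.015 ∧
    0 ≤ 1 - dt e u ∧ 1 - dt e u ≤ cr e u ^ 2 := by
  have h1 := unit_frame he hu
  have h2 := unit_le_one h1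
  have h3 := C.hη1
  unfold near at h
  refine ⟨by linarith, h2.2.1, ?_, ?_, by linarith, by nlinarith⟩ <;> nlinarith

lemma Zlem {v a : V} (h : C.adj v a) (hR : C.R v a) (hL : C.L a v) : False := by
  obtain ⟨x, hx, nx, cx⟩ := hR
  obtain ⟨b, hb, nb, cb⟩ := hL
  have he := ud h
  have hw := ud hx
  have hy := ud hb
  rw [d_neg v a] at nb cb
  rw [cr_neg_l] at cb
  have nb' := near_coord (by rw [dt_neg_l, dt_neg_r, neg_neg]; exact he) hy nb
  rw [dt_neg_l, cr_neg_l] at nb'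
  have nx' := near_coord he hw nx
  have uw := unit_frame he hw
  have uy := unit_frame he hy
  have key := nox' hx hb
  rw [cr_frame he (C.d v x) (C.d a b)] at key
  generalize dt (C.d v a) (C.d v x) = w1 at *
  generalize cr (C.d v a) (C.d v x) = w2 at *
  generalize dt (C.d v a) (C.d a b) = y1 at *
  generalize cr (C.d v a) (C.d a b) = y2 at *
  obtain ⟨a1, a2, a3, a4, a5, a6⟩ := nx'
  obtain ⟨b1, b2, b3, b4, b5, b6⟩ := nb'
  have hD : w1 * y2 - w2 * y1 < 0 := by nlinarith
  refine key hD (by linarith) ?_ (by linarith) ?_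
  · nlinarith
  · nlinarith

end Cfg
end MS


namespace MS

lemma cr_trans {e p q r : ℝ × ℝ} (hp : 0 < dt e p) (hq : 0 < dt e q) (hr : 0 < dt e r)
    (h1 : 0 < cr p q) (h2 : 0 < cr q r) : 0 < cr p r := by
  have key : dt e q * cr p r = dt e r * cr p q + dt e p * cr q r := by
    simp only [cr, dt]; ring
  have : 0 < dt e q * cr p r := by rw [key]; positivity
  exact (pos_iff_pos_of_mul_pos this).1 hq

lemma cone_dt {a c z : ℝ × ℝ} (ha : dt a a = 1) (hc : dt c c = 1) (hac : 0 < dt a c)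
    (h0 : 0 < cr a c) (h1 : 0 < cr a z) (h2 : 0 < cr z c) : 0 < dt z a ∧ 0 < dt z c := by
  have k1 : cr a c * dt z a = cr z c * dt a a + cr a z * dt a c := by
    simp only [cr, dt]; ring
  have k2 : cr a c * dt z c = cr z c * dt a c + cr a z * dt c c := by
    simp only [cr, dt]; ring
  rw [ha] at k1
  rw [hc] at k2
  constructor
  · have : 0 < cr a c * dt z a := by rw [k1]; positivity
    exact (pos_iff_pos_of_mul_pos this).1 h0
  · have : 0 < cr a c * dt z c := by rw [k2]; positivity
    exact (pos_iff_pos_of_mul_pos this).1 h0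

lemma unit_mono {x1 x2 y1 y2 : ℝ} (hx : x1 ^ 2 + x2 ^ 2 = 1) (hy : y1 ^ 2 + y2 ^ 2 = 1)
    (h1 : 0 < x1) (h2 : x2 < 0) (h3 : y2 < 0) (h4 : 0 < x1 * y2 - x2 * y1) : x1 < y1 := by
  have hy1 : 0 < y1 := by
    by_contra h
    push Not at h
    nlinarith
  by_contra h
  push Not at h
  have : y2 ≤ x2 := by nlinarith
  nlinarith

namespace Cfg
variable {V : Type} {C : Cfg V}

lemma near_pos {u w : ℝ × ℝ} (h : C.near u w) : 0.9999 < dt u w := by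
  have := C.hη1
  unfold near at h; linarith

lemma near_self {v a : V} (h : C.adj v a) : C.near (C.d v a) (C.d v a) := by
  unfold near; rw [ud h]; linarith [C.hη0]

lemma near_eq {v x y : V} (hx : C.adj v x) (hy : C.adj v y) (h : C.near (C.d v x) (C.d v y))
    (h0 : cr (C.d v x) (C.d v y) = 0) : x = y :=
  eq_of_d (eq_of_cr_zero (ud hx) (ud hy) h0 (by linarith [near_pos h]))

lemma NL_near {v x y : V} (hx : C.NL v x) (hy : C.NL v y) (h : C.near (C.d v x) (C.d v y)) :
    x = y := by
  rcases lt_trichotomy (cr (C.d v x) (C.d v y)) 0 with h0 | h0 | h0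
  · exfalso
    exact hy.2 ⟨x, hx.1, near_symm h, by rw [cr_comm]; linarith⟩
  · exact near_eq hx.1 hy.1 h h0
  · exact absurd ⟨y, hy.1, h, h0⟩ hx.2

lemma NR_near {v x y : V} (hx : C.NR v x) (hy : C.NR v y) (h : C.near (C.d v x) (C.d v y)) :
    x = y := by
  rw [← mir_NL] at hx hy
  exact NL_near hx hy ((mir_near _ _ _ _).2 h)

lemma gap_of_R [Finite V] {q a : V} (hqa : C.adj q a) (h : C.R q a) : ∃ a', C.Gap q a' a := by
  have hne : {x | C.adj q x ∧ C.near (C.d q a) (C.d q x) ∧ cr (C.d q a) (C.d q x) < 0}.Nonempty := h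
  obtain ⟨x, ⟨hx1, hx2, hx3⟩, hmax⟩ := Set.exists_max_image _ (fun x => dt (C.d q a) (C.d q x))
    (Set.toFinite _) hne
  refine ⟨x, hx1, hqa, near_symm hx2, by rw [cr_comm]; linarith, ?_⟩
  intro y hy h1 h2
  have he := ud hqa
  have hyn : cr (C.d q a) (C.d q y) < 0 := by rw [cr_comm]; linarith
  have hlt : dt (C.d q a) (C.d q x) < dt (C.d q a) (C.d q y) := by
    apply unit_mono (unit_frame he (ud hx1)) (unit_frame he (ud hy)) _ hx3 hyn
    · rw [← cr_frame he]; exact h1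
    · linarith [near_pos hx2]
  have := hmax y ⟨hy, by unfold near at *; linarith, hyn⟩
  linarith

lemma gap_of_L [Finite V] {t a : V} (hta : C.adj t a) (h : C.L t a) : ∃ c, C.Gap t a c := by
  rw [← mir_R] at h
  obtain ⟨c, hc⟩ := gap_of_R (C := C.mir) hta h
  exact ⟨c, (mir_Gap _ _ _).1 hc⟩

lemma Gap.pos {t a c : V} (h : C.Gap t a c) : 0 < cr (C.d t a) (C.d t c) := h.2.2.2.1
lemma Gap.near {t a c : V} (h : C.Gap t a c) : C.near (C.d t a) (C.d t c) := h.2.2.1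
lemma Gap.a1 {t a c : V} (h : C.Gap t a c) : C.adj t a := h.1
lemma Gap.a2 {t a c : V} (h : C.Gap t a c) : C.adj t c := h.2.1
lemma Gap.L {t a c : V} (h : C.Gap t a c) : C.L t a := ⟨c, h.a2, h.near, h.pos⟩
lemma Gap.R {t a c : V} (h : C.Gap t a c) : C.R t c :=
  ⟨a, h.a1, near_symm h.near, by rw [cr_comm]; linarith [h.pos]⟩
lemma Gap.NL {t a c : V} (h : C.Gap t a c) : C.NL c t :=
  ⟨C.symm h.a2, fun h' => Zlem h.a2 h.R h'⟩
lemma Gap.NR {t a c : V} (h : C.Gap t a c) : C.NR a t :=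
  ⟨C.symm h.a1, fun h' => Zlem (C.symm h.a1) h' h.L⟩

lemma Gap.right_unique {t a c c' : V} (h : C.Gap t a c) (h' : C.Gap t a c') : c = c' := by
  rcases lt_trichotomy (cr (C.d t c) (C.d t c')) 0 with h0 | h0 | h0
  · exact (h.2.2.2.2 c' h'.a2 h'.pos (by rw [cr_comm]; linarith)).elim
  · refine eq_of_d (eq_of_cr_zero (ud h.a2) (ud h'.a2) h0 ?_)
    have n1 := near_coord (ud h.a1) (ud h.a2) h.near
    have n2 := near_coord (ud h.a1) (ud h'.a2) h'.near
    rw [dt_frame (ud h.a1)]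
    nlinarith [n1.1, n2.1, h.pos, h'.pos]
  · exact (h'.2.2.2.2 c h.a2 h.pos h0).elim

lemma Gap.left_unique {t a a' c : V} (h : C.Gap t a c) (h' : C.Gap t a' c) : a = a' := by
  rw [← mir_Gap] at h h'
  exact h.right_unique h'

lemma Gap.same {t a1 c1 a2 c2 : V} {z : ℝ × ℝ} (h1 : C.Gap t a1 c1) (h2 : C.Gap t a2 c2)
    (z1 : 0 < cr (C.d t a1) z) (z1' : 0 < cr z (C.d t c1))
    (z2 : 0 < cr (C.d t a2) z) (z2' : 0 < cr z (C.d t c2)) : a1 = a2 := by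
  obtain ⟨p1, q1⟩ := cone_dt (ud h1.a1) (ud h1.a2) (by linarith [near_pos h1.near]) h1.pos z1 z1'
  obtain ⟨p2, q2⟩ := cone_dt (ud h2.a1) (ud h2.a2) (by linarith [near_pos h2.near]) h2.pos z2 z2'
  have hzz : 0 < dt z z := by
    by_contra h
    simp only [dt, cr] at *
    have e1 : z.1 = 0 := by nlinarith [sq_nonneg z.1, sq_nonneg z.2]
    have e2 : z.2 = 0 := by nlinarith [sq_nonneg z.1, sq_nonneg z.2]
    rw [e1, e2] at z1; simp at z1
  rcases lt_trichotomy (cr (C.d t a1) (C.d t a2)) 0 with h0 | h0 | h0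
  · exact (h2.2.2.2.2 a1 h1.a1 (by rw [cr_comm]; linarith) (cr_trans p1 hzz q2 z1 z2')).elim
  · refine eq_of_d (eq_of_cr_zero (ud h1.a1) (ud h2.a1) h0 ?_)
    by_contra hneg
    have key : dt z z * dt (C.d t a1) (C.d t a2) = dt z (C.d t a1) * dt z (C.d t a2) +
      cr (C.d t a1) z * cr (C.d t a2) z := by simp only [cr, dt]; ring
    have : 0 < dt z z * dt (C.d t a1) (C.d t a2) := by rw [key]; positivity
    nlinarith
  · exact (h1.2.2.2.2 a2 h2.a1 h0 (cr_trans p2 hzz q1 z2 z1')).elim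

end Cfg
end MS


namespace MS

lemma dt_chain {a b c : ℝ × ℝ} (ha : dt a a = 1) (hb : dt b b = 1) (hc : dt c c = 1)
    (h1 : 0.99 ≤ dt a b) (h2 : 0.99 ≤ dt b c) : 0.95 ≤ dt a c := by
  rw [dt_frame hb]
  have u1 := unit_frame hb ha
  have u2 := unit_frame hb hc
  rw [dt_comm a b] at h1
  nlinarith [sq_nonneg (cr b a + cr b c)]

lemma dt_anti {a b c : ℝ × ℝ} (ha : dt a a = 1) (hb : dt b b = 1) (hc : dt c c = 1)
    {k : ℝ} (hk : k ≤ -0.9) (h1 : 0.9999 ≤ dt a b) (h2 : dt b c ≤ k) : dt a c < k + 0.01 := by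
  rw [dt_frame hb]
  have u1 := unit_frame hb ha
  have u2 := unit_frame hb hc
  rw [dt_comm a b] at h1
  have l1 := unit_le_one u1
  have l2 := unit_le_one u2
  have a1 : cr b a ^ 2 ≤ 0.0002 := by nlinarith
  have a2 : cr b c ^ 2 ≤ 0.19 := by nlinarith
  have a3 : cr b a * cr b c ≤ 0.0065 := by
    nlinarith [sq_nonneg (31 * cr b a - cr b c)]
  nlinarith

lemma between {p q r : ℝ × ℝ} (hp : dt p p = 1) (hq : dt q q = 1) (hr : dt r r = 1)
    (h1 : 0 < dt p q) (h2 : 0 < dt p r) (h3 : 0 ≤ cr p q) (h4 : 0 ≤ cr q r) :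
    dt p r ≤ dt p q := by
  have u1 := unit_frame hp hq
  have u2 := unit_frame hp hr
  rw [cr_frame hp q r] at h4
  by_contra h
  push Not at h
  have : cr p r ≥ cr p q := by
    have : 0 ≤ cr p r := by
      by_contra h'
      push Not at h'
      nlinarith [mul_nonneg h3 h2.le]
    nlinarith
  have h5 : cr p r < cr p q ∨ cr p q ≤ 0 := by
    by_contra h'
    push Not at h'
    nlinarith
  rcases h5 with h5 | h5
  · linarith
  · have : cr p q = 0 := by linarith
    rw [this] at u1
    nlinarith

lemma between' {p q r : ℝ × ℝ} (hp : dt p p = 1) (hq : dt q q = 1) (hr : dt r r = 1)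
    (h1 : 0 < dt q r) (h2 : 0 < dt p r) (h3 : 0 ≤ cr p q) (h4 : 0 ≤ cr q r) :
    dt p r ≤ dt q r := by
  have := between (p := (r.1, -r.2)) (q := (q.1, -q.2)) (r := (p.1, -p.2))
  simp only [dt, cr] at *
  linarith [this (by linarith) (by linarith) (by linarith) (by linarith) (by linarith)
    (by linarith) (by linarith)]

lemma half_mono {a b t1 t2 : ℝ} (h1 : a ^ 2 + b ^ 2 = 1) (h2 : t1 ^ 2 + t2 ^ 2 = 1)
    (hb : 0 < b) (ht : 0 < t2) (h : 0 ≤ t1 * b - t2 * a) : a ≤ t1 := by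
  by_contra hlt
  push Not at hlt
  rcases le_or_gt 0 t1 with h0 | h0
  · have : b < t2 := by nlinarith
    nlinarith
  · rcases le_or_gt 0 a with h3 | h3
    · nlinarith
    · have : t2 < b := by nlinarith
      nlinarith

namespace Cfg
variable {V : Type} {C : Cfg V}

lemma G2a {v q t x : V} (hq : C.adj v q) (ht : C.adj v t) (h0 : 0 < cr (C.d v q) (C.d v t))
    (hx : C.adj q x) (hn : C.near (C.d q v) (C.d q x)) (hc : cr (C.d q v) (C.d q x) < 0)
    (hm : cr (C.d v x) (C.d v t) ≤ 0) : False := by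
  have he := ud hq
  have hg := ud hx
  have hT := ud ht
  rw [d_neg v q] at hn hc
  rw [cr_neg_l] at hc
  have nn := near_coord (by rw [dt_neg_l, dt_neg_r, neg_neg]; exact he) hg hn
  rw [dt_neg_l, cr_neg_l] at nn
  have hp : C.d v x = C.d v q + C.d q x := by simp [d]
  rw [hp, cr_add_l, cr_frame he (C.d q x)] at hm
  have ug := unit_frame he hg
  have uT := unit_frame he hT
  have key := nox ht hx
  rw [cr_frame he (C.d v t) (C.d q x)] at key
  generalize dt (C.d v q) (C.d q x) = g1 at *
  generalize cr (C.d v q) (C.d q x) = g2 at *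
  generalize dt (C.d v q) (C.d v t) = t1 at *
  generalize cr (C.d v q) (C.d v t) = t2 at *
  obtain ⟨a1, a2, a3, a4, a5, a6⟩ := nn
  have lT := unit_le_one uT
  have ht1 : 0 ≤ t1 := by
    by_contra h
    push Not at h
    nlinarith
  have e1 : 1 - t1 ≤ t2 := by nlinarith
  refine key ?_ (by linarith) ?_ h0.le ?_
  · nlinarith
  · nlinarith
  · nlinarith

lemma G2 {v q t : V} (hq : C.adj v q) (ht : C.adj v t) (h0 : 0 < cr (C.d v q) (C.d v t))
    (h1 : 0.04 ≤ dt (C.d v q) (C.d v t)) (hR : C.R q v) : False := by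
  obtain ⟨x, hx, hn, hc⟩ := hR
  refine G2a hq ht h0 hx hn hc ?_
  have he := ud hq
  have hg := ud hx
  have hT := ud ht
  rw [d_neg v q] at hn hc
  rw [cr_neg_l] at hc
  have nn := near_coord (by rw [dt_neg_l, dt_neg_r, neg_neg]; exact he) hg hn
  rw [dt_neg_l, cr_neg_l] at nn
  have hp : C.d v x = C.d v q + C.d q x := by simp [d]
  rw [hp, cr_add_l, cr_frame he (C.d q x)]
  have uT := unit_le_one (unit_frame he hT)
  nlinarith [nn.2.2.1, nn.2.2.2.2.2, nn.2.2.2.2.1]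

lemma cwmost [Finite V] {v q : V} (hq : C.adj v q) : ∃ t, C.adj v t ∧ C.near (C.d v q) (C.d v t) ∧
    0 ≤ cr (C.d v t) (C.d v q) ∧
    ∀ y, C.adj v y → C.near (C.d v q) (C.d v y) → 0 ≤ cr (C.d v t) (C.d v y) := by
  obtain ⟨t, ⟨ht1, ht2⟩, hmin⟩ := Set.exists_min_image
    {x | C.adj v x ∧ C.near (C.d v q) (C.d v x)} (fun x => cr (C.d v q) (C.d v x))
    (Set.toFinite _) ⟨q, hq, near_self hq⟩
  have h0 := hmin q ⟨hq, near_self hq⟩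
  rw [cr_self] at h0
  refine ⟨t, ht1, ht2, by rw [cr_comm]; linarith, ?_⟩
  intro y hy hny
  have h1 := hmin y ⟨hy, hny⟩
  have he := ud hq
  rw [cr_frame he]
  have ut := unit_frame he (ud ht1)
  have uy := unit_frame he (ud hy)
  have p1 := near_pos ht2
  have p2 := near_pos hny
  generalize cr (C.d v q) (C.d v t) = t2 at *
  generalize dt (C.d v q) (C.d v t) = t1 at *
  generalize cr (C.d v q) (C.d v y) = y2 at *
  generalize dt (C.d v q) (C.d v y) = y1 at *
  rcases le_or_gt 0 y2 with h | h
  · nlinarith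
  · have : t1 ≤ y1 := by nlinarith
    nlinarith

lemma corner [Finite V] {v q1 q2 : V} (hX : ¬ C.X v) (h1 : C.NL v q1) (h2 : C.NL v q2)
    (hd : -0.95 ≤ dt (C.d v q1) (C.d v q2)) (hc : 0 < cr (C.d v q1) (C.d v q2)) :
    C.Bent v := by
  obtain ⟨t, ht, hnt, hct, hmin⟩ := cwmost h2.1
  have e1 := ud h1.1
  have e2 := ud h2.1
  have et := ud ht
  have hnn : ¬ C.near (C.d v q1) (C.d v q2) := by
    intro h
    have := NL_near h1 h2 h
    rw [this, cr_self] at hc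
    exact lt_irrefl _ hc
  have u2 := unit_frame e1 e2
  have ut := unit_frame e1 et
  have hntp := near_pos hnt
  have hcr : 0 < cr (C.d v q1) (C.d v t) := by
    by_contra hneg
    push Not at hneg
    have h3 := dt_frame e1 (C.d v q2) (C.d v t)
    have hβ : cr (C.d v q1) (C.d v q2) < 0.0142 := by
      nlinarith [sq_nonneg (dt (C.d v q1) (C.d v q2) - dt (C.d v q1) (C.d v t))]
    have hα : 0.99 < dt (C.d v q1) (C.d v q2) := by
      by_contra h'
      push Not at h'
      nlinarith
    have h4 : 0.95 ≤ dt (C.d v q1) (C.d v t) := dt_chain e1 e2 et hα.le (by linarith)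
    apply hnn
    have h5 := between' et e1 e2 (by linarith) (by rw [dt_comm]; linarith)
      (by rw [cr_comm]; linarith) hc.le
    unfold near at *
    rw [dt_comm] at h5
    linarith
  have hdd : dt (C.d v q1) (C.d v q2) ≤ dt (C.d v q1) (C.d v t) := by
    rw [cr_frame e1] at hct
    exact half_mono u2 ut hc hcr hct
  refine ⟨q1, t, h1, ⟨ht, ?_⟩, hcr, by linarith⟩
  rintro ⟨y, hy, hny, hcy⟩
  have ey := ud hy
  by_cases hy2 : C.near (C.d v q2) (C.d v y)
  · have := hmin y hy hy2
    linarith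
  by_cases hy1 : C.near (C.d v q1) (C.d v y)
  · have hLy : cr (C.d v q1) (C.d v y) ≤ 0 := by
      by_contra h
      push Not at h
      exact h1.2 ⟨y, hy, hy1, h⟩
    have n1 := near_pos hy1
    have n2 := near_pos hny
    rw [dt_comm] at n2
    have h5 := dt_chain e1 ey et (by linarith) (by linarith)
    have h6 := between' ey e1 et (by linarith) (by linarith) (by rw [cr_comm]; linarith) hcr.le
    refine h1.2 ⟨t, ht, ?_, hcr⟩
    unfold near at *
    rw [dt_comm] at hny
    linarith
  · exact hX ⟨q1, q2, y, h1.1, h2.1, hy, hnn, hy1, hy2⟩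

lemma goodStruct [Finite V] {v : V} (h : ¬ C.B v) :
    (∀ x y, C.adj v x → C.adj v y → C.near (C.d v x) (C.d v y) ∨ dt (C.d v x) (C.d v y) < -0.9) ∧
    (∀ x, C.adj v x → ∃ y, C.adj v y ∧ dt (C.d v x) (C.d v y) < -0.9) := by
  have hX : ¬ C.X v := fun h' => h (Or.inl (Or.inl h'))
  have hLow : ¬ C.Low v := fun h' => h (Or.inl (Or.inr (Or.inl h')))
  have hBent : ¬ C.Bent v := fun h' => h (Or.inr h')
  unfold Low at hLow
  push Not at hLow
  obtain ⟨⟨x, y, hxy, hx, hy⟩, -⟩ := hLow hX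
  have hnn : ¬ C.near (C.d v x) (C.d v y) := fun h' => hxy (NL_near hx hy h')
  have hdt : dt (C.d v x) (C.d v y) < -0.95 := by
    by_contra hge
    push Not at hge
    rcases lt_trichotomy (cr (C.d v x) (C.d v y)) 0 with h0 | h0 | h0
    · exact hBent (corner hX hy hx (by rw [dt_comm]; exact hge) (by rw [cr_comm]; linarith))
    · have u := unit_frame (ud hx.1) (ud hy.1)
      rw [h0] at u
      apply hnn
      unfold near
      have : dt (C.d v x) (C.d v y) = 1 := by nlinarith
      rw [this]; linarith [C.hη0]
    · exact hBent (corner hX hx hy hge h0)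
  have ex := ud hx.1
  have ey := ud hy.1
  have hall : ∀ z, C.adj v z → C.near (C.d v z) (C.d v x) ∨ C.near (C.d v z) (C.d v y) := by
    intro z hz
    by_contra hcon
    push Not at hcon
    exact hX ⟨z, x, y, hz, hx.1, hy.1, hcon.1, hcon.2, hnn⟩
  have hdt' : dt (C.d v y) (C.d v x) < -0.95 := by rw [dt_comm]; exact hdt
  have notnear : ∀ {a b : ℝ × ℝ}, dt a b < 0 → ¬ C.near a b := by
    intro a b hab hn
    linarith [near_pos hn]
  have aux : ∀ x y z w, C.adj v x → C.adj v y → C.adj v z → C.adj v w →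
      dt (C.d v x) (C.d v y) < -0.95 → C.near (C.d v z) (C.d v x) → C.near (C.d v w) (C.d v x) →
      C.near (C.d v z) (C.d v w) := by
    intro x y z w hx hy hz hw h0 h1 h2
    by_contra hcon
    have p1 := near_pos h1
    have p2 := near_pos h2
    exact hX ⟨z, w, y, hz, hw, hy, hcon,
      notnear (by linarith [dt_anti (ud hz) (ud hx) (ud hy) (by norm_num : (-0.95:ℝ) ≤ -0.9) (by linarith) h0.le]),
      notnear (by linarith [dt_anti (ud hw) (ud hx) (ud hy) (by norm_num : (-0.95:ℝ) ≤ -0.9) (by linarith) h0.le])⟩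
  constructor
  · intro z w hz hw
    rcases hall z hz with h1 | h1 <;> rcases hall w hw with h2 | h2
    · exact Or.inl (aux x y z w hx.1 hy.1 hz hw hdt h1 h2)
    · right
      have k1 := dt_anti (ud hz) ex ey (by norm_num : (-0.95:ℝ) ≤ -0.9)
        (by linarith [near_pos h1]) hdt.le
      rw [dt_comm] at k1
      have k2 := dt_anti (ud hw) ey (ud hz) (by norm_num : (-0.95 + 0.01:ℝ) ≤ -0.9)
        (by linarith [near_pos h2]) k1.le
      rw [dt_comm]
      linarith
    · right
      have k1 := dt_anti (ud hz) ey ex (by norm_num : (-0.95:ℝ) ≤ -0.9)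
        (by linarith [near_pos h1]) hdt'.le
      rw [dt_comm] at k1
      have k2 := dt_anti (ud hw) ex (ud hz) (by norm_num : (-0.95 + 0.01:ℝ) ≤ -0.9)
        (by linarith [near_pos h2]) k1.le
      rw [dt_comm]
      linarith
    · exact Or.inl (aux y x z w hy.1 hx.1 hz hw hdt' h1 h2)
  · intro z hz
    rcases hall z hz with h1 | h1
    · exact ⟨y, hy.1, by
        linarith [dt_anti (ud hz) ex ey (by norm_num : (-0.95:ℝ) ≤ -0.9)
          (by linarith [near_pos h1]) hdt.le]⟩
    · exact ⟨x, hx.1, by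
        linarith [dt_anti (ud hz) ey ex (by norm_num : (-0.95:ℝ) ≤ -0.9)
          (by linarith [near_pos h1]) hdt'.le]⟩

end Cfg
end MS


namespace MS

lemma exit1 {f0 f1 : ℝ} (h0 : 0 < f0) (h1 : f1 ≤ 0) :
    ∃ l, 0 < l ∧ l ≤ 1 ∧ f0 + l * (f1 - f0) = 0 ∧ ∀ m, 0 ≤ m → m ≤ l → 0 ≤ f0 + m * (f1 - f0) := by
  have hd : 0 < f0 - f1 := by linarith
  refine ⟨f0 / (f0 - f1), by positivity, ?_, ?_, ?_⟩
  · rw [div_le_one hd]; linarith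
  · field_simp; ring
  · intro m _ h
    rw [le_div_iff₀ hd] at h
    linarith

lemma affpos {f0 f1 m : ℝ} (h0 : 0 < f0) (h1 : 0 < f1) (hm : 0 ≤ m) (hm1 : m ≤ 1) :
    0 < f0 + m * (f1 - f0) := by
  rcases hm.eq_or_lt with h | h
  · rw [← h]; linarith
  · nlinarith [mul_pos h h1, mul_nonneg (sub_nonneg.2 hm1) h0.le]

lemma exit2 {f0 f1 g0 g1 : ℝ} (hf : 0 < f0) (hg : 0 < g0) (h : f1 ≤ 0 ∨ g1 ≤ 0) :
    ∃ l, 0 < l ∧ l ≤ 1 ∧ (f0 + l * (f1 - f0) = 0 ∨ g0 + l * (g1 - g0) = 0) ∧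
      ∀ m, 0 ≤ m → m ≤ l → 0 ≤ f0 + m * (f1 - f0) ∧ 0 ≤ g0 + m * (g1 - g0) := by
  rcases le_or_gt f1 0 with h1 | h1
  · obtain ⟨l, a1, a2, a3, a4⟩ := exit1 hf h1
    rcases le_or_gt g1 0 with h2 | h2
    · obtain ⟨l', b1, b2, b3, b4⟩ := exit1 hg h2
      rcases le_total l l' with hl | hl
      · exact ⟨l, a1, a2, Or.inl a3, fun m m0 m1 => ⟨a4 m m0 m1, b4 m m0 (m1.trans hl)⟩⟩
      · exact ⟨l', b1, b2, Or.inr b3, fun m m0 m1 => ⟨a4 m m0 (m1.trans hl), b4 m m0 m1⟩⟩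
    · exact ⟨l, a1, a2, Or.inl a3, fun m m0 m1 => ⟨a4 m m0 m1, (affpos hg h2 m0 (m1.trans a2)).le⟩⟩
  · have h2 : g1 ≤ 0 := by rcases h with h | h <;> linarith
    obtain ⟨l', b1, b2, b3, b4⟩ := exit1 hg h2
    exact ⟨l', b1, b2, Or.inr b3, fun m m0 m1 => ⟨(affpos hf h1 m0 (m1.trans b2)).le, b4 m m0 m1⟩⟩

lemma exit3 {f0 f1 g0 g1 h0 h1 : ℝ} (hf : 0 < f0) (hg : 0 < g0) (hh : 0 < h0)
    (h : f1 ≤ 0 ∨ g1 ≤ 0 ∨ h1 ≤ 0) :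
    ∃ l, 0 < l ∧ l ≤ 1 ∧
      (f0 + l * (f1 - f0) = 0 ∨ g0 + l * (g1 - g0) = 0 ∨ h0 + l * (h1 - h0) = 0) ∧
      0 ≤ f0 + l * (f1 - f0) ∧ 0 ≤ g0 + l * (g1 - g0) ∧ 0 ≤ h0 + l * (h1 - h0) := by
  by_cases hfg : f1 ≤ 0 ∨ g1 ≤ 0
  · obtain ⟨l, a1, a2, a3, a4⟩ := exit2 hf hg hfg
    rcases le_or_gt h1 0 with k | k
    · obtain ⟨l', b1, b2, b3, b4⟩ := exit1 hh k
      rcases le_total l l' with hl | hl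
      · exact ⟨l, a1, a2, by tauto, (a4 l a1.le le_rfl).1, (a4 l a1.le le_rfl).2, b4 l a1.le hl⟩
      · exact ⟨l', b1, b2, by tauto, (a4 l' b1.le hl).1, (a4 l' b1.le hl).2, b4 l' b1.le le_rfl⟩
    · exact ⟨l, a1, a2, by tauto, (a4 l a1.le le_rfl).1, (a4 l a1.le le_rfl).2,
        (affpos hh k a1.le a2).le⟩
  · push Not at hfg
    have k : h1 ≤ 0 := by rcases h with h | h | h <;> linarith
    obtain ⟨l', b1, b2, b3, b4⟩ := exit1 hh k
    exact ⟨l', b1, b2, by tauto, (affpos hf hfg.1 b1.le b2).le, (affpos hg hfg.2 b1.le b2).le,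
      b4 l' b1.le le_rfl⟩

lemma tri_diam {a c z y : ℝ × ℝ} (ha : dt a a = 1) (hc : dt c c = 1) (hg : 1 / 2 ≤ dt a c)
    (hg1 : dt a c ≤ 1)
    (z1 : 0 < cr a z) (z2 : 0 < cr z c) (z3 : cr a z + cr z c < cr a c)
    (y1 : 0 ≤ cr a y) (y2 : 0 ≤ cr y c) (y3 : cr a y + cr y c ≤ cr a c) :
    dt (z - y) (z - y) < 1 := by
  have hD : 0 < cr a c := by linarith
  have key : cr a c ^ 2 * dt (z - y) (z - y) = (cr z c - cr y c) ^ 2 * dt a a +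
      (cr a z - cr a y) ^ 2 * dt c c + 2 * (cr z c - cr y c) * (cr a z - cr a y) * dt a c := by
    simp only [cr, dt, Prod.fst_sub, Prod.snd_sub]; ring
  rw [ha, hc] at key
  set u := cr z c - cr y c with hu
  set v := cr a z - cr a y with hv
  set g := dt a c
  set D := cr a c
  have b1 : u < D := by linarith
  have b2 : -D < u := by linarith
  have b3 : v < D := by linarith
  have b4 : -D < v := by linarith
  have b5 : u + v < D := by linarith
  have b6 : -D < u + v := by linarith
  have hlt : u ^ 2 * 1 + v ^ 2 * 1 + 2 * u * v * g < D ^ 2 := by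
    rcases le_or_gt 0 (u * v) with h | h
    · nlinarith
    · have : u ^ 2 * 1 + v ^ 2 * 1 + 2 * u * v * g ≤ u ^ 2 + v ^ 2 + u * v := by nlinarith
      rcases le_total 0 u with hu' | hu'
      · have hv' : v < 0 := by
          by_contra hcon
          push Not at hcon
          nlinarith
        rcases le_total u (-v) with k | k
        · nlinarith
        · nlinarith
      · have hv' : 0 < v := by
          by_contra hcon
          push Not at hcon
          nlinarith
        rcases le_total (-u) v with k | k
        · nlinarith
        · nlinarith
  by_contra hcon
  push Not at hcon
  nlinarith [sq_nonneg D]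

lemma pt_on {a c w : ℝ × ℝ} (hD : 0 < cr a c) :
    w = (cr w c / cr a c) • a + (cr a w / cr a c) • c := by
  have := hD.ne'
  ext
  · simp only [Prod.fst_add, Prod.smul_fst, smul_eq_mul]
    field_simp
    simp only [cr]; ring
  · simp only [Prod.snd_add, Prod.smul_snd, smul_eq_mul]
    field_simp
    simp only [cr]; ring

namespace Cfg
variable {V : Type} {C : Cfg V}

/-- an edge with an end inside a gap triangle leaves through the base -/
lemma exitBase {t a c z x : V} (hg : C.Gap t a c) (hz : C.In t a c (C.P z)) (hzx : C.adj z x) :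
    ∃ l m : ℝ, 0 < l ∧ l < 1 ∧ 0 < m ∧ m < 1 ∧ C.d a z + l • C.d z x = m • C.d a c := by
  have hD := hg.pos
  have ea := ud hg.a1
  have ec := ud hg.a2
  have hn := near_coord ea ec hg.near
  obtain ⟨z1, z2, z3⟩ := hz
  change 0 < cr (C.d t a) (C.d t z) at z1
  change 0 < cr (C.d t z) (C.d t c) at z2
  change cr (C.d t a) (C.d t z) + cr (C.d t z) (C.d t c) < _ at z3
  have far : ∀ y : ℝ × ℝ, 0 ≤ cr (C.d t a) y → 0 ≤ cr y (C.d t c) →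
      cr (C.d t a) y + cr y (C.d t c) ≤ cr (C.d t a) (C.d t c) →
      dt (C.d t z - y) (C.d t z - y) < 1 := fun y h1 h2 h3 =>
    tri_diam ea ec (by linarith [hn.1]) hn.2.1 z1 z2 z3 h1 h2 h3
  have hxz : dt (C.d t z - C.d t x) (C.d t z - C.d t x) = 1 := by
    have : C.d t z - C.d t x = C.d x z := by simp [d]
    rw [this]; exact ud (C.symm hzx)
  have hnot : cr (C.d t a) (C.d t x) ≤ 0 ∨ cr (C.d t x) (C.d t c) ≤ 0 ∨
      cr (C.d t a) (C.d t c) - (cr (C.d t a) (C.d t x) + cr (C.d t x) (C.d t c)) ≤ 0 := by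
    by_contra hcon
    push Not at hcon
    have := far (C.d t x) hcon.1.le hcon.2.1.le (by linarith [hcon.2.2])
    linarith
  obtain ⟨l, l0, l1, hor, q1, q2, q3⟩ := exit3 z1 z2 (by linarith : 0 < cr (C.d t a) (C.d t c) -
    (cr (C.d t a) (C.d t z) + cr (C.d t z) (C.d t c))) hnot
  -- the exit point
  set y : ℝ × ℝ := C.d t z + l • C.d z x with hy
  have hx' : C.d t x = C.d t z + C.d z x := by simp [d]
  have y1 : cr (C.d t a) y = cr (C.d t a) (C.d t z) +
      l * (cr (C.d t a) (C.d t x) - cr (C.d t a) (C.d t z)) := by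
    rw [hy, hx']; simp only [cr_add_r, cr_smul_r]; ring
  have y2 : cr y (C.d t c) = cr (C.d t z) (C.d t c) +
      l * (cr (C.d t x) (C.d t c) - cr (C.d t z) (C.d t c)) := by
    rw [hy, hx']; simp only [cr_add_l, cr_smul_l]; ring
  rw [← y1] at q1 hor
  rw [← y2] at q2 hor
  have y3 : cr (C.d t a) y + cr y (C.d t c) ≤ cr (C.d t a) (C.d t c) := by
    rw [y1, y2]; linarith
  have l1' : l < 1 := by
    have := far y q1 q2 y3
    rw [hy] at this
    have h2 : C.d t z - (C.d t z + l • C.d z x) = (-l) • C.d z x := by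
      rw [neg_smul]; abel
    rw [h2, dt_smul_l, dt_smul_r, ud hzx] at this
    nlinarith
  have hyp := pt_on (w := y) hD
  have hza : z ≠ a := by
    rintro rfl
    rw [cr_self] at z1; exact lt_irrefl _ z1
  have hzc : z ≠ c := by
    rintro rfl
    rw [cr_self] at z2; exact lt_irrefl _ z2
  have hzt : z ≠ t := by
    rintro rfl
    have : C.d z z = 0 := by simp [d]
    rw [this] at z1; simp [cr] at z1
  have f1 : 0 < cr (C.d t a) y := by
    rcases lt_or_eq_of_le q1 with h | h
    · exact h
    exfalso
    rw [← h] at hyp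
    rw [zero_div, zero_smul, add_zero] at hyp
    have := C.nc hzx hg.a1 (fun h => hzt h.1) (fun h => hza h.1) l
      (cr y (C.d t c) / cr (C.d t a) (C.d t c)) l0.le l1 (div_nonneg q2 hD.le)
      (by rw [div_le_one hD]; linarith) (by
        have h5 : C.d t z + l • C.d z x = (cr y (C.d t c) / cr (C.d t a) (C.d t c)) • C.d t a := by
          rw [← hyp]
        unfold d at h5 ⊢
        rw [← h5]; abel)
    rcases this.1 with h | h <;> linarith
  have f2 : 0 < cr y (C.d t c) := by
    rcases lt_or_eq_of_le q2 with h | h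
    · exact h
    exfalso
    rw [← h] at hyp
    rw [zero_div, zero_smul, zero_add] at hyp
    have := C.nc hzx hg.a2 (fun h => hzt h.1) (fun h => hzc h.1) l
      (cr (C.d t a) y / cr (C.d t a) (C.d t c)) l0.le l1 (div_nonneg q1 hD.le)
      (by rw [div_le_one hD]; linarith) (by
        have h5 : C.d t z + l • C.d z x = (cr (C.d t a) y / cr (C.d t a) (C.d t c)) • C.d t c := by
          rw [← hyp]
        unfold d at h5 ⊢
        rw [← h5]; abel)
    rcases this.1 with h | h <;> linarith
  have f3 : cr (C.d t a) y + cr y (C.d t c) = cr (C.d t a) (C.d t c) := by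
    rcases hor with h | h | h
    · linarith
    · linarith
    · rw [y1, y2]; linarith
  refine ⟨l, cr (C.d t a) y / cr (C.d t a) (C.d t c), l0, l1', by positivity,
    by rw [div_lt_one hD]; linarith, ?_⟩
  have h6 : cr y (C.d t c) / cr (C.d t a) (C.d t c) =
      1 - cr (C.d t a) y / cr (C.d t a) (C.d t c) := by
    field_simp; linarith
  rw [h6] at hyp
  have h7 : C.d a z = C.d t z - C.d t a := by simp [d]
  have h8 : C.d a c = C.d t c - C.d t a := by simp [d]
  have h9 : C.d a z + l • C.d z x = y - C.d t a := by rw [h7, hy]; abel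
  rw [h9, h8]
  nth_rw 1 [hyp]
  rw [sub_smul, one_smul, smul_sub]; abel

lemma exitBase_cr {t a c z x : V} (hg : C.Gap t a c) (hz : C.In t a c (C.P z))
    (hzx : C.adj z x) : 0 < cr (C.d z x) (C.d a c) := by
  obtain ⟨l, m, l0, l1, m0, m1, h⟩ := exitBase hg hz hzx
  obtain ⟨z1, z2, z3⟩ := hz
  have e1 : cr (C.d a z) (C.d a c) + l * cr (C.d z x) (C.d a c) = 0 := by
    rw [← cr_smul_l, ← cr_add_l, h, cr_smul_l, cr_self, mul_zero]
  have e2 : cr (C.d a z) (C.d a c) = cr (C.d t a) (C.P z - C.P t) +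
      cr (C.P z - C.P t) (C.d t c) - cr (C.d t a) (C.d t c) := by
    simp only [cr, d, Prod.fst_sub, Prod.snd_sub]; ring
  by_contra hcon
  push Not at hcon
  nlinarith

end Cfg
end MS


namespace MS

lemma two_eq {u v x y : ℝ × ℝ} (h : cr u v ≠ 0) (h1 : cr u x = cr u y) (h2 : cr v x = cr v y) :
    x = y := by
  simp only [cr] at *
  ext
  · have : (u.1 * v.2 - u.2 * v.1) * (x.1 - y.1) = 0 := by linear_combination v.1 * h1 - u.1 * h2
    rcases mul_eq_zero.1 this with h' | h'
    · exact absurd h' h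
    · linarith
  · have : (u.1 * v.2 - u.2 * v.1) * (x.2 - y.2) = 0 := by linear_combination v.2 * h1 - u.2 * h2
    rcases mul_eq_zero.1 this with h' | h'
    · exact absurd h' h
    · linarith

lemma g4a {c S w1 w2 : ℝ} (s0 : 0 < S) (s1 : S < 0.015) (c0 : 0 ≤ c) (c1 : c ≤ S ^ 2)
    (ug : (1 - c) ^ 2 + S ^ 2 = 1) (uw : w1 ^ 2 + w2 ^ 2 = 1) (h1 : 0 < w1 * S - w2 * c)
    (hcon : w2 < -(w1 * S - w2 * c)) : S < -w2 := by
  by_contra hle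
  push Not at hle
  have hc' : 0.99 < 1 - c := by nlinarith
  have hw2 : w2 < 0 := by linarith
  have hww : (1 - c) ^ 2 ≤ w1 ^ 2 := by nlinarith
  rcases le_total 0 w1 with h0 | h0
  · have h2 : 1 - c ≤ w1 := by
      by_contra h; push Not at h; nlinarith
    have h3 : (1 - c) * S ≤ w1 * S := by nlinarith
    have h4 : w1 * S < (-w2) * (1 - c) := by linarith
    have h5 : (-w2) * (1 - c) ≤ S * (1 - c) := by nlinarith
    linarith
  · have h2 : w1 ≤ -(1 - c) := by
      by_contra h; push Not at h; nlinarith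
    have h3 : w1 * S ≤ -0.99 * S := by nlinarith
    have h4 : -w2 * c ≤ S * c := by nlinarith
    have h5 : S * c ≤ S * 0.01 := by nlinarith
    linarith

lemma g4b {c S w1 w2 k p1 T : ℝ} (s0 : 0 < S) (s1 : S < 0.015) (c0 : 0 ≤ c) (c1 : c ≤ S ^ 2)
    (uw : w1 ^ 2 + w2 ^ 2 = 1) (hk : 0 < k) (j1 : 0.29 * T < p1) (j2 : k < T)
    (hg : c * w2 - S * w1 ≤ w2) (hw : 0 < w1 * k - w2 * p1) : 0.25 ≤ w1 ∧ -0.02 ≤ w2 := by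
  have lw := unit_le_one uw
  have hc' : c < 0.001 := by nlinarith
  have hw2 : -0.02 ≤ w2 := by
    by_contra h
    push Not at h
    have : c * w2 ≥ 0.001 * w2 := by nlinarith
    have : S * w1 ≤ 0.015 := by nlinarith
    nlinarith
  refine ⟨?_, hw2⟩
  by_contra hlt
  push Not at hlt
  rcases le_total 0 w2 with h0 | h0
  · have h1 : 0 ≤ w2 * p1 := by nlinarith
    have hp : 0 ≤ w1 := by
      by_contra h
      push Not at h
      nlinarith
    have h2 : 0.96 < w2 := by nlinarith
    have h3 : w1 * k ≤ 0.25 * T := by nlinarith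
    have h4 : 0.96 * (0.29 * T) ≤ w2 * p1 := by nlinarith
    nlinarith
  · have h1 : w1 < -0.9 := by
      by_contra h
      push Not at h
      nlinarith
    have h2 : c * w2 ≥ S ^ 2 * w2 := by nlinarith
    have h3 : -S * w1 > 0.9 * S := by nlinarith
    have h4 : w1 * k < -0.9 * k := by nlinarith
    have h5 : S ^ 2 * w2 ≥ - S * 0.015 := by nlinarith
    nlinarith

namespace Cfg
variable {V : Type} {C : Cfg V}

lemma nv_line {t b x : V} (h : C.adj t b) (s : ℝ) (s0 : 0 < s) (s1 : s < 1)
    (hw : C.d t x = s • C.d t b) : False := by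
  refine C.nv (w := x) h s s0 s1 ?_
  unfold d at hw
  rw [← hw]; abel

/-- two thin triangles at a common corner overlap -/
lemma G3 {a q t a' b : V} (hqa : C.adj q a') (htb : C.adj t b)
    (hA : 0 < cr (C.d a b) (C.d a a')) (hBq : 0 < cr (C.d a q) (C.d a a'))
    (hBt : 0 < cr (C.d a b) (C.d a t)) (hm : 0 < cr (C.d a a') (C.d a t))
    (hk : 0 < cr (C.d a q) (C.d a b)) : C.In t a b (C.P a') ∨ C.In q a' a (C.P b) := by
  have pl : cr (C.d a q) (C.d a a') * cr (C.d a b) (C.d a t) -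
      cr (C.d a q) (C.d a b) * cr (C.d a a') (C.d a t) =
      cr (C.d a q) (C.d a t) * cr (C.d a b) (C.d a a') := by simp only [cr]; ring
  have hD : cr (C.d q a') (C.d t b) = cr (C.d a q) (C.d a t) - cr (C.d a b) (C.d a a') -
      cr (C.d a a') (C.d a t) - cr (C.d a q) (C.d a b) := by
    simp only [cr, d, Prod.fst_sub, Prod.snd_sub]; ring
  have hs : cr (C.d q t) (C.d t b) = cr (C.d a q) (C.d a t) - cr (C.d a b) (C.d a t) -
      cr (C.d a q) (C.d a b) := by
    simp only [cr, d, Prod.fst_sub, Prod.snd_sub]; ring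
  have ht : cr (C.d q t) (C.d q a') = cr (C.d a q) (C.d a t) - cr (C.d a a') (C.d a t) -
      cr (C.d a q) (C.d a a') := by
    simp only [cr, d, Prod.fst_sub, Prod.snd_sub]; ring
  by_contra hcon
  push Not at hcon
  obtain ⟨n1, n2⟩ := hcon
  have i1 : cr (C.d a b) (C.d a t) ≤ cr (C.d a a') (C.d a t) + cr (C.d a b) (C.d a a') := by
    by_contra h
    push Not at h
    apply n1
    refine ⟨?_, ?_, ?_⟩ <;> simp only [cr, d, Prod.fst_sub, Prod.snd_sub] at * <;> linarith
  have i2 : cr (C.d a q) (C.d a a') ≤ cr (C.d a b) (C.d a a') + cr (C.d a q) (C.d a b) := by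
    by_contra h
    push Not at h
    apply n2
    refine ⟨?_, ?_, ?_⟩ <;> simp only [cr, d, Prod.fst_sub, Prod.snd_sub] at * <;> linarith
  have i1' : cr (C.d a b) (C.d a t) < cr (C.d a a') (C.d a t) + cr (C.d a b) (C.d a a') := by
    rcases i1.lt_or_eq with h | h
    · exact h
    exfalso
    refine nv_line (x := a') htb (cr (C.d a a') (C.d a t) / cr (C.d a b) (C.d a t))
      (by positivity) (by rw [div_lt_one hBt]; linarith) ?_
    refine two_eq hBt.ne' ?_ ?_
    · rw [cr_smul_r]; field_simp
      rw [show C.d t a' = C.d a a' - C.d a t by simp [d], show C.d t b = C.d a b - C.d a t by simp [d]]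
      simp only [cr_sub_r, cr_self]
      rw [h]; ring
    · rw [cr_smul_r]; field_simp
      rw [show C.d t a' = C.d a a' - C.d a t by simp [d], show C.d t b = C.d a b - C.d a t by simp [d]]
      simp only [cr_sub_r, cr_self]
      rw [cr_comm (C.d a t) (C.d a a'), cr_comm (C.d a t) (C.d a b)]; ring
  have i2' : cr (C.d a q) (C.d a a') < cr (C.d a b) (C.d a a') + cr (C.d a q) (C.d a b) := by
    rcases i2.lt_or_eq with h | h
    · exact h
    exfalso
    refine nv_line (x := b) hqa (cr (C.d a q) (C.d a b) / cr (C.d a q) (C.d a a'))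
      (by positivity) (by rw [div_lt_one hBq]; linarith) ?_
    refine two_eq hBq.ne' ?_ ?_
    · rw [cr_smul_r]; field_simp
      rw [show C.d q b = C.d a b - C.d a q by simp [d], show C.d q a' = C.d a a' - C.d a q by simp [d]]
      simp only [cr_sub_r, cr_self]; ring
    · rw [cr_smul_r]; field_simp
      rw [show C.d q b = C.d a b - C.d a q by simp [d], show C.d q a' = C.d a a' - C.d a q by simp [d]]
      simp only [cr_sub_r, cr_self]
      rw [cr_comm (C.d a a') (C.d a b), cr_comm (C.d a a') (C.d a q), h]; ring
  have key := nox' hqa htb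
  rw [hD, hs, ht] at key
  generalize cr (C.d a q) (C.d a a') = Bq at *
  generalize cr (C.d a b) (C.d a t) = Bt at *
  generalize cr (C.d a a') (C.d a t) = m at *
  generalize cr (C.d a q) (C.d a b) = k at *
  generalize cr (C.d a b) (C.d a a') = A at *
  generalize cr (C.d a q) (C.d a t) = E at *
  have hE1 : E < Bt + k := by
    refine lt_of_mul_lt_mul_right (a := A) ?_ hA.le
    nlinarith [mul_pos (sub_pos.2 i2') hBt, mul_pos (sub_pos.2 i1') hk]
  have hE2 : E < Bq + m := by
    refine lt_of_mul_lt_mul_right (a := A) ?_ hA.le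
    nlinarith [mul_pos (sub_pos.2 i1') hBq, mul_pos (sub_pos.2 i2') hm]
  exact key (by linarith) (by linarith) (by linarith) (by linarith) (by linarith)

/-- frame coordinates of the two thin triangles at `a` -/
lemma thin_q {a q a' : V} (h : C.Gap q a' a) :
    0 < cr (C.d a q) (C.d a a') ∧ cr (C.d a q) (C.d a a') < 0.015 ∧
    0 ≤ dt (C.d a q) (C.d a a') ∧ dt (C.d a q) (C.d a a') ≤ cr (C.d a q) (C.d a a') ^ 2 ∧
    (1 - dt (C.d a q) (C.d a a')) ^ 2 + cr (C.d a q) (C.d a a') ^ 2 = 1 := by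
  have e := ud (C.symm h.a2)
  have n := near_coord (ud h.a2) (ud h.a1) (near_symm h.near)
  have u := unit_frame (ud h.a2) (ud h.a1)
  have p := h.pos
  have c1 : cr (C.d a q) (C.d a a') = - cr (C.d q a) (C.d q a') := by
    simp only [cr, d, Prod.fst_sub, Prod.snd_sub]; ring
  have c2 : dt (C.d a q) (C.d a a') = 1 - dt (C.d q a) (C.d q a') := by
    rw [← e]; simp only [dt, d, Prod.fst_sub, Prod.snd_sub]; ring
  rw [cr_comm] at p
  rw [c1, c2]
  refine ⟨by linarith, by linarith [n.2.2.1], n.2.2.2.2.1, by nlinarith [n.2.2.2.2.2], by nlinarith⟩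

lemma thin_t {a t b : V} (h : C.Gap t a b) :
    0 < cr (C.d a b) (C.d a t) ∧ cr (C.d a b) (C.d a t) < 0.015 ∧
    0 ≤ dt (C.d a t) (C.d a b) ∧ dt (C.d a t) (C.d a b) ≤ cr (C.d a b) (C.d a t) ^ 2 := by
  have h' := (mir_Gap t b a).2 h
  obtain ⟨h1, h2, h3, h4, -⟩ := thin_q h'
  rw [mir_cr, mir_dt] at *
  rw [cr_comm (C.d a b) (C.d a t)]
  exact ⟨h1, h2, h3, h4⟩

lemma G4pos {a q t a' b : V} (hq : C.Gap q a' a) (ht : C.Gap t a b)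
    (hc : 0 < cr (C.d a q) (C.d a t)) (hd : -0.95 ≤ dt (C.d a q) (C.d a t)) :
    0 < cr (C.d a b) (C.d a a') ∧ 0 < cr (C.d a a') (C.d a t) ∧ 0 < cr (C.d a q) (C.d a b) ∧
    dt (C.d a q) (C.d a t) < 0.05 ∧
    0.29 * cr (C.d a b) (C.d a t) < dt (C.d a q) (C.d a b) ∧
    cr (C.d a q) (C.d a b) < cr (C.d a b) (C.d a t) := by
  have aq := C.symm hq.a2
  have at' := C.symm ht.a1
  have hd2 : dt (C.d a q) (C.d a t) < 0.05 := by
    by_contra h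
    push Not at h
    exact G2 aq at' hc (by linarith) hq.R
  have hm : 0 < cr (C.d a a') (C.d a t) := by
    by_contra h
    push Not at h
    exact G2a aq at' hc hq.a1 (near_symm hq.near) (by rw [cr_comm]; linarith [hq.pos]) h
  have hk : 0 < cr (C.d a q) (C.d a b) := by
    by_contra h
    push Not at h
    refine G2a (C := C.mir) (v := a) (q := t) (t := q) (x := b) at' aq ?_ ht.a2
      ((mir_near _ _ _ _).2 ht.near) ?_ ?_
    · rw [mir_cr, ← cr_comm]; exact hc
    · rw [mir_cr]; linarith [ht.pos]
    · rw [mir_cr, ← cr_comm]; exact h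
  obtain ⟨s0, s1, c0, c1, -⟩ := thin_q hq
  obtain ⟨s0', s1', c0', c1'⟩ := thin_t ht
  have e := ud aq
  have eT := ud at'
  have uT := unit_frame e eT
  have t2 : 0.31 < cr (C.d a q) (C.d a t) := by nlinarith
  have k1 : dt (C.d a q) (C.d a b) = dt (C.d a t) (C.d a b) * dt (C.d a q) (C.d a t) +
      cr (C.d a b) (C.d a t) * cr (C.d a q) (C.d a t) := by
    have := dt_frame eT (C.d a q) (C.d a b)
    rw [this, dt_comm (C.d a q) (C.d a t), cr_comm (C.d a t) (C.d a q),
      cr_comm (C.d a t) (C.d a b)]; ring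
  have k2 : cr (C.d a q) (C.d a b) = dt (C.d a t) (C.d a b) * cr (C.d a q) (C.d a t) -
      cr (C.d a b) (C.d a t) * dt (C.d a q) (C.d a t) := by
    have := cr_frame eT (C.d a q) (C.d a b)
    rw [this, dt_comm (C.d a q) (C.d a t), cr_comm (C.d a t) (C.d a q),
      cr_comm (C.d a t) (C.d a b)]; ring
  have l := unit_le_one uT
  have k3 := cr_frame e (C.d a b) (C.d a a')
  have j1 : 0.29 * cr (C.d a b) (C.d a t) < dt (C.d a q) (C.d a b) := by
    rw [k1]; nlinarith
  have j2 : cr (C.d a q) (C.d a b) < cr (C.d a b) (C.d a t) := by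
    rw [k2]; nlinarith
  refine ⟨?_, hm, hk, hd2, j1, j2⟩
  rw [k3]
  nlinarith [mul_pos s0 s0']

lemma G4edge {a q t a' b x : V} (hq : C.Gap q a' a) (ht : C.Gap t a b)
    (hc : 0 < cr (C.d a q) (C.d a t)) (hd : -0.95 ≤ dt (C.d a q) (C.d a t))
    (hin : C.In t a b (C.P a')) (hx : C.adj a' x) :
    0.25 ≤ dt (C.d a q) (C.d a' x) ∧ -0.02 ≤ cr (C.d a q) (C.d a' x) := by
  obtain ⟨hA, hm, hk, hd2, j1, j2⟩ := G4pos hq ht hc hd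
  obtain ⟨s0, s1, c0, c1, ug⟩ := thin_q hq
  have aq := C.symm hq.a2
  have e := ud aq
  have uw := unit_frame e (ud hx)
  have hw := exitBase_cr ht hin hx
  obtain ⟨l, m, l0, l1, m0, m1, hlm⟩ := exitBase ht hin hx
  have h1 : 0 < cr (C.d a' x) (C.d a a') := by
    have : cr (C.d a' x) (C.d a a') = m * cr (C.d a' x) (C.d a b) := by
      rw [← cr_smul_r, ← hlm, cr_add_r, cr_smul_r, cr_self]; ring
    rw [this]; positivity
  -- cr g w ≥ 0
  have hg : cr (C.d a a') (C.d a' x) ≤ cr (C.d a q) (C.d a' x) := by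
    by_contra hcon
    push Not at hcon
    have key := nox hx aq
    have r1 : cr (C.d a' a) (C.d a q) = cr (C.d a q) (C.d a a') := by
      rw [d_neg a a', cr_neg_l, ← cr_comm]
    have r2 : cr (C.d a' a) (C.d a' x) = cr (C.d a' x) (C.d a a') := by
      rw [d_neg a a', cr_neg_l, ← cr_comm]
    rw [r1, r2, cr_comm (C.d a' x) (C.d a q)] at key
    rw [cr_comm (C.d a a') (C.d a' x)] at hcon
    have q1 := cr_frame e (C.d a' x) (C.d a a')
    rw [q1] at key hcon h1
    generalize cr (C.d a q) (C.d a' x) = w2 at *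
    generalize dt (C.d a q) (C.d a' x) = w1 at *
    generalize cr (C.d a q) (C.d a a') = S at *
    generalize dt (C.d a q) (C.d a a') = c at *
    refine key (by linarith) s0 ?_ h1.le (by linarith)
    exact g4a s0 s1 c0 c1 ug uw h1 hcon
  rw [cr_frame e (C.d a a') (C.d a' x)] at hg
  rw [cr_frame e (C.d a' x) (C.d a b)] at hw
  have lw := unit_le_one uw
  generalize cr (C.d a q) (C.d a' x) = w2 at *
  generalize dt (C.d a q) (C.d a' x) = w1 at *
  generalize cr (C.d a q) (C.d a a') = S at *
  generalize dt (C.d a q) (C.d a a') = c at *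
  generalize cr (C.d a q) (C.d a b) = k at *
  generalize dt (C.d a q) (C.d a b) = p1 at *
  generalize cr (C.d a b) (C.d a t) = S' at *
  exact g4b s0 s1 c0 c1 uw hk j1 j2 hg hw

lemma G4 {a q t a' b : V} (hq : C.Gap q a' a) (ht : C.Gap t a b)
    (hc : 0 < cr (C.d a q) (C.d a t)) (hd : -0.95 ≤ dt (C.d a q) (C.d a t))
    (hin : C.In t a b (C.P a')) : C.B0 a' := by
  by_contra hB
  have hX : ¬ C.X a' := fun h' => hB (Or.inl h')
  have hLow : ¬ C.Low a' := fun h' => hB (Or.inr (Or.inl h'))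
  have hW : ∀ x, ¬ C.W x a' := fun x h' => hB (Or.inr (Or.inr ⟨x, Or.inr h'⟩))
  unfold Low at hLow
  push Not at hLow
  obtain ⟨⟨x, y, hxy, hx, hy⟩, -⟩ := hLow hX
  have e := ud (C.symm hq.a2)
  have hdt : ∀ x y, C.adj a' x → C.adj a' y → 0.04 ≤ dt (C.d a' x) (C.d a' y) := by
    intro x y hx hy
    obtain ⟨x1, hx2⟩ := G4edge hq ht hc hd hin hx
    obtain ⟨y1, hy2⟩ := G4edge hq ht hc hd hin hy
    have lx := unit_le_one (unit_frame e (ud hx))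
    have ly := unit_le_one (unit_frame e (ud hy))
    rw [dt_frame e]
    generalize cr (C.d a q) (C.d a' x) = x2 at *
    generalize cr (C.d a q) (C.d a' y) = y2 at *
    have : -0.02 ≤ x2 * y2 := by
      rcases le_total 0 x2 with h | h <;> rcases le_total 0 y2 with h' | h' <;> nlinarith
    nlinarith
  have hRx : ∀ x, C.NL a' x → C.R x a' := by
    intro x hx
    by_contra h
    exact hW x ⟨C.symm hx.1, h, hx.2⟩
  rcases lt_trichotomy (cr (C.d a' x) (C.d a' y)) 0 with h0 | h0 | h0
  · exact G2 hy.1 hx.1 (by rw [cr_comm]; linarith) (hdt _ _ hy.1 hx.1) (hRx y hy)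
  · exact hxy (eq_of_d (eq_of_cr_zero (ud hx.1) (ud hy.1) h0 (by linarith [hdt _ _ hx.1 hy.1])))
  · exact G2 hx.1 hy.1 h0 (hdt _ _ hx.1 hy.1) (hRx x hx)

/-- a bent vertex which is not basic bad has a basic bad vertex near it -/
lemma bent_charge [Finite V] {v : V} (hB : C.Bent v) (h0 : ¬ C.B0 v) :
    (∃ q b, C.Gap q b v ∧ C.B0 b) ∨ (∃ t b, C.Gap t v b ∧ C.B0 b) := by
  obtain ⟨q, t, hq, ht, hc, hd⟩ := hB
  have hW : ∀ x, ¬ C.W x v ∧ ¬ C.W v x := fun x =>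
    ⟨fun h' => h0 (Or.inr (Or.inr ⟨x, Or.inr h'⟩)), fun h' => h0 (Or.inr (Or.inr ⟨x, Or.inl h'⟩))⟩
  have hR : C.R q v := by
    by_contra h
    exact (hW q).1 ⟨C.symm hq.1, h, hq.2⟩
  have hL : C.L t v := by
    by_contra h
    exact (hW t).2 ⟨ht.1, ht.2, h⟩
  obtain ⟨a', ga⟩ := gap_of_R (C.symm hq.1) hR
  obtain ⟨b, gb⟩ := gap_of_L (C.symm ht.1) hL
  obtain ⟨hA, hm, hk, -⟩ := G4pos ga gb hc hd
  rcases G3 ga.a1 gb.a2 hA (thin_q ga).1 (thin_t gb).1 hm hk with h | h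
  · exact Or.inl ⟨q, a', ga, G4 ga gb hc hd h⟩
  · refine Or.inr ⟨t, b, gb, ?_⟩
    rw [← mir_B0]
    refine G4 (C := C.mir) (a := v) (q := t) (t := q) (a' := b) (b := a') ((mir_Gap _ _ _).2 gb)
      ((mir_Gap _ _ _).2 ga) ?_ ?_ ((mir_In _ _ _ _).2 h)
    · rw [mir_cr, ← cr_comm]; exact hc
    · rw [mir_dt, dt_comm]; exact hd

end Cfg
end MS


namespace MS

lemma prod_lb {x y ε : ℝ} (he : 0 ≤ ε) (x0 : -ε ≤ x) (x1 : x ≤ 1) (y0 : -ε ≤ y) (y1 : y ≤ 1) :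
    -ε ≤ x * y := by
  rcases le_total 0 x with k | k
  · rcases le_total 0 y with k' | k'
    · nlinarith
    · have : x * (-y) ≤ 1 * ε := mul_le_mul x1 (by linarith) (by linarith) (by linarith)
      linarith
  · rcases le_total 0 y with k' | k'
    · have : (-x) * y ≤ ε * 1 := mul_le_mul (by linarith) y1 (by linarith) (by linarith)
      linarith
    · nlinarith [mul_nonneg (neg_nonneg.2 k) (neg_nonneg.2 k')]

lemma prod_abs {x y a b : ℝ} (ha : |x| ≤ a) (hb : |y| ≤ b) : |x * y| ≤ a * b := by
  rw [abs_mul]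
  exact mul_le_mul ha hb (abs_nonneg _) ((abs_nonneg _).trans ha)

lemma g6b {w1 w2 q1 q2 c1 c2 l m : ℝ} (hw2 : w2 ≤ -0.88) (hq1 : 0.9 < q1)
    (l0 : 0 < l) (m0 : 0 < m) (m1 : m < 1) (hl2 : l < 0.02) (hp : 0 < c2)
    (uw : w1 ^ 2 + w2 ^ 2 = 1) (uq : q1 ^ 2 + q2 ^ 2 = 1) (n4 : c2 < 0.015) (n5 : 0 ≤ 1 - c1)
    (n6 : 1 - c1 ≤ c2 ^ 2) (hcr : 0 < w1 * c2 - w2 * (c1 - 1)) :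
    0.55 ≤ w1 * q2 - w2 * q1 ∧
    0 < l * (w1 * q2 - w2 * q1) - m * ((c1 - 1) * q2 - c2 * q1) ∧
    l * (w1 * q2 - w2 * q1) - m * ((c1 - 1) * q2 - c2 * q1) < w1 * q2 - w2 * q1 ∧
    m * (w1 * c2 - w2 * (c1 - 1)) ≤ w1 * q2 - w2 * q1 := by
  have lw := unit_le_one uw
  have lq := unit_le_one uq
  have hq2 : |q2| ≤ 0.44 := by apply abs_le_of_sq_le_sq _ (by norm_num); nlinarith
  have hw1 : |w1| ≤ 0.48 := by apply abs_le_of_sq_le_sq _ (by norm_num); nlinarith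
  have h1 := abs_le.1 (prod_abs hw1 hq2)
  have h2 : -w2 * q1 ≥ 0.88 * 0.9 := mul_le_mul (by linarith) hq1.le (by norm_num) (by linarith)
  have hD : 0.55 ≤ w1 * q2 - w2 * q1 := by linarith
  have hcc : c2 ^ 2 ≤ 0.015 * c2 := by rw [sq]; exact mul_le_mul_of_nonneg_right n4.le hp.le
  have hc1 : |c1 - 1| ≤ 0.015 * c2 := by rw [abs_le]; constructor <;> linarith
  have h3 := abs_le.1 (prod_abs hc1 hq2)
  have h4 : c2 * 0.9 < c2 * q1 := mul_lt_mul_of_pos_left hq1 hp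
  have h5 : c2 * q1 ≤ c2 * 1 := mul_le_mul_of_nonneg_left lq.2.1 hp.le
  have hb : 0 < -((c1 - 1) * q2 - c2 * q1) := by linarith
  have hb2 : -((c1 - 1) * q2 - c2 * q1) < 0.02 := by linarith
  have hw2a : |w2| ≤ 1 := abs_le.2 ⟨lw.2.2.1, lw.2.2.2⟩
  have h6 := abs_le.1 (prod_abs hw2a hc1)
  have h7 : w1 * c2 ≤ 1 * c2 := mul_le_mul_of_nonneg_right lw.2.1 hp.le
  have hb3 : w1 * c2 - w2 * (c1 - 1) < 0.02 := by linarith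
  have m2 : m * -((c1 - 1) * q2 - c2 * q1) ≤ 1 * -((c1 - 1) * q2 - c2 * q1) :=
    mul_le_mul_of_nonneg_right m1.le hb.le
  have m3 := mul_pos m0 hb
  have l3 := mul_pos l0 (by linarith : 0 < w1 * q2 - w2 * q1)
  have l4 : l * (w1 * q2 - w2 * q1) ≤ 0.02 * (w1 * q2 - w2 * q1) :=
    mul_le_mul_of_nonneg_right hl2.le (by linarith)
  have m4 : m * (w1 * c2 - w2 * (c1 - 1)) ≤ 1 * (w1 * c2 - w2 * (c1 - 1)) :=
    mul_le_mul_of_nonneg_right m1.le hcr.le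
  exact ⟨hD, by linarith, by linarith, by linarith⟩

lemma g6a {x1 x2 y1 y2 c1 c2 : ℝ} (ux : x1 ^ 2 + x2 ^ 2 = 1) (uy : y1 ^ 2 + y2 ^ 2 = 1)
    (c0 : 0 < c2) (c3 : c2 < 0.015) (c4 : 0 ≤ 1 - c1) (c5 : 1 - c1 ≤ c2 ^ 2)
    (h : x1 * y1 + x2 * y2 < -0.9) (hx : 0 < x1 * c2 - x2 * (c1 - 1))
    (hy : 0 < y1 * c2 - y2 * (c1 - 1)) : x2 ≤ -0.88 ∨ y2 ≤ -0.88 := by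
  have lx := unit_le_one ux
  have ly := unit_le_one uy
  have hx1 : -0.015 < x1 := by
    by_contra hc
    push Not at hc
    have : x2 * (1 - c1) ≤ c2 ^ 2 := by nlinarith
    nlinarith
  have hy1 : -0.015 < y1 := by
    by_contra hc
    push Not at hc
    have : y2 * (1 - c1) ≤ c2 ^ 2 := by nlinarith
    nlinarith
  have h1 : -0.015 ≤ x1 * y1 := by
    exact prod_lb (by norm_num) hx1.le lx.2.1 hy1.le ly.2.1
  have h2 : x2 * y2 < -0.88 := by linarith
  rcases le_total 0 x2 with k | k
  · right
    by_contra hc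
    push Not at hc
    nlinarith
  · left
    by_contra hc
    push Not at hc
    nlinarith

namespace Cfg
variable {V : Type} {C : Cfg V}

lemma oppNR [Finite V] {v p : V} (h : ¬ C.B v) (hp : C.adj v p) :
    ∃ t, C.NR v t ∧ dt (C.d v p) (C.d v t) < -0.9 := by
  obtain ⟨g1, g2⟩ := goodStruct h
  obtain ⟨t0, ht0, hd0⟩ := g2 p hp
  obtain ⟨t, ht, hnt, -, hmin⟩ := cwmost ht0
  have hpos := near_pos hnt
  refine ⟨t, ⟨ht, ?_⟩, ?_⟩
  · rintro ⟨y, hy, hny, hcy⟩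
    rcases g1 t0 y ht0 hy with k | k
    · linarith [hmin y hy k]
    · have := dt_chain (ud ht0) (ud ht) (ud hy) (by linarith) (by linarith [near_pos hny])
      linarith
  · rcases g1 p t hp ht with k | k
    · have := near_pos k
      rw [dt_comm] at hpos
      have := dt_chain (ud hp) (ud ht) (ud ht0) (by linarith) (by linarith)
      linarith
    · exact k

lemma G6core {t a c z x q : V} (hg : C.Gap t a c) (hz : C.In t a c (C.P z)) (hx : C.adj z x)
    (hw2 : cr (C.d t a) (C.d z x) ≤ -0.88) (hq : C.adj a q)
    (hq1 : 0.9 < dt (C.d t a) (C.d a q)) : False := by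
  have e := ud hg.a1
  obtain ⟨l, m, l0, l1, m0, m1, hlm⟩ := exitBase hg hz hx
  have hcr := exitBase_cr hg hz hx
  have n := near_coord e (ud hg.a2) hg.near
  have hp := hg.pos
  have uw := unit_frame e (ud hx)
  have uq := unit_frame e (ud hq)
  have k1 : cr (C.d z a) (C.d z x) = m * cr (C.d z x) (C.d a c) := by
    rw [← cr_smul_r, ← hlm, cr_add_r, cr_smul_r, cr_self, d_neg a z, cr_neg_l, ← cr_comm]; ring
  have k2 : cr (C.d z a) (C.d a q) = l * cr (C.d z x) (C.d a q) - m * cr (C.d a c) (C.d a q) := by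
    rw [← cr_smul_l, ← cr_smul_l m, ← hlm, cr_add_l, d_neg a z, cr_neg_l]; ring
  have hac : C.d a c = C.d t c - C.d t a := by simp [d]
  have c1 : dt (C.d t a) (C.d a c) = dt (C.d t a) (C.d t c) - 1 := by
    rw [hac, dt_sub_r, e]
  have c2 : cr (C.d t a) (C.d a c) = cr (C.d t a) (C.d t c) := by
    rw [hac, cr_sub_r, cr_self, sub_zero]
  -- bound on l
  obtain ⟨z1, z2, z3⟩ := hz
  change 0 < cr (C.d t a) (C.d t z) at z1
  have hl : cr (C.d t a) (C.d t z) + l * cr (C.d t a) (C.d z x) = m * cr (C.d t a) (C.d t c) := by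
    have : C.d t z = C.d a z + C.d t a := by simp [d]
    rw [this, cr_add_r, cr_self, add_zero, ← cr_smul_r, ← cr_add_r, hlm, cr_smul_r, c2]
  change cr (C.d t a) (C.d t z) + cr (C.d t z) (C.d t c) < _ at z3
  change 0 < cr (C.d t z) (C.d t c) at z2
  have hl2 : l < 0.02 := by
    have h1 := mul_pos m0 hp
    have h2 : l * -(cr (C.d t a) (C.d z x)) ≥ l * 0.88 :=
      mul_le_mul_of_nonneg_left (by linarith) l0.le
    linarith [n.2.2.2.1]
  have key := nox hx hq
  rw [k1, k2, cr_frame e (C.d z x) (C.d a q), cr_frame e (C.d z x) (C.d a c),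
    cr_frame e (C.d a c) (C.d a q), c1, c2] at key
  rw [cr_frame e (C.d z x) (C.d a c), c1, c2] at hcr
  obtain ⟨f1, f2, f3, f4⟩ := g6b hw2 hq1 l0 m0 m1 hl2 hp uw uq n.2.2.2.1 n.2.2.2.2.1 n.2.2.2.2.2 hcr
  exact key (by linarith) f2 f3 (mul_pos m0 hcr).le f4

lemma G6 [Finite V] {t a c z q : V} (hg : C.Gap t a c) (hz : C.In t a c (C.P z))
    (hq : C.adj a q) (hd : dt (C.d a t) (C.d a q) < -0.9) : C.B z := by
  by_contra hB
  obtain ⟨-, g2⟩ := goodStruct hB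
  have hX : ¬ C.X z := fun h' => hB (Or.inl (Or.inl h'))
  have hLow : ¬ C.Low z := fun h' => hB (Or.inl (Or.inr (Or.inl h')))
  unfold Low at hLow
  push Not at hLow
  obtain ⟨⟨x, -, -, hx, -⟩, -⟩ := hLow hX
  obtain ⟨y, hy, hxy⟩ := g2 x hx.1
  have e := ud hg.a1
  have n := near_coord e (ud hg.a2) hg.near
  have hp := hg.pos
  have hac : C.d a c = C.d t c - C.d t a := by simp [d]
  have c1 : dt (C.d t a) (C.d a c) = dt (C.d t a) (C.d t c) - 1 := by
    rw [hac, dt_sub_r, e]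
  have c2 : cr (C.d t a) (C.d a c) = cr (C.d t a) (C.d t c) := by
    rw [hac, cr_sub_r, cr_self, sub_zero]
  have k1 := exitBase_cr hg hz hx.1
  have k2 := exitBase_cr hg hz hy
  rw [cr_frame e, c1, c2] at k1 k2
  rw [dt_frame e] at hxy
  have hq1 : 0.9 < dt (C.d t a) (C.d a q) := by
    rw [d_neg t a, dt_neg_l] at hd; linarith
  rcases g6a (unit_frame e (ud hx.1)) (unit_frame e (ud hy)) hp n.2.2.2.1 n.2.2.2.2.1 n.2.2.2.2.2
    hxy k1 k2 with h | h
  · exact G6core hg hz hx.1 h hq hq1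
  · exact G6core hg hz hy h hq hq1

lemma G6' [Finite V] {t a c z q : V} (hg : C.Gap t a c) (hz : C.In t a c (C.P z))
    (hq : C.adj c q) (hd : dt (C.d c t) (C.d c q) < -0.9) : C.B z := by
  rw [← mir_B]
  exact G6 (C := C.mir) (t := t) (a := c) (c := a) (q := q) ((mir_Gap _ _ _).2 hg)
    ((mir_In _ _ _ _).2 hz) hq (by rw [mir_dt]; exact hd)

end Cfg
end MS


namespace MS

lemma abs_of_sq_sum {x y k l : ℝ} (h : x ^ 2 + y ^ 2 = 1) (hx : x < -k) (k0 : 0 ≤ k) (l0 : 0 ≤ l)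
    (hkl : 1 ≤ k ^ 2 + l ^ 2) : |y| ≤ l := by
  apply abs_le_of_sq_le_sq _ l0
  nlinarith

lemma line_of_cr {T z : ℝ × ℝ} (h : dt T T = 1) (h0 : cr z T = 0) : z = dt T z • T := by
  simp only [cr, dt] at *
  ext
  · simp only [Prod.smul_fst, smul_eq_mul]
    linear_combination (-z.1) * h + T.2 * h0
  · simp only [Prod.smul_snd, smul_eq_mul]
    linear_combination (-z.2) * h - T.1 * h0

/-- cross product bound for a thin vector -/
lemma thin_lb {c S x : ℝ} (c0 : 0 ≤ c) (c1 : c ≤ S ^ 2) (s0 : 0 < S) (s1 : S < 0.015)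
    (hx : |x| ≤ 1) : |c * x| ≤ 0.015 * S := by
  have h : c ≤ 0.015 * S := by nlinarith
  have := prod_abs (abs_le.2 ⟨by linarith, h⟩ : |c| ≤ 0.015 * S) hx
  linarith

lemma thin_bd {c S x y k : ℝ} (c0 : 0 ≤ c) (c1 : c ≤ S ^ 2) (s0 : 0 < S) (s1 : S < 0.015)
    (hx : |x| ≤ 1) (y0 : k + 0.02 ≤ y) : k * S < c * x + S * y := by
  have := abs_le.1 (thin_lb c0 c1 s0 s1 hx)
  have : (k + 0.02) * S ≤ y * S := mul_le_mul_of_nonneg_right y0 s0.le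
  linarith

lemma thin_le {c S x y : ℝ} (c0 : 0 ≤ c) (c1 : c ≤ S ^ 2) (s0 : 0 < S) (s1 : S < 0.015)
    (hx : |x| ≤ 1) (hy : |y| ≤ 1) : |c * x + S * y| ≤ 0.016 := by
  have k : c ≤ 0.001 := by nlinarith
  have h1 := abs_le.1 (prod_abs (abs_le.2 ⟨by linarith, k⟩ : |c| ≤ 0.001) hx)
  have h2 := abs_le.1 (prod_abs (abs_le.2 ⟨by linarith, s1.le⟩ : |S| ≤ 0.015) hy)
  rw [abs_le]; constructor <;> linarith

namespace Cfg
variable {V : Type} {C : Cfg V}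

structure G5H (C : Cfg V) (a q a' t b : V) : Prop where
  gq : C.Gap q a' a
  gt : C.Gap t a b
  opp : dt (C.d a q) (C.d a t) < -0.9

lemma G5H.mir {a q a' t b : V} (h : G5H C a q a' t b) : G5H C.mir a t b q a' :=
  ⟨(mir_Gap _ _ _).2 h.gt, (mir_Gap _ _ _).2 h.gq, by rw [mir_dt, dt_comm]; exact h.opp⟩

lemma abs_unit {x y : ℝ} (h : x ^ 2 + y ^ 2 = 1) : |x| ≤ 1 ∧ |y| ≤ 1 := by
  have := unit_le_one h
  exact ⟨abs_le.2 ⟨this.1, this.2.1⟩, abs_le.2 ⟨this.2.2.1, this.2.2.2⟩⟩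

lemma G5H.m {a q a' t b : V} (h : G5H C a q a' t b) : 0 < cr (C.d a a') (C.d a t) := by
  obtain ⟨s0, s1, c0, c1, -⟩ := thin_q h.gq
  have e := ud (C.symm h.gq.a2)
  have u := abs_unit (unit_frame e (ud (C.symm h.gt.a1)))
  rw [cr_frame e]
  have := thin_bd (k := 0) (y := -dt (C.d a q) (C.d a t)) c0 c1 s0 s1 u.2 (by linarith [h.opp])
  linarith

lemma G5H.k {a q a' t b : V} (h : G5H C a q a' t b) : 0 < cr (C.d a q) (C.d a b) := by
  have := h.mir.m
  rw [mir_cr] at this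
  rw [cr_comm]; exact this

/-- the side vector is to the right of w when w opposes e -/
lemma thin_la {a q a' : V} (h : C.Gap q a' a) {w : ℝ × ℝ} (hw : dt w w = 1)
    (h1 : dt (C.d a q) w < -0.52) : 0.5 * cr (C.d a q) (C.d a a') < cr (C.d a a') w := by
  obtain ⟨s0, s1, c0, c1, -⟩ := thin_q h
  have e := ud (C.symm h.a2)
  have u := abs_unit (unit_frame e hw)
  rw [cr_frame e _ w]
  have := thin_bd (k := 0.5) (y := -dt (C.d a q) w) c0 c1 s0 s1 u.2 (by linarith)
  linarith

lemma thin_lc {a q a' : V} (h : C.Gap q a' a) {w : ℝ × ℝ} (hw : dt w w = 1)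
    (h1 : 0.52 < dt (C.d a q) w) : cr (C.d a a') w < 0 := by
  have := thin_la h (w := -w) (by rw [dt_neg_l, dt_neg_r, hw, neg_neg]) (by rw [dt_neg_r]; linarith)
  rw [cr_neg_r] at this
  have := (thin_q h).1
  linarith

/-- the thin side is short in every direction -/
lemma thin_dir {a t b : V} (h : C.Gap t a b) {e : ℝ × ℝ} (he : dt e e = 1) :
    |dt e (C.d a b)| ≤ 0.016 ∧ |cr e (C.d a b)| ≤ 0.016 := by
  obtain ⟨s0, s1, c0, c1⟩ := thin_t h
  have u := ud (C.symm h.a1)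
  have hu := abs_unit (unit_frame u he)
  have hcc : cr (C.d a t) (C.d a b) = - cr (C.d a b) (C.d a t) := cr_comm _ _
  constructor
  · rw [dt_frame u, hcc]
    have := thin_le c0 c1 s0 s1 hu.1 (y := - cr (C.d a t) e) (by rw [abs_neg]; exact hu.2)
    convert this using 2; ring
  · rw [cr_frame u, hcc]
    have := thin_le c0 c1 s0 s1 (x := - cr (C.d a t) e) (by rw [abs_neg]; exact hu.2)
      (y := - dt (C.d a t) e) (by rw [abs_neg]; exact hu.1)
    convert this using 2; ring

set_option maxHeartbeats 800000 in
lemma E1 {a q a' t b t' : V} (h : G5H C a q a' t b) (hw : C.adj a' t')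
    (hew : dt (C.d a q) (C.d a' t') < -0.89) (hA : cr (C.d a b) (C.d a a') ≤ 0) (hne : a' ≠ b) :
    C.In t a b (C.P t') ∨ 0 < cr (C.d a' t') (C.d a' b) := by
  by_contra hcon
  push Not at hcon
  obtain ⟨hnin, hlb⟩ := hcon
  obtain ⟨s0, s1, c0, c1, -⟩ := thin_q h.gq
  obtain ⟨s0', -, -, -⟩ := thin_t h.gt
  have e := ud (C.symm h.gq.a2)
  have uT := ud (C.symm h.gt.a1)
  have uB := ud h.gt.a2
  have hla := thin_la h.gq (ud hw) (by linarith)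
  have hm := h.m
  have hdl : C.d a' b = C.d a b - C.d a a' := by simp [d]
  have htb : C.d t b = C.d a b - C.d a t := by simp [d]
  have hta : C.d t a = - C.d a t := d_neg _ _
  have hlab : cr (C.d a b) (C.d a' t') = cr (C.d a a') (C.d a' t') - cr (C.d a' t') (C.d a' b) := by
    rw [hdl, cr_sub_r, cr_comm (C.d a' t') (C.d a b), cr_comm (C.d a' t') (C.d a a')]; ring
  have hA2 : - cr (C.d a b) (C.d a a') < 0.5 * cr (C.d a q) (C.d a a') := by
    rw [← cr_comm, cr_frame e]
    have hd := thin_dir h.gt e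
    have h1 := abs_le.1 (thin_lb c0 c1 s0 s1 (x := cr (C.d a q) (C.d a b)) (by linarith [hd.2]))
    have h2 := abs_le.1 (prod_abs (abs_of_pos s0).le hd.1)
    linarith
  have hne1 : a' ≠ a := by
    rintro rfl; simp [d, cr] at s0
  have hne2 : a' ≠ t := by
    rintro rfl; rw [cr_self] at hm; exact lt_irrefl _ hm
  set p := C.d a a' with hp
  set p2 := C.d a b with hp2
  set w := C.d a' t' with hwd
  set T := C.d a t with hT
  have hDpos : 0 < cr p2 w := by linarith
  set D := cr p2 w with hD
  set l0 := -cr p2 p / D with hl0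
  set μ := cr p w / D with hμ
  have hl0n : 0 ≤ l0 := div_nonneg (by linarith) hDpos.le
  have hl01 : l0 < 1 := by rw [hl0, div_lt_one hDpos]; linarith
  have hμ0 : 0 < μ := div_pos (by linarith) hDpos
  have hpt : p + l0 • w = μ • p2 := by
    apply two_eq (u := p2) (v := w) hDpos.ne'
    · rw [cr_add_r, cr_smul_r, cr_smul_r, cr_self, hl0, ← hD]; field_simp; ring
    · rw [cr_add_r, cr_smul_r, cr_smul_r, cr_self, hμ, cr_comm w p, cr_comm w p2, ← hD]; field_simp; ring
  have hPt : ∀ l : ℝ, C.P a' + l • (C.P t' - C.P a') = C.P a + (p + l • w) := by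
    intro l; simp only [hp, hwd, d]; abel
  rcases hlb.eq_or_lt with hlb | hlb
  · have : μ = 1 := by rw [hμ, div_eq_one_iff_eq hDpos.ne']; linarith
    rw [this, one_smul] at hpt
    rcases hl0n.eq_or_lt with h0 | h0
    · apply hne
      rw [← h0, zero_smul, add_zero] at hpt
      exact eq_of_d hpt
    · refine C.nv (w := b) hw l0 h0 hl01 ?_
      rw [hPt, hpt]; simp [hp2, d]
  have hμ1 : μ < 1 := by rw [hμ, div_lt_one hDpos]; linarith
  have hnt : t' ≠ t := by
    rintro rfl
    refine h.gt.2.2.2.2 a' (C.symm hw) ?_ ?_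
    · rw [hta, show C.d t' a' = p - T by simp [hp, hT, d], cr_sub_r, cr_neg_l, cr_neg_l, cr_self,
        ← cr_comm]; linarith
    · rw [htb, show C.d t' a' = p - T by simp [hp, hT, d]]
      rw [hdl, show w = T - p by simp [hwd, hp, hT, d]] at hlb
      simp only [cr_sub_l, cr_sub_r, cr_self] at hlb ⊢
      linarith [cr_comm T p, cr_comm T p2, cr_comm p p2]
  have hPte : ∀ z : ℝ × ℝ, C.P a + z - C.P t = z - T := by
    intro z; simp only [hT, d]; abel
  have hPt' : C.P t' = C.P a + (p + w) := by simp [hp, hwd, d]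
  have hbase : ∀ l : ℝ, cr p2 (p + l • w) = (l - l0) * D := by
    intro l; rw [cr_add_r, cr_smul_r, ← hD, hl0]; field_simp; ring
  have hor : cr (p + w) T ≤ 0 ∨ cr (p + w - T) (p2 - T) ≤ 0 := by
    by_contra hc
    push Not at hc
    apply hnin
    unfold In
    have hb := hbase 1
    rw [one_smul] at hb
    have hb2 : 0 < (1 - l0) * D := mul_pos (by linarith) hDpos
    rw [hPt', hPte, hta, htb]
    refine ⟨?_, hc.2, ?_⟩
    · have := hc.1
      rw [cr_neg_l, cr_sub_r, cr_self]
      linarith [cr_comm (p + w) T]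
    · simp only [cr_sub_l (p + w) T, cr_sub_r, cr_neg_l, cr_self]
      linarith [cr_comm (p + w) T, cr_comm p2 T, cr_comm (p + w) p2]
  have f0 : cr (p + l0 • w) T = μ * cr p2 T := by rw [hpt, cr_smul_l]
  have g0 : cr (p + l0 • w - T) (p2 - T) = (1 - μ) * cr p2 T := by
    rw [hpt]; simp only [cr_sub_l, cr_sub_r, cr_self, cr_smul_l]
    rw [cr_comm T p2]; ring
  obtain ⟨l, hl, hl1, hz, hpos⟩ := exit2 (mul_pos hμ0 s0') (mul_pos (sub_pos.2 hμ1) s0') hor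
  obtain ⟨hf, hg⟩ := hpos l hl.le le_rfl
  set x := l0 + l * (1 - l0) with hx
  have hx0 : l0 < x := by nlinarith
  have hx1 : x ≤ 1 := by nlinarith
  have ef : μ * cr p2 T + l * (cr (p + w) T - μ * cr p2 T) = cr (p + x • w) T := by
    rw [← f0, hx]; simp only [cr_add_l, cr_smul_l]; ring
  have eg : (1 - μ) * cr p2 T + l * (cr (p + w - T) (p2 - T) - (1 - μ) * cr p2 T)
      = cr (p + x • w - T) (p2 - T) := by
    rw [← g0, hx]; simp only [cr_sub_l, cr_sub_r, cr_add_l, cr_smul_l]; ring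
  rw [ef] at hz hf
  rw [eg] at hz hg
  have hb := hbase x
  have hb2 : 0 < (x - l0) * D := mul_pos (by linarith) hDpos
  rw [← hb] at hb2
  rcases hz with hz | hz
  · have hline := line_of_cr uT hz
    set s := dt T (p + x • w)
    rw [hline] at hg hb2
    rw [cr_smul_r] at hb2
    have hs : 0 < s := (mul_pos_iff_of_pos_right s0').1 hb2
    have hs1 : s ≤ 1 := by
      simp only [cr_sub_l, cr_sub_r, cr_self, cr_smul_l] at hg
      have := cr_comm T p2
      rw [this] at hg
      have h1 : 0 ≤ (1 - s) * cr p2 T := by linarith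
      linarith [(mul_nonneg_iff_of_pos_right s0').1 h1]
    have := C.nc hw (C.symm h.gt.a1) (fun h' => hne1 h'.1) (fun h' => hne2 h'.1) x s
      (by linarith) hx1 hs.le hs1 (by rw [hPt, hline]; simp [hT, d])
    have hxe : x = 1 := by rcases this.1 with k | k <;> linarith
    have hse : s = 1 := by rcases this.2 with k | k <;> linarith
    apply hnt
    apply C.inj
    rw [hxe, hse, one_smul, one_smul] at hline
    rw [hPt', hline]; simp [hT, d]
  · rw [← htb] at hz
    have hline := line_of_cr uB hz
    set s := dt (C.d t b) (p + x • w - T)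
    have hline' : p + x • w = T + s • (p2 - T) := by
      rw [← htb, ← hline]; abel
    rw [hline'] at hf hb2
    have hs : 0 ≤ s := by
      simp only [cr_add_l, cr_sub_l, cr_self, cr_smul_l] at hf
      rw [zero_add, sub_zero] at hf
      exact (mul_nonneg_iff_of_pos_right s0').1 hf
    have hs1 : s < 1 := by
      simp only [cr_add_r, cr_sub_r, cr_self, cr_smul_r] at hb2
      have h1 : 0 < (1 - s) * cr p2 T := by linarith
      linarith [(mul_pos_iff_of_pos_right s0').1 h1]
    have := C.nc hw h.gt.a2 (fun h' => hne2 h'.1) (fun h' => hne h'.1) x s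
      (by linarith) hx1 hs hs1.le (by rw [hPt, hline', hp2, hT]; simp only [d, sub_sub_sub_cancel_right]; abel)
    have hxe : x = 1 := by rcases this.1 with k | k <;> linarith
    have hse : s = 0 := by rcases this.2 with k | k <;> linarith
    apply hnt
    apply C.inj
    rw [hxe, hse, one_smul, zero_smul, add_zero] at hline'
    rw [hPt', hline']; simp [hT, d]

lemma cramer {δ w w2 : ℝ × ℝ} (hw : dt w w = 1) (hw2 : dt w2 w2 = 1) (hd : dt w w2 ≤ 0)
    (hδ : dt δ δ < 1) (hD : cr w w2 < 0) (h1 : cr δ w2 < 0) (h2 : cr δ w < 0) :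
    cr w w2 < cr δ w2 ∧ cr w w2 < cr δ w := by
  have key : cr w w2 ^ 2 * dt δ δ = cr δ w2 ^ 2 * dt w w + cr δ w ^ 2 * dt w2 w2 -
      2 * (cr δ w2 * cr δ w) * dt w w2 := by
    simp only [cr, dt]; ring
  rw [hw, hw2] at key
  have h3 := mul_pos_of_neg_of_neg h1 h2
  have h4 : 0 ≤ -(2 * (cr δ w2 * cr δ w) * dt w w2) := by nlinarith
  have h5 : cr w w2 ^ 2 * dt δ δ < cr w w2 ^ 2 * 1 := mul_lt_mul_of_pos_left hδ (by have := hD.ne; positivity)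
  constructor <;> apply lt_of_neg_lt_neg <;> apply lt_of_pow_lt_pow_left₀ 2 (by linarith) <;>
    nlinarith [sq_nonneg (cr δ w2), sq_nonneg (cr δ w)]

lemma G5 [Finite V] {a q a' t b : V} (h : G5H C a q a' t b) (ha' : ¬ C.B a') (hb : ¬ C.B b)
    (e1 : ∀ z, ¬ C.In q a' a (C.P z)) (e2 : ∀ z, ¬ C.In t a b (C.P z)) : a' = b := by
  by_contra hne
  have e := ud (C.symm h.gq.a2)
  have uT := ud (C.symm h.gt.a1)
  rcases lt_or_ge 0 (cr (C.d a b) (C.d a a')) with hA | hA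
  · rcases G3 h.gq.a1 h.gt.a2 hA (thin_q h.gq).1 (thin_t h.gt).1 h.m h.k with k | k
    · exact e2 _ k
    · exact e1 _ k
  obtain ⟨t', ht', hd1⟩ := (goodStruct ha').2 q (C.symm h.gq.a1)
  obtain ⟨q', hq', hd2⟩ := (goodStruct hb).2 t (C.symm h.gt.a2)
  have n1 := near_pos h.gq.near
  have n2 := near_pos h.gt.near
  have hew : dt (C.d a q) (C.d a' t') < -0.89 := by
    have := dt_anti e (ud (C.symm h.gq.a1)) (ud ht') (k := -0.9) le_rfl
      (by rw [d_neg q a, d_neg q a', dt_neg_l, dt_neg_r, neg_neg, dt_comm]; exact n1.le) hd1.le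
    linarith
  have hTw : dt (C.d a t) (C.d b q') < -0.89 := by
    have := dt_anti uT (ud (C.symm h.gt.a2)) (ud hq') (k := -0.9) le_rfl
      (by rw [d_neg t a, d_neg t b, dt_neg_l, dt_neg_r, neg_neg]; exact n2.le) hd2.le
    linarith
  have k1 := (E1 h ht' hew hA hne).resolve_left (e2 _)
  have k2 : 0 < cr (C.d b q') (C.d a' b) := by
    rcases E1 h.mir (t' := q') hq' (by rw [mir_dt]; exact hTw)
      (by rw [mir_cr, ← cr_comm]; exact hA) (Ne.symm hne) with k | k
    · exact absurd ((mir_In _ _ _ _).1 k) (e1 _)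
    · rw [mir_cr, d_neg a' b, cr_neg_r, neg_neg] at k; exact k
  have uw := ud ht'
  have uw2 := ud hq'
  have hla := thin_la h.gq uw (by linarith)
  have s0 := (thin_q h.gq).1
  have i1 := unit_frame uT e
  have i2 := unit_frame uT uw2
  have hopp := h.opp
  rw [dt_comm] at hopp
  have hew2 : 0.6 < dt (C.d a q) (C.d b q') := by
    rw [dt_frame uT]
    have b1 := abs_of_sq_sum i1 (k := 0.9) (l := 0.436) (by linarith) (by norm_num) (by norm_num) (by norm_num)
    have b2 := abs_of_sq_sum i2 (k := 0.89) (l := 0.457) (by linarith) (by norm_num) (by norm_num) (by norm_num)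
    have := abs_le.1 (prod_abs b1 b2)
    have : 0.9 * 0.89 ≤ (-dt (C.d a t) (C.d a q)) * (-dt (C.d a t) (C.d b q')) :=
      mul_le_mul (by linarith) (by linarith) (by norm_num) (by linarith)
    linarith
  have hpw2 := thin_lc h.gq uw2 (by linarith)
  have hww : dt (C.d a' t') (C.d b q') ≤ 0 := by
    rw [dt_frame e]
    have b1 := abs_of_sq_sum (unit_frame e uw) (k := 0.89) (l := 0.457) (by linarith) (by norm_num) (by norm_num) (by norm_num)
    have b2 : |cr (C.d a q) (C.d b q')| ≤ 0.8 := by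
      have := unit_frame e uw2
      apply abs_le_of_sq_le_sq _ (by norm_num); nlinarith
    have := abs_le.1 (prod_abs b1 b2)
    have : 0.89 * 0.6 ≤ (-dt (C.d a q) (C.d a' t')) * (dt (C.d a q) (C.d b q')) :=
      mul_le_mul (by linarith) (by linarith) (by norm_num) (by linarith)
    linarith
  have hdl : C.d a' b = C.d a b - C.d a a' := by simp [d]
  rcases lt_trichotomy (cr (C.d a' t') (C.d b q')) 0 with hD | hD | hD
  · have hs : dt (C.d a' b) (C.d a' b) < 1 := by
      have f1 := thin_dir h.gt e
      have f2 := thin_dir h.mir.gt (e := ((C.d a q).1, -(C.d a q).2)) (by simpa [dt] using e)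
      have g1 : dt ((C.d a q).1, -(C.d a q).2) (C.mir.d a a') = dt (C.d a q) (C.d a a') := by
        simp only [dt, d, mir, Prod.fst_sub, Prod.snd_sub]; ring
      have g2 : cr ((C.d a q).1, -(C.d a q).2) (C.mir.d a a') = - cr (C.d a q) (C.d a a') := by
        simp only [cr, d, mir, Prod.fst_sub, Prod.snd_sub]; ring
      rw [g1, g2, abs_neg] at f2
      rw [dt_frame e, hdl, dt_sub_r, cr_sub_r]
      have a1 := abs_le.1 f1.1
      have a2 := abs_le.1 f1.2
      have a3 := abs_le.1 f2.1
      have a4 := abs_le.1 f2.2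
      have b1 : |dt (C.d a q) (C.d a b) - dt (C.d a q) (C.d a a')| ≤ 0.04 := by
        rw [abs_le]; constructor <;> linarith
      have b2 : |cr (C.d a q) (C.d a b) - cr (C.d a q) (C.d a a')| ≤ 0.04 := by
        rw [abs_le]; constructor <;> linarith
      have := abs_le.1 (prod_abs b1 b1)
      have := abs_le.1 (prod_abs b2 b2)
      linarith
    have q1 : cr (C.d a' b) (C.d b q') < 0 := by rw [cr_comm]; linarith
    have q2 : cr (C.d a' b) (C.d a' t') < 0 := by rw [cr_comm]; linarith
    have cm := cramer uw uw2 hww hs hD q1 q2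
    exact nox' ht' hq' hD q1 cm.1 q2.le cm.2.le
  · have := cr_frame uw (C.d b q') (C.d a' b)
    rw [hD] at this
    nlinarith
  · have key : cr (C.d a' t') (C.d b q') * cr (C.d a a') (C.d a' b) =
        - (cr (C.d b q') (C.d a' b)) * cr (C.d a a') (C.d a' t') +
          cr (C.d a' t') (C.d a' b) * cr (C.d a a') (C.d b q') := by
      simp only [cr]; ring
    have hpd : 0 ≤ cr (C.d a a') (C.d a' b) := by
      rw [hdl, cr_sub_r, cr_self, cr_comm]; linarith
    have z1 := mul_nonneg hD.le hpd
    have z2 := mul_pos k2 (by linarith : 0 < cr (C.d a a') (C.d a' t'))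
    have z3 := mul_neg_of_pos_of_neg k1 hpw2
    linarith

end Cfg
end MS


namespace MS
namespace Cfg
variable {V : Type} {C : Cfg V}

lemma In.coords {t a c : V} {y : ℝ × ℝ} (hy : C.In t a c y) (h : C.Gap t a c) :
    ∃ α β : ℝ, 0 < α ∧ 0 < β ∧ y - C.P t = α • C.d t a + β • C.d t c := by
  obtain ⟨h1, h2, -⟩ := hy
  exact ⟨_, _, div_pos h2 h.pos, div_pos h1 h.pos, pt_on h.pos⟩

lemma dir_base {t a c : V} (h : C.Gap t a c) {e : ℝ × ℝ} (he : dt e e = 1)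
    (hd : 0.95 ≤ dt (C.d t a) e) : 0 < cr e (C.d a c) := by
  have u := ud h.a1
  have n := near_coord u (ud h.a2) h.near
  have hac : C.d a c = C.d t c - C.d t a := by simp [d]
  have c1 : dt (C.d t a) (C.d a c) = dt (C.d t a) (C.d t c) - 1 := by
    rw [hac, dt_sub_r, u]
  have c2 : cr (C.d t a) (C.d a c) = cr (C.d t a) (C.d t c) := by
    rw [hac, cr_sub_r, cr_self, sub_zero]
  rw [cr_frame u, c1, c2]
  have hu := abs_unit (unit_frame u he)
  have := thin_bd (k := 0) (x := cr (C.d t a) e) (y := dt (C.d t a) e) n.2.2.2.2.1 n.2.2.2.2.2 h.pos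
    n.2.2.2.1 hu.2 (by linarith)
  linarith

/-- leaving a thin triangle downwards happens through a side -/
lemma side_exit {t a c : V} {y v : ℝ × ℝ} (h : C.Gap t a c) (hy : C.In t a c y)
    (hv : 0 ≤ cr v (C.d a c)) : C.In t a c (y - v) ∨
    ∃ l s : ℝ, ∃ x, 0 < l ∧ l ≤ 1 ∧ 0 ≤ s ∧ s < 1 ∧ (x = a ∨ x = c) ∧
      y - l • v = C.P t + s • C.d t x := by
  by_cases hin : C.In t a c (y - v)
  · exact Or.inl hin
  right
  obtain ⟨h1, h2, h3⟩ := hy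
  set z := y - C.P t with hz
  have hac : C.d a c = C.d t c - C.d t a := by simp [d]
  rw [hac, cr_sub_r] at hv
  have hsum : ∀ l : ℝ, 0 ≤ l → cr (C.d t a) (z - l • v) + cr (z - l • v) (C.d t c)
      < cr (C.d t a) (C.d t c) := by
    intro l hl
    rw [cr_sub_l, cr_sub_r, cr_smul_l, cr_smul_r, cr_comm (C.d t a) v]
    nlinarith
  have hzv : y - v - C.P t = z - v := by rw [hz]; abel
  have hor : cr (C.d t a) (z - v) ≤ 0 ∨ cr (z - v) (C.d t c) ≤ 0 := by
    by_contra hc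
    push Not at hc
    apply hin
    have := hsum 1 zero_le_one
    rw [one_smul] at this
    unfold In
    rw [hzv]
    exact ⟨hc.1, hc.2, this⟩
  obtain ⟨l, hl, hl1, hzz, hpos⟩ := exit2 h1 h2 hor
  obtain ⟨p1, p2⟩ := hpos l hl.le le_rfl
  have hb := hsum l hl.le
  have e1 : cr (C.d t a) z + l * (cr (C.d t a) (z - v) - cr (C.d t a) z) = cr (C.d t a) (z - l • v) := by
    rw [cr_sub_r z v, cr_sub_r z, cr_smul_r]; ring
  have e2 : cr z (C.d t c) + l * (cr (z - v) (C.d t c) - cr z (C.d t c)) = cr (z - l • v) (C.d t c) := by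
    rw [cr_sub_l z v, cr_sub_l z, cr_smul_l]; ring
  rw [e1] at hzz p1
  rw [e2] at hzz p2
  have hp := h.pos
  have hyl : y - l • v = C.P t + (z - l • v) := by rw [hz]; abel
  rcases hzz with k | k
  · have hl := line_of_cr (ud h.a1) (by rw [cr_comm, k, neg_zero] : cr (z - l • v) (C.d t a) = 0)
    rw [hl] at p2 hb
    rw [cr_smul_l] at p2
    rw [cr_smul_l, cr_smul_r, cr_self] at hb
    refine ⟨l, _, a, by assumption, hl1, (mul_nonneg_iff_of_pos_right hp).1 p2, ?_, Or.inl rfl, ?_⟩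
    · by_contra hc; push Not at hc; nlinarith
    · rw [hyl]; congr 1
  · have hl := line_of_cr (ud h.a2) k
    rw [hl] at p1 hb
    rw [cr_smul_r] at p1
    rw [cr_smul_l, cr_smul_r, cr_self] at hb
    refine ⟨l, _, c, by assumption, hl1, (mul_nonneg_iff_of_pos_right hp).1 p1, ?_, Or.inr rfl, ?_⟩
    · by_contra hc; push Not at hc; nlinarith
    · rw [hyl]; congr 1

lemma In.shrink {t a c : V} {y : ℝ × ℝ} (hy : C.In t a c y) (h : C.Gap t a c) {l : ℝ} (l0 : 0 < l) (l1 : l ≤ 1) :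
    C.In t a c (C.P t + l • (y - C.P t)) := by
  obtain ⟨h1, h2, h3⟩ := hy
  unfold In
  rw [add_sub_cancel_left, cr_smul_l, cr_smul_r]
  refine ⟨by positivity, by positivity, ?_⟩
  nlinarith [h.pos]

lemma dirs {t a c t2 a2 c2 x x2 : V} (h : C.Gap t a c) (h2 : C.Gap t2 a2 c2)
    (hn : 0.9999 < dt (C.d t a) (C.d t2 a2)) (hx : x = a ∨ x = c) (hx2 : x2 = a2 ∨ x2 = c2) :
    0.94 < dt (C.d t x) (C.d t2 x2) ∧ (x = a → 0.95 ≤ dt (C.d t x) (C.d t2 x2)) := by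
  have n1 := near_pos h.near
  have n2 := near_pos h2.near
  have u1 := ud h.a1
  have u2 := ud h.a2
  have u3 := ud h2.a1
  have u4 := ud h2.a2
  rw [dt_comm] at n1
  have k2 := dt_chain u1 u3 u4 (by linarith) (by linarith)
  have k3 := dt_chain u2 u1 u3 (by linarith) (by linarith)
  have k4 : 0.94 < dt (C.d t c) (C.d t2 c2) := by
    have := dt_anti (c := -C.d t2 a2) u2 u1 (by rw [dt_neg_l, dt_neg_r, u3, neg_neg]) (k := -0.9999)
      (by norm_num) (by linarith) (by rw [dt_neg_r]; linarith)
    rw [dt_neg_r] at this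
    have h5 : 0.9899 < dt (C.d t c) (C.d t2 a2) := by linarith
    have := dt_anti (a := C.d t2 c2) (b := C.d t2 a2) (c := -C.d t c) u4 u3 (by rw [dt_neg_l, dt_neg_r, u2, neg_neg]) (k := -0.9899)
      (by norm_num) (by rw [dt_comm]; linarith) (by rw [dt_neg_r, dt_comm]; linarith)
    rw [dt_neg_r, dt_comm] at this
    linarith
  rcases hx with rfl | rfl <;> rcases hx2 with rfl | rfl
  · exact ⟨by linarith, fun _ => by linarith⟩
  · exact ⟨by linarith, fun _ => by linarith⟩
  · exact ⟨by linarith, fun _ => by linarith⟩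
  · refine ⟨by linarith, fun h' => ?_⟩
    rw [h']; linarith

lemma G7aux {t1 a1 c1 t2 a2 c2 z : V} (g1 : C.Gap t1 a1 c1) (g2 : C.Gap t2 a2 c2)
    (hn : 0.9999 < dt (C.d t1 a1) (C.d t2 a2))
    (z2 : C.In t2 a2 c2 (C.P z))
    (m1 : ∀ y, C.In t1 a1 c1 (C.P y) → dt (C.d t1 z) (C.d t1 z) ≤ dt (C.d t1 y) (C.d t1 y)) :
    ¬ C.In t1 a1 c1 (C.P t2) := by
  intro hin
  have hm := m1 _ hin
  obtain ⟨α, β, ha, hb, h1⟩ := z2.coords g2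
  obtain ⟨α', β', ha', hb', h2⟩ := hin.coords g1
  have e : C.d t1 z = C.d t1 t2 + C.d t2 z := by simp [d]
  have d1 := (dirs g1 g2 hn (x := a1) (x2 := a2) (Or.inl rfl) (Or.inl rfl)).1
  have d2 := (dirs g1 g2 hn (x := a1) (x2 := c2) (Or.inl rfl) (Or.inr rfl)).1
  have d3 := (dirs g1 g2 hn (x := c1) (x2 := a2) (Or.inr rfl) (Or.inl rfl)).1
  have d4 := (dirs g1 g2 hn (x := c1) (x2 := c2) (Or.inr rfl) (Or.inr rfl)).1
  have hp : 0 < dt (C.d t1 t2) (C.d t2 z) := by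
    change C.d t2 z = _ at h1
    change C.d t1 t2 = _ at h2
    rw [h1, h2]
    simp only [dt_add_l, dt_add_r, dt_smul_l, dt_smul_r]
    have : (0:ℝ) < dt (C.d t1 a1) (C.d t2 a2) := by linarith
    have : (0:ℝ) < dt (C.d t1 a1) (C.d t2 c2) := by linarith
    have : (0:ℝ) < dt (C.d t1 c1) (C.d t2 a2) := by linarith
    have : (0:ℝ) < dt (C.d t1 c1) (C.d t2 c2) := by linarith
    positivity
  have hq : 0 ≤ dt (C.d t2 z) (C.d t2 z) := by
    simp only [dt]; nlinarith [sq_nonneg (C.d t2 z).1, sq_nonneg (C.d t2 z).2]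
  rw [e, dt_add_l, dt_add_r, dt_add_r, dt_comm (C.d t2 z) (C.d t1 t2)] at hm
  linarith

lemma G7 {t1 a1 c1 t2 a2 c2 z : V} (g1 : C.Gap t1 a1 c1) (g2 : C.Gap t2 a2 c2)
    (hn : 0.9999 < dt (C.d t1 a1) (C.d t2 a2))
    (z1 : C.In t1 a1 c1 (C.P z)) (z2 : C.In t2 a2 c2 (C.P z))
    (m1 : ∀ y, C.In t1 a1 c1 (C.P y) → dt (C.d t1 z) (C.d t1 z) ≤ dt (C.d t1 y) (C.d t1 y))
    (m2 : ∀ y, C.In t2 a2 c2 (C.P y) → dt (C.d t2 z) (C.d t2 z) ≤ dt (C.d t2 y) (C.d t2 y)) :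
    t1 = t2 := by
  have hn' : 0.9999 < dt (C.d t2 a2) (C.d t1 a1) := by rw [dt_comm]; exact hn
  have n1 := G7aux g1 g2 hn z2 m1
  have n2 := G7aux g2 g1 hn' z1 m2
  obtain ⟨α, β, ha, hb, hv⟩ := z2.coords g2
  have hcr : 0 ≤ cr (C.P z - C.P t2) (C.d a1 c1) := by
    rw [hv, cr_add_l, cr_smul_l, cr_smul_l]
    have := dir_base g1 (ud g2.a1) ((dirs g1 g2 hn (Or.inl rfl) (Or.inl rfl)).2 rfl)
    have := dir_base g1 (ud g2.a2) ((dirs g1 g2 hn (Or.inl rfl) (Or.inr rfl)).2 rfl)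
    positivity
  rcases side_exit g1 z1 hcr with k | ⟨l, s, x, l0, l1, s0, s1, hx, hy⟩
  · rw [sub_sub_cancel] at k
    exact absurd k n1
  have hax : C.adj t1 x := by rcases hx with rfl | rfl <;> [exact g1.a1; exact g1.a2]
  have hcr2 : 0 < cr (C.d t1 x) (C.d a2 c2) :=
    dir_base g2 (ud hax) ((dirs g2 g1 hn' (Or.inl rfl) hx).2 rfl)
  rcases l1.eq_or_lt with rfl | l1
  · rw [one_smul, sub_sub_cancel] at hy
    rcases s0.eq_or_lt with rfl | s0
    · rw [zero_smul, add_zero] at hy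
      exact (C.inj hy).symm
    · exact absurd hy (fun h => C.nv hax s s0 s1 h)
  have hin : C.In t2 a2 c2 (C.P z - l • (C.P z - C.P t2)) := by
    have := z2.shrink g2 (l := 1 - l) (by linarith) (by linarith)
    convert this using 1
    rw [sub_smul, one_smul]; abel
  rw [hy] at hin
  rcases side_exit g2 hin (v := s • C.d t1 x) (by rw [cr_smul_l]; positivity) with k |
    ⟨l', s', x', l0', l1', s0', s1', hx', hy'⟩
  · rw [add_sub_cancel_right] at k
    exact absurd k n2
  have hax' : C.adj t2 x' := by rcases hx' with rfl | rfl <;> [exact g2.a1; exact g2.a2]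
  by_contra hne
  have key := C.nc hax hax' (fun h => hne h.1) ?_ (s - l' * s) s' (by nlinarith) (by nlinarith) s0' s1'.le ?_
  · have e1 : s - l' * s = 0 := by
      rcases key.1 with k | k
      · exact k
      · nlinarith
    have e2 : s' = 0 := by
      rcases key.2 with k | k <;> linarith
    apply hne
    apply C.inj
    rw [e2, zero_smul, add_zero, smul_smul, add_sub_assoc, ← sub_smul, e1, zero_smul, add_zero] at hy'
    exact hy'
  · rintro ⟨rfl, rfl⟩
    have := (dirs g1 g2 hn hx hx').1
    rw [d_neg t1 x, dt_neg_r, ud hax] at this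
    linarith
  · rw [sub_smul, mul_smul, ← add_sub_assoc]
    exact hy'

end Cfg
end MS


namespace MS

lemma trip1a {xj yj x2 y2 η D c : ℝ} (hD : D = xj * y2 - yj * x2) (hc : c = xj * x2 + yj * y2)
    (uj : xj ^ 2 + yj ^ 2 = 1) (u2 : x2 ^ 2 + y2 ^ 2 = 1)
    (h1 : η ≤ 1) (hj : 0 < yj) (h2 : 0 < y2)
    (hx : x2 < xj + η / 4) (k : c ≤ 0)
    (i1 : y2 = c * yj + D * xj) (i2 : yj = c * y2 - D * x2) : 0 < D ∧ y2 ≤ D ∧ yj ≤ D := by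
  have lj := unit_le_one uj
  have l2 := unit_le_one u2
  have hyy := mul_pos hj h2
  have hxx : xj * x2 < 0 := by linarith
  have hp : 0 < xj ∧ x2 < 0 := by
    rcases mul_neg_iff.1 hxx with h | h
    · exact h
    · exfalso
      have e : (x2 - xj) ^ 2 + (yj - y2) ^ 2 = 2 - 2 * c := by
        rw [hc]; linear_combination uj + u2
      have e1 : (yj - y2) ^ 2 ≤ 1 := by
        rw [sq_le_one_iff_abs_le_one, abs_le]; constructor <;> linarith
      have e2 : (x2 - xj) ^ 2 < 1 := by
        rw [sq_lt_one_iff_abs_lt_one, abs_lt]; constructor <;> linarith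
      linarith
  obtain ⟨hxj, hx2⟩ := hp
  have a1 := mul_pos hxj h2
  have a2 := mul_pos hj (neg_pos.2 hx2)
  have hDp : 0 < D := by linarith
  have b1 := mul_nonneg hj.le (neg_nonneg.2 k)
  have b2 := mul_nonneg h2.le (neg_nonneg.2 k)
  have b3 := mul_nonneg hDp.le (sub_nonneg.2 lj.2.1)
  have b4 := mul_nonneg hDp.le (sub_nonneg.2 l2.1)
  refine ⟨hDp, ?_, ?_⟩ <;> linarith

lemma trip1b {xj yj x2 y2 η D c : ℝ} 
    (h0 : 0 < η) (h1 : η ≤ 1)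
    (hd : c ≤ 1 - η / 2)
    (hx : x2 < xj + η / 4) (k : 0 < c) (hDd : D ^ 2 + c ^ 2 = 1)
    (i3 : (1 + c) * (x2 - xj) = -D * (yj + y2)) (i4 : |D| ≤ yj + y2) : 0 < D ∧ η / 2 ≤ D := by
  have hD2 : η / 2 * (1 + c) ≤ D ^ 2 := by nlinarith
  have hDp : 0 < D := by
    by_contra hn
    push Not at hn
    rw [abs_of_nonpos hn] at i4
    have h3 : D ^ 2 ≤ -D * (yj + y2) := by nlinarith
    have h4 : (1 + c) * (η / 2) ≤ (1 + c) * (x2 - xj) := by linarith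
    have := le_of_mul_le_mul_left h4 (by linarith)
    linarith
  refine ⟨hDp, ?_⟩
  by_contra hn
  push Not at hn
  have : D ^ 2 < (η / 2) ^ 2 := by nlinarith
  nlinarith

lemma trip1 {xj yj x2 y2 η ρ : ℝ} (uj : xj ^ 2 + yj ^ 2 = 1) (u2 : x2 ^ 2 + y2 ^ 2 = 1)
    (h0 : 0 < η) (h1 : η ≤ 1) (hj : 0 < yj) (h2 : 0 < y2) (hd : xj * x2 + yj * y2 ≤ 1 - η / 2)
    (hx : x2 < xj + η / 4) (r0 : 0 < ρ) (r1 : ρ < η / 2) :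
    0 < xj * y2 - yj * x2 ∧ ρ * y2 < xj * y2 - yj * x2 ∧ ρ * yj < xj * y2 - yj * x2 := by
  have lj := unit_le_one uj
  have l2 := unit_le_one u2
  have hDd : (xj * y2 - yj * x2) ^ 2 + (xj * x2 + yj * y2) ^ 2 = 1 := by
    have : (xj * y2 - yj * x2) ^ 2 + (xj * x2 + yj * y2) ^ 2 = (xj ^ 2 + yj ^ 2) * (x2 ^ 2 + y2 ^ 2) := by ring
    rw [this, uj, u2, one_mul]
  have i1 : y2 = (xj * x2 + yj * y2) * yj + (xj * y2 - yj * x2) * xj := by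
    linear_combination (-y2) * uj
  have i2 : yj = (xj * x2 + yj * y2) * y2 - (xj * y2 - yj * x2) * x2 := by
    linear_combination (-yj) * u2
  have i3 : (1 + (xj * x2 + yj * y2)) * (x2 - xj) = -(xj * y2 - yj * x2) * (yj + y2) := by
    linear_combination (-x2) * uj + xj * u2
  have i4 : |xj * y2 - yj * x2| ≤ yj + y2 := by
    have b1 := mul_nonneg h2.le (sub_nonneg.2 lj.2.1)
    have b2 := mul_nonneg h2.le (sub_nonneg.2 lj.1)
    have b3 := mul_nonneg hj.le (sub_nonneg.2 l2.2.1)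
    have b4 := mul_nonneg hj.le (sub_nonneg.2 l2.1)
    rw [abs_le]; constructor <;> linarith
  have t2 : ρ * y2 < y2 := by nlinarith
  have tj : ρ * yj < yj := by nlinarith
  rcases le_or_gt (xj * x2 + yj * y2) 0 with k | k
  · obtain ⟨a, b, c⟩ := trip1a rfl rfl uj u2 h1 hj h2 hx k i1 i2
    exact ⟨a, by linarith, by linarith⟩
  · obtain ⟨a, b⟩ := trip1b h0 h1 hd hx k hDd i3 i4
    have : ρ * y2 ≤ ρ := by nlinarith
    have : ρ * yj ≤ ρ := by nlinarith
    exact ⟨a, by linarith, by linarith⟩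

lemma trip0 {x y x' y' τ : ℝ} (u : x ^ 2 + y ^ 2 = 1) (u' : x' ^ 2 + y' ^ 2 = 1) (t1 : τ ≤ 1)
    (h : 1 - τ ≤ x) (h' : 1 - τ ≤ x') : 1 - 4 * τ ≤ x * x' + y * y' := by
  have l := unit_le_one u
  have l' := unit_le_one u'
  have a1 : y ^ 2 ≤ 2 * τ := by nlinarith
  have a2 : y' ^ 2 ≤ 2 * τ := by nlinarith
  have a3 : (1 - τ) * (1 - τ) ≤ x * x' := mul_le_mul h h' (by linarith) (by linarith)
  nlinarith [sq_nonneg (y + y'), sq_nonneg τ]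

lemma trip0' {x y x' y' τ : ℝ} (u : x ^ 2 + y ^ 2 = 1) (u' : x' ^ 2 + y' ^ 2 = 1) (t1 : τ ≤ 1)
    (h : x ≤ -(1 - τ)) (h' : x' ≤ -(1 - τ)) : 1 - 4 * τ ≤ x * x' + y * y' := by
  have := trip0 (x := -x) (y := y) (x' := -x') (y' := y') (by linarith) (by linarith) t1 (by linarith) (by linarith)
  linarith

lemma close_fr {e u u' : ℝ × ℝ} {η : ℝ} (he : dt e e = 1) (hu : dt u u = 1) (hu' : dt u' u' = 1)
    (h0 : 0 < η) (h : 1 - η ^ 2 / 128 ≤ dt u u') :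
    |dt e u - dt e u'| ≤ η / 8 ∧ |cr e u - cr e u'| ≤ η / 8 := by
  have key : (dt e u - dt e u') ^ 2 + (cr e u - cr e u') ^ 2 = 2 - 2 * dt u u' := by
    have h1 := unit_frame he hu
    have h2 := unit_frame he hu'
    rw [dt_frame he u u']; linear_combination h1 + h2
  constructor <;> apply abs_le_of_sq_le_sq _ (by linarith) <;> nlinarith [sq_nonneg (dt e u - dt e u'), sq_nonneg (cr e u - cr e u')]

namespace Cfg
variable {V : Type} {C : Cfg V}

lemma mir_d_eq (v a : V) : C.mir.d v a = ((C.d v a).1, -(C.d v a).2) := by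
  simp only [d, mir]; ext <;> simp; ring
lemma mir_dt' (e : ℝ × ℝ) (v a : V) : dt (e.1, -e.2) (C.mir.d v a) = dt e (C.d v a) := by
  rw [mir_d_eq]; simp only [dt]; ring
lemma mir_cr' (e : ℝ × ℝ) (v a : V) : cr (e.1, -e.2) (C.mir.d v a) = -cr e (C.d v a) := by
  rw [mir_d_eq]; simp only [cr]; ring
lemma mir_smul {e : ℝ × ℝ} {v a : V} {ρ : ℝ} (h : C.d v a = ρ • e) :
    C.mir.d v a = ρ • (e.1, -e.2) := by
  rw [mir_d_eq, h]; ext <;> simp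

structure Tri (C : Cfg V) (v w x1 x2 x3 y1 y2 y3 : V) : Prop where
  a1 : C.adj v x1
  a2 : C.adj v x2
  a3 : C.adj v x3
  b1 : C.adj w y1
  b2 : C.adj w y2
  b3 : C.adj w y3
  n12 : dt (C.d v x1) (C.d v x2) ≤ 1 - C.η
  n13 : dt (C.d v x1) (C.d v x3) ≤ 1 - C.η
  n23 : dt (C.d v x2) (C.d v x3) ≤ 1 - C.η
  k1 : 1 - C.η ^ 2 / 128 ≤ dt (C.d v x1) (C.d w y1)
  k2 : 1 - C.η ^ 2 / 128 ≤ dt (C.d v x2) (C.d w y2)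
  k3 : 1 - C.η ^ 2 / 128 ≤ dt (C.d v x3) (C.d w y3)
  near : dt (C.d v w) (C.d v w) < (C.η / 2) ^ 2
  ne : v ≠ w

lemma Tri.mir {v w x1 x2 x3 y1 y2 y3 : V} (h : Tri C v w x1 x2 x3 y1 y2 y3) :
    Tri C.mir v w x1 x2 x3 y1 y2 y3 := by
  constructor <;> first | exact h.ne | (first | rw [mir_dt] | skip); first | exact h.a1 | exact h.a2 | exact h.a3 | exact h.b1 | exact h.b2 | exact h.b3 | exact h.n12 | exact h.n13 | exact h.n23 | exact h.k1 | exact h.k2 | exact h.k3 | exact h.near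

lemma Tri.swap {v w x1 x2 x3 y1 y2 y3 : V} (h : Tri C v w x1 x2 x3 y1 y2 y3) :
    Tri C v w x3 x2 x1 y3 y2 y1 :=
  ⟨h.a3, h.a2, h.a1, h.b3, h.b2, h.b1, by rw [dt_comm]; exact h.n23, by rw [dt_comm]; exact h.n13,
    by rw [dt_comm]; exact h.n12, h.k3, h.k2, h.k1, h.near, h.ne⟩

lemma Tri.rot {v w x1 x2 x3 y1 y2 y3 : V} (h : Tri C v w x1 x2 x3 y1 y2 y3) :
    Tri C v w x2 x3 x1 y2 y3 y1 :=
  ⟨h.a2, h.a3, h.a1, h.b2, h.b3, h.b1, h.n23, by rw [dt_comm]; exact h.n12,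
    by rw [dt_comm]; exact h.n13, h.k2, h.k3, h.k1, h.near, h.ne⟩

lemma Tri.e {v w x1 x2 x3 y1 y2 y3 : V} (h : Tri C v w x1 x2 x3 y1 y2 y3) :
    ∃ (e : ℝ × ℝ) (ρ : ℝ), dt e e = 1 ∧ 0 < ρ ∧ ρ < C.η / 2 ∧ C.d v w = ρ • e := by
  have hpos : 0 < dt (C.d v w) (C.d v w) := by
    rcases eq_or_ne (C.d v w) 0 with k | k
    · exfalso
      apply h.ne
      apply C.inj
      unfold d at k
      exact (sub_eq_zero.1 k).symm
    · have : (C.d v w).1 ≠ 0 ∨ (C.d v w).2 ≠ 0 := by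
        by_contra hc
        push Not at hc
        exact k (Prod.ext hc.1 hc.2)
      simp only [dt]
      rcases this with k | k
      · have := mul_self_pos.2 k
        nlinarith [mul_self_nonneg (C.d v w).2]
      · have := mul_self_pos.2 k
        nlinarith [mul_self_nonneg (C.d v w).1]
  set ρ := Real.sqrt (dt (C.d v w) (C.d v w)) with hρ
  have h0 : 0 < ρ := Real.sqrt_pos.2 hpos
  have hsq : ρ ^ 2 = dt (C.d v w) (C.d v w) := Real.sq_sqrt hpos.le
  refine ⟨ρ⁻¹ • C.d v w, ρ, ?_, h0, ?_, ?_⟩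
  · rw [dt_smul_l, dt_smul_r, ← hsq]; field_simp
  · apply lt_of_pow_lt_pow_left₀ 2 (by linarith [C.hη0])
    rw [hsq]; exact h.near
  · rw [smul_smul, mul_inv_cancel₀ h0.ne', one_smul]

/-- crossing of an edge at v with an edge at w, upper side -/
lemma Tri.cross {v w x y : V} {e : ℝ × ℝ} {ρ : ℝ} (he : dt e e = 1) (r0 : 0 < ρ) (r1 : ρ < C.η / 2)
    (hvw : C.d v w = ρ • e) (hx : C.adj v x) (hy : C.adj w y)
    (p1 : 0 < cr e (C.d v x)) (p2 : 0 < cr e (C.d w y))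
    (hd : dt (C.d v x) (C.d w y) ≤ 1 - C.η / 2)
    (hl : dt e (C.d w y) < dt e (C.d v x) + C.η / 4) : False := by
  have hη := C.hη1
  rw [dt_frame he] at hd
  obtain ⟨f1, f2, f3⟩ := trip1 (unit_frame he (ud hx)) (unit_frame he (ud hy)) C.hη0 (by linarith)
    p1 p2 hd hl r0 r1
  rw [← cr_frame he] at f1 f2 f3
  apply nox hx hy f1 <;> rw [hvw, cr_smul_l]
  · positivity
  · exact f2
  · positivity
  · exact f3.le

lemma Tri.cross' {v w x y : V} {e : ℝ × ℝ} {ρ : ℝ} (he : dt e e = 1) (r0 : 0 < ρ) (r1 : ρ < C.η / 2)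
    (hvw : C.d v w = ρ • e) (hx : C.adj v x) (hy : C.adj w y)
    (p1 : cr e (C.d v x) < 0) (p2 : cr e (C.d w y) < 0)
    (hd : dt (C.d v x) (C.d w y) ≤ 1 - C.η / 2)
    (hl : dt e (C.d w y) < dt e (C.d v x) + C.η / 4) : False := by
  refine Tri.cross (C := C.mir) (v := v) (w := w) (x := x) (y := y) (e := (e.1, -e.2)) (ρ := ρ) ?_ r0 r1 ?_ hx hy ?_ ?_ ?_ ?_
  · simpa [dt] using he
  · exact mir_smul hvw
  · rw [mir_cr']; linarith
  · rw [mir_cr']; linarith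
  · rw [mir_dt]; exact hd
  · rw [mir_dt', mir_dt']; exact hl

lemma dt_close {f u u' : ℝ × ℝ} {η : ℝ} (hf : dt f f = 1) (hu : dt u u = 1) (hu' : dt u' u' = 1)
    (h0 : 0 < η) (h : 1 - η ^ 2 / 128 ≤ dt u u') (hd : dt f u ≤ 1 - η) : dt f u' ≤ 1 - η / 2 := by
  have := abs_le.1 (close_fr hf hu hu' h0 h).1
  linarith

lemma Tri.main {v w x1 x2 x3 y1 y2 y3 : V} (h : Tri C v w x1 x2 x3 y1 y2 y3) {e : ℝ × ℝ} {ρ : ℝ}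
    (he : dt e e = 1) (r0 : 0 < ρ) (r1 : ρ < C.η / 2) (hvw : C.d v w = ρ • e)
    (m1 : dt e (C.d v x2) ≤ dt e (C.d v x3)) (m3 : dt e (C.d v x3) ≤ dt e (C.d v x1))
    (hp : 0 < cr e (C.d w y2)) : False := by
  have h0 := C.hη0
  have hη := C.hη1
  have u1 := unit_frame he (ud h.a1)
  have u2 := unit_frame he (ud h.a2)
  have u3 := unit_frame he (ud h.a3)
  have c1 := close_fr he (ud h.a1) (ud h.b1) h0 h.k1
  have c2 := close_fr he (ud h.a2) (ud h.b2) h0 h.k2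
  have c3 := close_fr he (ud h.a3) (ud h.b3) h0 h.k3
  have c2a := abs_le.1 c2.1
  have c3a := abs_le.1 c3.1
  have c3b := abs_le.1 c3.2
  have n12 := h.n12
  have n13 := h.n13
  have n23 := h.n23
  -- the others are not above
  have p1 : cr e (C.d v x1) ≤ 0 := by
    by_contra hc
    push Not at hc
    exact Tri.cross he r0 r1 hvw h.a1 h.b2 hc hp (dt_close (ud h.a1) (ud h.a2) (ud h.b2) h0 h.k2 n12)
      (by linarith)
  have p3 : cr e (C.d v x3) ≤ 0 := by
    by_contra hc
    push Not at hc
    exact Tri.cross he r0 r1 hvw h.a3 h.b2 hc hp (dt_close (ud h.a3) (ud h.a2) (ud h.b2) h0 h.k2 (by rw [dt_comm]; exact n23))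
      (by linarith)
  rw [dt_frame he] at n12 n13 n23
  have q1 : cr e (C.d v x1) < 0 := by
    apply lt_of_le_of_ne p1
    intro hz
    rw [hz] at u1
    have : (dt e (C.d v x1) - 1) * (dt e (C.d v x1) + 1) = 0 := by linarith
    rcases mul_eq_zero.1 this with k | k
    · have hee : e = C.d v x1 := eq_of_cr_zero he (ud h.a1) hz (by linarith)
      exact nv_line h.a1 ρ r0 (by linarith) (by rw [hvw, hee])
    · have := trip0' u1 u2 (τ := 0) (by norm_num) (by linarith) (by linarith)
      rw [hz] at n12
      linarith
  have q3 : cr e (C.d v x3) < 0 := by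
    apply lt_of_le_of_ne p3
    intro hz
    rw [hz] at u3
    have : (dt e (C.d v x3) - 1) * (dt e (C.d v x3) + 1) = 0 := by linarith
    rcases mul_eq_zero.1 this with k | k
    · have hee : e = C.d v x3 := eq_of_cr_zero he (ud h.a3) hz (by linarith)
      exact nv_line h.a3 ρ r0 (by linarith) (by rw [hvw, hee])
    · have := trip0' u2 u3 (τ := 0) (by norm_num) (by linarith) (by linarith)
      rw [hz] at n23
      linarith
  have s3 : cr e (C.d w y3) < 0 := by
    by_contra hc
    push Not at hc
    have b1 : -(C.η / 8) ≤ cr e (C.d v x3) := by linarith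
    have b2 : 1 - C.η / 8 ≤ dt e (C.d v x3) ^ 2 := by nlinarith
    rcases le_total 0 (dt e (C.d v x3)) with k | k
    · have : 1 - C.η / 8 ≤ dt e (C.d v x3) := by
        have := (unit_le_one u3).2.1
        nlinarith
      have := trip0 u1 u3 (τ := C.η / 8) (by linarith) (by linarith) this
      linarith
    · have : dt e (C.d v x3) ≤ -(1 - C.η / 8) := by
        have := (unit_le_one u3).1
        nlinarith
      have := trip0' u2 u3 (τ := C.η / 8) (by linarith) (by linarith) this
      linarith
  exact Tri.cross' he r0 r1 hvw h.a1 h.b3 q1 s3 (dt_close (ud h.a1) (ud h.a3) (ud h.b3) h0 h.k3 h.n13)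
      (by linarith)

lemma Tri.main2 {v w x1 x2 x3 y1 y2 y3 : V} (h : Tri C v w x1 x2 x3 y1 y2 y3) {e : ℝ × ℝ} {ρ : ℝ}
    (he : dt e e = 1) (r0 : 0 < ρ) (r1 : ρ < C.η / 2) (hvw : C.d v w = ρ • e)
    (m1 : dt e (C.d v x2) ≤ dt e (C.d v x3)) (m3 : dt e (C.d v x3) ≤ dt e (C.d v x1)) : False := by
  have h0 := C.hη0
  have hη := C.hη1
  have u1 := unit_frame he (ud h.a1)
  have u2 := unit_frame he (ud h.a2)
  have u3 := unit_frame he (ud h.a3)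
  have u2' := unit_frame he (ud h.b2)
  have c2a := abs_le.1 (close_fr he (ud h.a2) (ud h.b2) h0 h.k2).1
  rcases lt_trichotomy (cr e (C.d w y2)) 0 with k | k | k
  · refine h.mir.main (e := (e.1, -e.2)) (ρ := ρ) ?_ r0 r1 ?_ ?_ ?_ ?_
    · simpa [dt] using he
    · exact mir_smul hvw
    · rw [mir_dt', mir_dt']; exact m1
    · rw [mir_dt', mir_dt']; exact m3
    · rw [mir_cr']; linarith
  · rw [k] at u2'
    have : (dt e (C.d w y2) - 1) * (dt e (C.d w y2) + 1) = 0 := by linarith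
    rcases mul_eq_zero.1 this with k' | k'
    · have n23 := h.n23
      rw [dt_frame he] at n23
      have := trip0 u2 u3 (τ := C.η / 8) (by linarith) (by linarith) (by linarith)
      linarith
    · have hee : -e = C.d w y2 := eq_of_cr_zero (by rw [dt_neg_l, dt_neg_r, neg_neg]; exact he) (ud h.b2)
        (by rw [cr_neg_l, k, neg_zero]) (by rw [dt_neg_l]; linarith)
      refine nv_line h.b2 ρ r0 (by linarith) (x := v) ?_
      rw [← hee, d_neg v w, hvw, smul_neg]
  · exact h.main he r0 r1 hvw m1 m3 k

lemma G8 {v w x1 x2 x3 y1 y2 y3 : V} (h : Tri C v w x1 x2 x3 y1 y2 y3) : False := by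
  obtain ⟨e, ρ, he, r0, r1, hvw⟩ := h.e
  rcases le_total (dt e (C.d v x1)) (dt e (C.d v x2)) with k | k <;>
  rcases le_total (dt e (C.d v x1)) (dt e (C.d v x3)) with k' | k' <;>
  rcases le_total (dt e (C.d v x2)) (dt e (C.d v x3)) with k'' | k''
  · exact h.rot.rot.main2 he r0 r1 hvw k k''
  · exact h.rot.rot.swap.main2 he r0 r1 hvw k' k''
  · exact h.rot.main2 he r0 r1 hvw k' k
  · exact h.rot.main2 he r0 r1 hvw k' k
  · exact h.swap.main2 he r0 r1 hvw k k'
  · exact h.swap.main2 he r0 r1 hvw k k'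
  · exact h.main2 he r0 r1 hvw k'' k'
  · exact h.rot.swap.main2 he r0 r1 hvw k'' k

end Cfg
end MS


namespace MS

/-- abstract charging lemma -/
lemma charge {α β κ : Type} [Finite α] [Finite β] [Fintype κ] (S : Set α) (T : Set β)
    (Rel : α → β → κ → Prop) (h : ∀ s ∈ S, ∃ t ∈ T, ∃ k, Rel s t k)
    (u : ∀ s s' t k, Rel s t k → Rel s' t k → s = s') : S.ncard ≤ T.ncard * Fintype.card κ := by
  classical
  rcases S.eq_empty_or_nonempty with hS | ⟨s0, hs0⟩
  · rw [hS]; simp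
  have h' : ∀ s : α, ∃ x : β × κ, s ∈ S → x.1 ∈ T ∧ Rel s x.1 x.2 := by
    intro s
    by_cases hs : s ∈ S
    · obtain ⟨t, ht, k, hk⟩ := h s hs
      exact ⟨(t, k), fun _ => ⟨ht, hk⟩⟩
    · obtain ⟨t, ht, k, hk⟩ := h s0 hs0
      exact ⟨(t, k), fun h => absurd h hs⟩
  choose f hf using h'
  have h1 : S.ncard ≤ (T ×ˢ (Set.univ : Set κ)).ncard := by
    apply Set.ncard_le_ncard_of_injOn f
    · intro s hs
      exact ⟨(hf s hs).1, trivial⟩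
    · intro s hs s' hs' he
      have a := (hf s hs).2
      have b := (hf s' hs').2
      rw [he] at a
      exact u _ _ _ _ a b
  rw [Set.ncard_prod, Set.ncard_univ, Nat.card_eq_fintype_card] at h1
  exact h1

/-- a finite code on a bounded box -/
lemma exists_code (M δ : ℝ) (hδ : 0 < δ) : ∃ (K : ℕ) (κ : ℝ × ℝ → Fin K), ∀ p q : ℝ × ℝ,
    |p.1| ≤ M → |p.2| ≤ M → |q.1| ≤ M → |q.2| ≤ M → κ p = κ q →
    |p.1 - q.1| < δ ∧ |p.2 - q.2| < δ := by
  let S : Set (ℤ × ℤ) := (Set.Icc ⌊-M / δ⌋ ⌊M / δ⌋) ×ˢ (Set.Icc ⌊-M / δ⌋ ⌊M / δ⌋)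
  have hS : S.Finite := (Set.finite_Icc _ _).prod (Set.finite_Icc _ _)
  have : Finite S := hS
  obtain ⟨K, ⟨e⟩⟩ := Finite.exists_equiv_fin S
  have hm : ∀ x : ℝ, |x| ≤ M → ⌊x / δ⌋ ∈ Set.Icc ⌊-M / δ⌋ ⌊M / δ⌋ := by
    intro x hx
    rw [abs_le] at hx
    constructor <;> apply Int.floor_le_floor <;> apply div_le_div_of_nonneg_right _ hδ.le <;> linarith
  have hf : ∀ x y : ℝ, ⌊x / δ⌋ = ⌊y / δ⌋ → |x - y| < δ := by
    intro x y h
    have := Int.abs_sub_lt_one_of_floor_eq_floor h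
    rw [← sub_div, abs_div, abs_of_pos hδ, div_lt_one hδ] at this
    exact this
  classical
  refine ⟨K + 1, fun p => if h : ((⌊p.1 / δ⌋, ⌊p.2 / δ⌋) : ℤ × ℤ) ∈ S then (e ⟨_, h⟩).castSucc
    else Fin.last K, ?_⟩
  intro p q p1 p2 q1 q2 h
  have hp : ((⌊p.1 / δ⌋, ⌊p.2 / δ⌋) : ℤ × ℤ) ∈ S := ⟨hm _ p1, hm _ p2⟩
  have hq : ((⌊q.1 / δ⌋, ⌊q.2 / δ⌋) : ℤ × ℤ) ∈ S := ⟨hm _ q1, hm _ q2⟩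
  simp only [dif_pos hp, dif_pos hq] at h
  have := e.injective (Fin.castSucc_injective _ h)
  simp only [Subtype.mk.injEq, Prod.mk.injEq] at this
  exact ⟨hf _ _ this.1, hf _ _ this.2⟩

/-- direction code -/
def DirCode (η : ℝ) (K : ℕ) (κ : ℝ × ℝ → Fin K) : Prop :=
  ∀ u u' : ℝ × ℝ, dt u u = 1 → dt u' u' = 1 → κ u = κ u' → 1 - η ^ 2 / 128 ≤ dt u u'

lemma abs_of_unit {u : ℝ × ℝ} (h : dt u u = 1) : |u.1| ≤ 1 ∧ |u.2| ≤ 1 := by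
  simp only [dt] at h
  constructor <;> rw [← sq_le_one_iff_abs_le_one] <;> nlinarith [sq_nonneg u.1, sq_nonneg u.2]

lemma exists_dirCode (η : ℝ) (h : 0 < η) : ∃ K κ, DirCode η K κ := by
  obtain ⟨K, κ, hκ⟩ := exists_code 1 (η / 16) (by linarith)
  refine ⟨K, κ, ?_⟩
  intro u u' hu hu' he
  obtain ⟨a, b⟩ := hκ u u' (abs_of_unit hu).1 (abs_of_unit hu).2 (abs_of_unit hu').1
    (abs_of_unit hu').2 he
  have a' := sq_lt_sq' (by linarith [(abs_lt.1 a).1]) (abs_lt.1 a).2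
  have b' := sq_lt_sq' (by linarith [(abs_lt.1 b).1]) (abs_lt.1 b).2
  simp only [dt] at *
  nlinarith

namespace Cfg
variable {V : Type} {C : Cfg V} {K : ℕ} {κ : ℝ × ℝ → Fin K}

lemma code_near (hκ : DirCode C.η K κ) {v a w b : V} (h : C.adj v a) (h' : C.adj w b)
    (he : κ (C.d v a) = κ (C.d w b)) : C.near (C.d v a) (C.d w b) := by
  have := hκ _ _ (ud h) (ud h') he
  have h0 := C.hη0
  have h1 := C.hη1
  unfold near
  nlinarith

lemma code_NL (hκ : DirCode C.η K κ) {v a b : V} (h : C.NL v a) (h' : C.NL v b)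
    (he : κ (C.d v a) = κ (C.d v b)) : a = b := NL_near h h' (code_near hκ h.1 h'.1 he)
lemma code_NR (hκ : DirCode C.η K κ) {v a b : V} (h : C.NR v a) (h' : C.NR v b)
    (he : κ (C.d v a) = κ (C.d v b)) : a = b := NR_near h h' (code_near hκ h.1 h'.1 he)

lemma oppNL [Finite V] {v p : V} (h : ¬ C.B v) (hp : C.adj v p) :
    ∃ t, C.NL v t ∧ dt (C.d v p) (C.d v t) < -0.9 := by
  obtain ⟨t, h1, h2⟩ := oppNR (C := C.mir) (v := v) (p := p) (by rw [mir_B]; exact h) hp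
  exact ⟨t, (mir_NR _ _).1 h1, by rw [mir_dt] at h2; exact h2⟩

/-- rhombus with bottom, left, top and right corner -/
structure Rh (C : Cfg V) (b d a d' : V) : Prop where
  g1 : C.Gap b d' d
  g2 : C.Gap a d d'
  good : ¬ C.B d

lemma Rh.par {b d a d' : V} (h : Rh C b d a d') : C.P a + C.P b = C.P d + C.P d' := by
  have u1 := ud h.g1.a1
  have u2 := ud h.g1.a2
  have u3 := ud h.g2.a1
  have u4 := ud h.g2.a2
  have p1 := h.g1.pos
  have p2 := h.g2.pos
  simp only [dt, cr, Cfg.d, Prod.fst_sub, Prod.snd_sub] at u1 u2 u3 u4 p1 p2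
  generalize C.P a = A at *
  generalize C.P b = B at *
  generalize C.P d = D at *
  generalize C.P d' = E at *
  obtain ⟨ax, ay⟩ := A
  obtain ⟨bx, bY⟩ := B
  obtain ⟨dx, dy⟩ := D
  obtain ⟨ex, ey⟩ := E
  simp only at u1 u2 u3 u4 p1 p2
  -- w orthogonal to both diagonals
  have o1 : (ax + bx - dx - ex) * (dx - ex) + (ay + bY - dy - ey) * (dy - ey) = 0 := by
    linear_combination (1/2) * u1 - (1/2) * u2 - (1/2) * u3 + (1/2) * u4
  have o2 : (ax + bx - dx - ex) * (ax - bx) + (ay + bY - dy - ey) * (ay - bY) = 0 := by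
    linear_combination -(1/2) * u1 - (1/2) * u2 + (1/2) * u3 + (1/2) * u4
  -- twice the area is positive
  have ar : 0 < (dy - ey) * (ax - bx) - (dx - ex) * (ay - bY) ∨ 0 < -((dy - ey) * (ax - bx) - (dx - ex) * (ay - bY)) := by
    by_contra hc
    push Not at hc
    nlinarith
  have hne : (dy - ey) * (ax - bx) - (dx - ex) * (ay - bY) ≠ 0 := by
    rcases ar with h | h
    · exact h.ne'
    · intro h'; rw [h'] at h; simp at h
  have e1 : (ax + bx - dx - ex) * ((dy - ey) * (ax - bx) - (dx - ex) * (ay - bY)) = 0 := by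
    linear_combination (dy - ey) * o2 - (ay - bY) * o1
  have e2 : (ay + bY - dy - ey) * ((dy - ey) * (ax - bx) - (dx - ex) * (ay - bY)) = 0 := by
    linear_combination (ax - bx) * o1 - (dx - ex) * o2
  have f1 := (mul_eq_zero.1 e1).resolve_right hne
  have f2 := (mul_eq_zero.1 e2).resolve_right hne
  ext <;> simp <;> linarith

/-- bad hinge -/
structure BH (C : Cfg V) (x : V × V × V) : Prop where
  good : ¬ C.B x.2.1
  nl : C.NL x.2.1 x.1
  nr : C.NR x.2.1 x.2.2
  opp : dt (C.d x.2.1 x.1) (C.d x.2.1 x.2.2) < -0.9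
  no : ¬ ∃ a', Rh C x.1 x.2.1 x.2.2 a'

def Cl (C : Cfg V) (t a c z : V) : Prop :=
  C.In t a c (C.P z) ∧ ∀ y, C.In t a c (C.P y) → dt (C.d t z) (C.d t z) ≤ dt (C.d t y) (C.d t y)

lemma exists_Cl [Finite V] {t a c : V} (h : ∃ z, C.In t a c (C.P z)) : ∃ z, C.Cl t a c z := by
  obtain ⟨z, hz, hm⟩ := Set.exists_min_image {z | C.In t a c (C.P z)}
    (fun z => dt (C.d t z) (C.d t z)) (Set.toFinite _) h
  exact ⟨z, hz, hm⟩

lemma Cl_unique (hκ : DirCode C.η K κ) {t a c t' a' c' z : V} (g : C.Gap t a c) (g' : C.Gap t' a' c')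
    (h : C.Cl t a c z) (h' : C.Cl t' a' c' z) (he : κ (C.d t a) = κ (C.d t' a')) :
    t = t' ∧ a = a' ∧ c = c' := by
  have e := G7 g g' (near_pos (code_near hκ g.a1 g'.a1 he)) h.1 h'.1 h.2 h'.2
  subst e
  have e2 := g.same g' h.1.1 h.1.2.1 h'.1.1 h'.1.2.1
  subst e2
  exact ⟨rfl, rfl, g.right_unique g'⟩

lemma BH_charge [Finite V] (hκ : DirCode C.η K κ) :
    {x | C.BH x}.ncard ≤ {v | C.B v}.ncard * (4 * (K * (K * K))) := by
  have key := charge (κ := Fin 4 × Fin K × Fin K × Fin K) {x | C.BH x} {v | C.B v}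
    (fun x v k => C.BH x ∧ k.2.2.1 = κ (C.d x.2.1 x.1) ∧ k.2.2.2 = κ (C.d x.2.1 x.2.2) ∧
      ((k.1 = 0 ∧ C.Gap x.1 v x.2.1 ∧ k.2.1 = κ (C.d v x.1)) ∨
       (k.1 = 1 ∧ C.Gap x.2.2 x.2.1 v ∧ k.2.1 = κ (C.d v x.2.2)) ∨
       (k.1 = 2 ∧ ∃ a', C.Gap x.1 a' x.2.1 ∧ C.Cl x.1 a' x.2.1 v ∧ k.2.1 = κ (C.d x.1 a')) ∨
       (k.1 = 3 ∧ ∃ b, C.Gap x.2.2 x.2.1 b ∧ C.Cl x.2.2 x.2.1 b v ∧ k.2.1 = κ (C.d x.2.2 x.2.1))))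
    ?_ ?_
  · simpa [Fintype.card_prod] using key
  · rintro ⟨p, s, t⟩ hx
    have hx' : C.BH (p, s, t) := hx
    obtain ⟨good, nl, nr, opp, no⟩ := hx
    simp only at good nl nr opp no
    have hW : ∀ y, ¬ C.W y s ∧ ¬ C.W s y := fun y =>
      ⟨fun h' => good (Or.inl (Or.inr (Or.inr ⟨y, Or.inr h'⟩))),
       fun h' => good (Or.inl (Or.inr (Or.inr ⟨y, Or.inl h'⟩)))⟩
    have hR : C.R p s := by
      by_contra hc
      exact (hW p).1 ⟨C.symm nl.1, hc, nl.2⟩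
    have hL : C.L t s := by
      by_contra hc
      exact (hW t).2 ⟨nr.1, nr.2, hc⟩
    obtain ⟨a', ga⟩ := gap_of_R (C.symm nl.1) hR
    obtain ⟨b, gb⟩ := gap_of_L (C.symm nr.1) hL
    by_cases h1 : C.B a'
    · exact ⟨a', h1, (0, κ (C.d a' p), κ (C.d s p), κ (C.d s t)), hx', rfl, rfl, Or.inl ⟨rfl, ga, rfl⟩⟩
    by_cases h2 : C.B b
    · exact ⟨b, h2, (1, κ (C.d b t), κ (C.d s p), κ (C.d s t)), hx', rfl, rfl,
        Or.inr (Or.inl ⟨rfl, gb, rfl⟩)⟩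
    by_cases h3 : ∃ z, C.In p a' s (C.P z)
    · obtain ⟨z, hz⟩ := exists_Cl h3
      exact ⟨z, G6' ga hz.1 nr.1 opp, (2, κ (C.d p a'), κ (C.d s p), κ (C.d s t)), hx', rfl, rfl,
        Or.inr (Or.inr (Or.inl ⟨rfl, a', ga, hz, rfl⟩))⟩
    by_cases h4 : ∃ z, C.In t s b (C.P z)
    · obtain ⟨z, hz⟩ := exists_Cl h4
      exact ⟨z, G6 gb hz.1 nl.1 (by rw [dt_comm]; exact opp), (3, κ (C.d t s), κ (C.d s p), κ (C.d s t)), hx', rfl, rfl,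
        Or.inr (Or.inr (Or.inr ⟨rfl, b, gb, hz, rfl⟩))⟩
    exfalso
    have e := G5 ⟨ga, gb, opp⟩ h1 h2 (fun z hz => h3 ⟨z, hz⟩) (fun z hz => h4 ⟨z, hz⟩)
    subst e
    exact no ⟨a', ga, gb, good⟩
  · rintro ⟨p, s, t⟩ ⟨p', s', t'⟩ v ⟨k1, k2, k3, k4⟩ ⟨hx, e1, e2, h⟩ ⟨hx', e1', e2', h'⟩
    simp only at *
    have fin : s = s' → ((p, s, t) : V × V × V) = (p', s', t') := by
      intro e
      subst e
      have f1 := code_NL hκ hx.nl hx'.nl (by rw [← e1, ← e1'])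
      have f2 := code_NR hκ hx.nr hx'.nr (by rw [← e2, ← e2'])
      simp only at f1 f2
      rw [f1, f2]
    apply fin
    rcases h with ⟨z, h⟩ | ⟨z, h⟩ | ⟨z, h⟩ | ⟨z, h⟩ <;> rcases h' with ⟨z', h'⟩ | ⟨z', h'⟩ | ⟨z', h'⟩ | ⟨z', h'⟩ <;>
      first | (exfalso; rw [z] at z'; revert z'; decide) | skip
    · have := code_NR hκ h.1.NR h'.1.NR (by rw [← h.2, ← h'.2])
      subst this
      exact h.1.right_unique h'.1
    · have := code_NL hκ h.1.NL h'.1.NL (by rw [← h.2, ← h'.2])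
      subst this
      exact h.1.left_unique h'.1
    · obtain ⟨a, g, c, k⟩ := h
      obtain ⟨a', g', c', k'⟩ := h'
      exact (Cl_unique hκ g g' c c' (by rw [← k, ← k'])).2.2
    · obtain ⟨a, g, c, k⟩ := h
      obtain ⟨a', g', c', k'⟩ := h'
      exact (Cl_unique hκ g g' c c' (by rw [← k, ← k'])).2.1

def OKl (C : Cfg V) (b d : V) : Prop := ∃ a d', Rh C b d a d'
def OKu (C : Cfg V) (d a : V) : Prop := ∃ b d', Rh C b d a d'

lemma bad0_count [Finite V] (hκ : DirCode C.η K κ) :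
    {x : V × V | C.adj x.1 x.2 ∧ ¬ C.OKl x.1 x.2 ∧ ¬ C.OKu x.1 x.2}.ncard ≤
      {v | C.B v}.ncard * (2 * K + 8 * (K * (K * K))) := by
  have c1 : {x : V × V | C.NR x.1 x.2 ∧ C.B x.1}.ncard ≤ {v | C.B v}.ncard * K := by
    have := charge (κ := Fin K) {x : V × V | C.NR x.1 x.2 ∧ C.B x.1} {v | C.B v}
      (fun x v k => v = x.1 ∧ C.NR x.1 x.2 ∧ k = κ (C.d x.1 x.2)) ?_ ?_
    · simpa using this
    · rintro ⟨p, s⟩ ⟨h1, h2⟩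
      exact ⟨p, h2, _, rfl, h1, rfl⟩
    · rintro ⟨p, s⟩ ⟨p', s'⟩ v k ⟨rfl, h1, h2⟩ ⟨e, h1', h2'⟩
      simp only at *
      subst e
      rw [code_NR hκ h1 h1' (by rw [← h2, ← h2'])]
  have c2 : {x : V × V | C.NL x.2 x.1 ∧ C.B x.2}.ncard ≤ {v | C.B v}.ncard * K := by
    have := charge (κ := Fin K) {x : V × V | C.NL x.2 x.1 ∧ C.B x.2} {v | C.B v}
      (fun x v k => v = x.2 ∧ C.NL x.2 x.1 ∧ k = κ (C.d x.2 x.1)) ?_ ?_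
    · simpa using this
    · rintro ⟨p, s⟩ ⟨h1, h2⟩
      exact ⟨s, h2, _, rfl, h1, rfl⟩
    · rintro ⟨p, s⟩ ⟨p', s'⟩ v k ⟨rfl, h1, h2⟩ ⟨e, h1', h2'⟩
      simp only at *
      subst e
      rw [code_NL hκ h1 h1' (by rw [← h2, ← h2'])]
  have c3 := BH_charge hκ
  have c4 : ((fun x : V × V × V => (x.1, x.2.1)) '' {x | C.BH x}).ncard ≤ {x | C.BH x}.ncard :=
    Set.ncard_image_le (Set.toFinite _)
  have c5 : ((fun x : V × V × V => (x.2.1, x.2.2)) '' {x | C.BH x}).ncard ≤ {x | C.BH x}.ncard :=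
    Set.ncard_image_le (Set.toFinite _)
  have hsub : {x : V × V | C.adj x.1 x.2 ∧ ¬ C.OKl x.1 x.2 ∧ ¬ C.OKu x.1 x.2} ⊆
      ({x : V × V | C.NR x.1 x.2 ∧ C.B x.1} ∪ {x : V × V | C.NL x.2 x.1 ∧ C.B x.2}) ∪
      (((fun x : V × V × V => (x.1, x.2.1)) '' {x | C.BH x}) ∪
       ((fun x : V × V × V => (x.2.1, x.2.2)) '' {x | C.BH x})) := by
    rintro ⟨p, s⟩ ⟨h, n1, n2⟩
    simp only at h n1 n2
    by_cases hr : C.R p s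
    · have nl : C.NL s p := ⟨C.symm h, fun h' => Zlem h hr h'⟩
      by_cases hB : C.B s
      · exact Or.inl (Or.inr ⟨nl, hB⟩)
      · obtain ⟨t, ht, ho⟩ := oppNR hB nl.1
        refine Or.inr (Or.inl ⟨(p, s, t), ⟨hB, nl, ht, ho, ?_⟩, rfl⟩)
        rintro ⟨a', ha⟩
        exact n1 ⟨t, a', ha⟩
    · have nr : C.NR p s := ⟨h, hr⟩
      by_cases hB : C.B p
      · exact Or.inl (Or.inl ⟨nr, hB⟩)
      · obtain ⟨t, ht, ho⟩ := oppNL hB nr.1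
        refine Or.inr (Or.inr ⟨(t, p, s), ⟨hB, ht, nr, by rw [dt_comm]; exact ho, ?_⟩, rfl⟩)
        rintro ⟨a', ha⟩
        exact n2 ⟨t, a', ha⟩
  have h1 := Set.ncard_le_ncard hsub (Set.toFinite _)
  have h2 := Set.ncard_union_le ({x : V × V | C.NR x.1 x.2 ∧ C.B x.1} ∪ {x : V × V | C.NL x.2 x.1 ∧ C.B x.2})
      (((fun x : V × V × V => (x.1, x.2.1)) '' {x | C.BH x}) ∪
       ((fun x : V × V × V => (x.2.1, x.2.2)) '' {x | C.BH x}))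
  have h3 := Set.ncard_union_le {x : V × V | C.NR x.1 x.2 ∧ C.B x.1} {x : V × V | C.NL x.2 x.1 ∧ C.B x.2}
  have h4 := Set.ncard_union_le ((fun x : V × V × V => (x.1, x.2.1)) '' {x | C.BH x})
       ((fun x : V × V × V => (x.2.1, x.2.2)) '' {x | C.BH x})
  have : {v | C.B v}.ncard * (2 * K + 8 * (K * (K * K))) = {v | C.B v}.ncard * K +
    {v | C.B v}.ncard * K + ({v | C.B v}.ncard * (4 * (K * (K * K))) + {v | C.B v}.ncard * (4 * (K * (K * K)))) := by ring
  rw [this]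
  omega

end Cfg
end MS


namespace MS

/-- number of inversions of a list of directions -/
noncomputable def invs : List (ℝ × ℝ) → ℕ
  | [] => 0
  | x :: l => (open Classical in l.countP (fun y => decide (0 < cr y x))) + invs l

lemma invs_swap (l1 l2 : List (ℝ × ℝ)) (x y : ℝ × ℝ) (h : 0 < cr y x) :
    invs (l1 ++ x :: y :: l2) = invs (l1 ++ y :: x :: l2) + 1 := by
  induction l1 with
  | nil =>
    have h' : ¬ 0 < cr x y := by rw [cr_comm]; linarith
    simp only [List.nil_append, invs, List.countP_cons, h, h', decide_true, decide_false]
    simp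
    omega
  | cons z l ih =>
    simp only [List.cons_append, invs, ih]
    have : (l ++ x :: y :: l2).Perm (l ++ y :: x :: l2) :=
      List.Perm.append_left _ (List.Perm.swap _ _ _)
    rw [this.countP_eq]
    omega

lemma invs_le (l : List (ℝ × ℝ)) : invs l ≤ l.length * l.length := by
  induction l with
  | nil => simp [invs]
  | cons x l ih =>
    simp only [invs, List.length_cons]
    have := open Classical in List.countP_le_length (p := fun y => decide (0 < cr y x)) (l := l)
    nlinarith

def cl (ε : ℝ) (u w : ℝ × ℝ) : Prop := |u.1 - w.1| ≤ ε ∧ |u.2 - w.2| ≤ ε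

lemma cl.trans {ε ε' : ℝ} {u v w : ℝ × ℝ} (h : cl ε u v) (h' : cl ε' v w) : cl (ε + ε') u w :=
  ⟨(abs_sub_le _ v.1 _).trans (add_le_add h.1 h'.1), (abs_sub_le _ v.2 _).trans (add_le_add h.2 h'.2)⟩
lemma cl.symm {ε : ℝ} {u v : ℝ × ℝ} (h : cl ε u v) : cl ε v u :=
  ⟨by rw [abs_sub_comm]; exact h.1, by rw [abs_sub_comm]; exact h.2⟩
lemma cl.mono {ε ε' : ℝ} {u v : ℝ × ℝ} (h : cl ε u v) (h' : ε ≤ ε') : cl ε' u v :=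
  ⟨h.1.trans h', h.2.trans h'⟩
lemma cl.dt {ε : ℝ} {u v : ℝ × ℝ} (hu : dt u u = 1) (hv : dt v v = 1) (h : cl ε u v) :
    1 - ε ^ 2 ≤ dt u v := by
  have e0 : 0 ≤ ε := (abs_nonneg _).trans h.1
  have a := sq_le_sq' (abs_le.1 h.1).1 (abs_le.1 h.1).2
  have b := sq_le_sq' (abs_le.1 h.2).1 (abs_le.1 h.2).2
  simp only [MS.dt] at *
  nlinarith

namespace Cfg
variable {V : Type} {C : Cfg V}

lemma near_cl {δ : ℝ} (h0 : 0 ≤ δ) (hδ : 2 * C.η ≤ δ ^ 2) {u v : ℝ × ℝ} (hu : dt u u = 1)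
    (hv : dt v v = 1) (h : C.near u v) : cl δ u v := by
  unfold near at h
  simp only [dt] at *
  constructor <;> apply abs_le_of_sq_le_sq _ h0 <;>
    nlinarith [sq_nonneg (u.1 - v.1), sq_nonneg (u.2 - v.2)]

/-- iterated badness of darts -/
def Bad (C : Cfg V) : ℕ → V → V → Prop
  | 0, x, y => C.adj x y ∧ ¬ C.OKl x y ∧ ¬ C.OKu x y
  | k + 1, x, y => Bad C k x y ∨ ∃ b d a d', Rh C b d a d' ∧
      ((x = b ∧ y = d) ∨ (x = d ∧ y = a)) ∧
      (Bad C k b d ∨ Bad C k d a ∨ Bad C k b d' ∨ Bad C k d' a)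

lemma not_bad_mono {k j : ℕ} {x y : V} (h : ¬ C.Bad (k + j) x y) : ¬ C.Bad k x y := by
  induction j with
  | zero => exact h
  | succ j ih => exact ih (fun h' => h (Or.inl h'))

lemma Rh.dir1 {b d a d' : V} (h : Rh C b d a d') : C.d d a = C.d b d' := by
  have := h.par
  unfold Cfg.d
  rw [sub_eq_sub_iff_add_eq_add, this, add_comm]
lemma Rh.dir2 {b d a d' : V} (h : Rh C b d a d') : C.d d' a = C.d b d := by
  have := h.par
  unfold Cfg.d
  rw [sub_eq_sub_iff_add_eq_add, this]

lemma Rh.a_unique {b d a a2 d' : V} (h : Rh C b d a d') (h' : Rh C b d a2 d') : a = a2 := by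
  apply eq_of_d (C := C) (v := d)
  rw [h.dir1, h'.dir1]
lemma Rh.b_unique {b b2 d a d' : V} (h : Rh C b d a d') (h' : Rh C b2 d a d') : b = b2 := by
  apply C.inj
  have h1 := h.par
  have h2 := h'.par
  rw [← h2] at h1
  exact add_left_cancel h1

lemma bad_count [Finite V] (k : ℕ) : {x : V × V | C.Bad (k + 1) x.1 x.2}.ncard ≤
    9 * {x : V × V | C.Bad k x.1 x.2}.ncard := by
  have hsub : {x : V × V | C.Bad (k + 1) x.1 x.2} ⊆ {x : V × V | C.Bad k x.1 x.2} ∪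
    {x : V × V | ∃ b d a d', Rh C b d a d' ∧
      ((x.1 = b ∧ x.2 = d) ∨ (x.1 = d ∧ x.2 = a)) ∧
      (C.Bad k b d ∨ C.Bad k d a ∨ C.Bad k b d' ∨ C.Bad k d' a)} := by
    rintro x (h | h)
    · exact Or.inl h
    · exact Or.inr h
  have h1 := Set.ncard_le_ncard hsub (Set.toFinite _)
  have h2 := Set.ncard_union_le {x : V × V | C.Bad k x.1 x.2} {x : V × V | ∃ b d a d', Rh C b d a d' ∧
      ((x.1 = b ∧ x.2 = d) ∨ (x.1 = d ∧ x.2 = a)) ∧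
      (C.Bad k b d ∨ C.Bad k d a ∨ C.Bad k b d' ∨ C.Bad k d' a)}
  have h3 := charge (κ := Fin 2 × Fin 4) {x : V × V | ∃ b d a d', Rh C b d a d' ∧
      ((x.1 = b ∧ x.2 = d) ∨ (x.1 = d ∧ x.2 = a)) ∧
      (C.Bad k b d ∨ C.Bad k d a ∨ C.Bad k b d' ∨ C.Bad k d' a)} {x : V × V | C.Bad k x.1 x.2}
      (fun x y j => ∃ b d a d', Rh C b d a d' ∧
        ((j.1 = 0 ∧ x = (b, d)) ∨ (j.1 = 1 ∧ x = (d, a))) ∧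
        ((j.2 = 0 ∧ y = (b, d)) ∨ (j.2 = 1 ∧ y = (d, a)) ∨ (j.2 = 2 ∧ y = (b, d')) ∨ (j.2 = 3 ∧ y = (d', a)))) ?_ ?_
  · simp only [Fintype.card_prod, Fintype.card_fin] at h3
    omega
  · rintro ⟨x, y⟩ ⟨b, d, a, d', hR, h, h'⟩
    have : ∃ j : Fin 2, (j = 0 ∧ (x, y) = (b, d)) ∨ (j = 1 ∧ (x, y) = (d, a)) := by
      rcases h with ⟨rfl, rfl⟩ | ⟨rfl, rfl⟩
      · exact ⟨0, Or.inl ⟨rfl, rfl⟩⟩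
      · exact ⟨1, Or.inr ⟨rfl, rfl⟩⟩
    obtain ⟨j, hj⟩ := this
    rcases h' with h' | h' | h' | h'
    · exact ⟨(b, d), h', (j, 0), b, d, a, d', hR, hj, Or.inl ⟨rfl, rfl⟩⟩
    · exact ⟨(d, a), h', (j, 1), b, d, a, d', hR, hj, Or.inr (Or.inl ⟨rfl, rfl⟩)⟩
    · exact ⟨(b, d'), h', (j, 2), b, d, a, d', hR, hj, Or.inr (Or.inr (Or.inl ⟨rfl, rfl⟩))⟩
    · exact ⟨(d', a), h', (j, 3), b, d, a, d', hR, hj, Or.inr (Or.inr (Or.inr ⟨rfl, rfl⟩))⟩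
  · rintro x x' y ⟨j1, j2⟩ ⟨b, d, a, d', hR, h, h'⟩ ⟨b2, d2, a2, d2', hR2, h2, h2'⟩
    simp only at h h' h2 h2'
    have key : b = b2 ∧ d = d2 ∧ a = a2 := by
      rcases h' with ⟨z, h'⟩ | ⟨z, h'⟩ | ⟨z, h'⟩ | ⟨z, h'⟩ <;>
      rcases h2' with ⟨z', h2'⟩ | ⟨z', h2'⟩ | ⟨z', h2'⟩ | ⟨z', h2'⟩ <;>
      first | (exfalso; rw [z] at z'; revert z'; decide) | skip
      all_goals
        rw [h'] at h2'
        simp only [Prod.mk.injEq] at h2'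
        obtain ⟨rfl, rfl⟩ := h2'
      · have := hR.g1.left_unique hR2.g1
        subst this
        exact ⟨rfl, rfl, hR.a_unique hR2⟩
      · have := hR.g2.right_unique hR2.g2
        subst this
        exact ⟨hR.b_unique hR2, rfl, rfl⟩
      · have := hR.g1.right_unique hR2.g1
        subst this
        exact ⟨rfl, rfl, hR.a_unique hR2⟩
      · have := hR.g2.left_unique hR2.g2
        subst this
        exact ⟨hR.b_unique hR2, rfl, rfl⟩
    obtain ⟨rfl, rfl, rfl⟩ := key
    rcases h with ⟨z, h⟩ | ⟨z, h⟩ <;> rcases h2 with ⟨z', h2⟩ | ⟨z', h2⟩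
    · rw [h, h2]
    · exfalso; rw [z] at z'; revert z'; decide
    · exfalso; rw [z] at z'; revert z'; decide
    · rw [h, h2]

lemma bad_count' [Finite V] (k : ℕ) : {x : V × V | C.Bad k x.1 x.2}.ncard ≤
    9 ^ k * {x : V × V | C.Bad 0 x.1 x.2}.ncard := by
  induction k with
  | zero => simp
  | succ k ih =>
    refine (bad_count k).trans ?_
    rw [pow_succ]
    nlinarith

/-- directions along a list of vertices -/
def pdirs (C : Cfg V) : List V → List (ℝ × ℝ)
  | [] => []
  | [_] => []
  | x :: y :: l => C.d x y :: pdirs C (y :: l)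

lemma pdirs_append (l1 l2 : List V) (b : V) :
    C.pdirs (l1 ++ b :: l2) = C.pdirs (l1 ++ [b]) ++ C.pdirs (b :: l2) := by
  induction l1 with
  | nil => simp [pdirs]
  | cons x l ih =>
    cases l with
    | nil => simp [pdirs]
    | cons y l => simp only [List.cons_append, pdirs] at ih ⊢; rw [ih]

lemma pdirs_length (x : V) (l : List V) : (C.pdirs (x :: l)).length = l.length := by
  induction l generalizing x with
  | nil => simp [pdirs]
  | cons y l ih => simp [pdirs, ih]

lemma find_split : ∀ (l : List V) (b s : V),
    List.IsChain (fun x y => C.OKl x y ∨ C.OKu x y) (b :: s :: l) → C.OKl b s →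
    (∃ l1 x y, b :: s :: l = l1 ++ [x, y] ∧ C.OKl x y) ∨
    (∃ l1 x y z l2, b :: s :: l = l1 ++ x :: y :: z :: l2 ∧ C.OKl x y ∧ C.OKu y z) := by
  intro l
  induction l with
  | nil => intro b s _ h; exact Or.inl ⟨[], b, s, rfl, h⟩
  | cons t l ih =>
    intro b s hc h
    rw [List.isChain_cons_cons] at hc
    by_cases hu : C.OKu s t
    · exact Or.inr ⟨[], b, s, t, l, rfl, h, hu⟩
    · have hl : C.OKl s t := (List.isChain_cons_cons.1 hc.2).1.resolve_right hu
      rcases ih s t hc.2 hl with ⟨l1, x, y, e, h1⟩ | ⟨l1, x, y, z, l2, e, h1, h2⟩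
      · exact Or.inl ⟨b :: l1, x, y, by rw [e]; rfl, h1⟩
      · exact Or.inr ⟨b :: l1, x, y, z, l2, by rw [e]; rfl, h1, h2⟩

def St (C : Cfg V) (u0 : ℝ × ℝ) (δ : ℝ) (h k : ℕ) (l : List V) : Prop :=
  l.length = h + 1 ∧ List.IsChain (fun x y => C.adj x y ∧ ¬ C.Bad k x y) l ∧
    ∀ e ∈ C.pdirs l, cl (h * δ) e u0

lemma sweep_one [Finite V] {u0 : ℝ × ℝ} {δ : ℝ} {h k : ℕ} (h0 : 0 ≤ δ) (hδ : 2 * C.η ≤ δ ^ 2)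
    (hs : (2 * h + 1) * δ ≤ 1 / 2) (h1 : 1 ≤ h) (l : List V) (hl : C.St u0 δ h (k + 1) l) :
    (∃ l', C.St u0 δ (h + 1) k l') ∨
    (∃ l', C.St u0 δ h k l' ∧ invs (C.pdirs l) = invs (C.pdirs l') + 1) := by
  obtain ⟨hlen, hch, hdir⟩ := hl
  have hh : (h : ℝ) * δ ≤ ((h + 1 : ℕ) : ℝ) * δ := by push_cast; nlinarith
  have hh' : δ + (h : ℝ) * δ = ((h + 1 : ℕ) : ℝ) * δ := by push_cast; ring
  have hch' : List.IsChain (fun x y => C.adj x y ∧ ¬ C.Bad k x y) l :=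
    hch.imp fun x y hxy => ⟨hxy.1, fun h' => hxy.2 (Or.inl h')⟩
  have hok : List.IsChain (fun x y => C.OKl x y ∨ C.OKu x y) l := by
    refine hch.imp fun x y hxy => ?_
    have : ¬ C.Bad 0 x y := not_bad_mono (j := k + 1) (by rw [zero_add]; exact hxy.2)
    by_contra hc
    push Not at hc
    exact this ⟨hxy.1, hc.1, hc.2⟩
  rcases l with _ | ⟨b, _ | ⟨s, rest⟩⟩
  · simp at hlen
  · simp at hlen; omega
  by_cases hu : C.OKu b s
  · left
    obtain ⟨b0, d', hR⟩ := hu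
    have hbs := (List.isChain_cons_cons.1 hch).1
    refine ⟨b0 :: b :: s :: rest, by simp only [List.length_cons] at hlen ⊢; omega, ?_, ?_⟩
    · rw [List.isChain_cons_cons]
      refine ⟨⟨hR.g1.a2, fun hb => hbs.2 (Or.inr ⟨b0, b, s, d', hR, Or.inr ⟨rfl, rfl⟩, Or.inl hb⟩)⟩, hch'⟩
    · intro e he
      simp only [pdirs, List.mem_cons] at he
      have hd1 : cl (h * δ) (C.d b s) u0 := hdir _ (by simp [pdirs])
      rcases he with rfl | he
      · rw [hR.dir1] at hd1
        have := (near_cl h0 hδ (ud hR.g1.a1) (ud hR.g1.a2) hR.g1.near).symm.trans hd1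
        rwa [hh'] at this
      · exact (hdir e (by simp only [pdirs, List.mem_cons]; exact he)).mono hh
  · have hol := (List.isChain_cons_cons.1 hok).1.resolve_right hu
    rcases find_split rest b s hok hol with ⟨l1, x, y, e, a, d', hR⟩ | ⟨l1, x, y, z, l2, e, ⟨a, d', hR⟩, ⟨b2, d2, hR2⟩⟩
    · left
      rw [e] at hlen hch hch' hdir
      rw [List.isChain_split] at hch hch'
      have hxy := (List.isChain_cons_cons.1 hch.2).1
      refine ⟨l1 ++ x :: [y, a], by simp only [List.length_append, List.length_cons, List.length_nil] at hlen ⊢; omega, ?_, ?_⟩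
      · rw [List.isChain_split]
        refine ⟨hch'.1, ?_⟩
        rw [List.isChain_cons_cons, List.isChain_cons_cons]
        refine ⟨(List.isChain_cons_cons.1 hch'.2).1, ⟨C.symm hR.g2.a1, fun hb => ?_⟩, by simp⟩
        exact hxy.2 (Or.inr ⟨x, y, a, d', hR, Or.inl ⟨rfl, rfl⟩, Or.inr (Or.inl hb)⟩)
      · intro e he
        rw [pdirs_append] at he hdir
        simp only [pdirs, List.mem_append, List.mem_cons, List.not_mem_nil, or_false] at he hdir
        have hd1 : cl (h * δ) (C.d x y) u0 := hdir _ (Or.inr rfl)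
        rcases he with he | rfl | rfl
        · exact (hdir e (Or.inl he)).mono hh
        · exact hd1.mono hh
        · rw [hR.dir1]
          have := (near_cl h0 hδ (ud hR.g1.a1) (ud hR.g1.a2) hR.g1.near).trans hd1
          rwa [hh'] at this
    · right
      rw [e] at hlen hch hch' hdir ⊢
      rw [List.isChain_split, List.isChain_cons_cons, List.isChain_cons_cons] at hch hch'
      have hxy := hch.2.1
      -- the two rhombi coincide
      have hd1 : cl (h * δ) (C.d x y) u0 := hdir _ (by rw [pdirs_append]; simp [pdirs])
      have hd2 : cl (h * δ) (C.d y z) u0 := hdir _ (by rw [pdirs_append]; simp [pdirs])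
      have hd3 := (near_cl h0 hδ (ud hR.g1.a1) (ud hR.g1.a2) hR.g1.near).trans (hd1.trans hd2.symm)
      rw [← hR.dir1] at hd3
      have hya : C.adj y a := C.symm hR.g2.a1
      have hyz : C.adj y z := C.symm hR2.g2.a1
      have hd4 := cl.dt (ud hya) (ud hyz) hd3
      have haz : a = z := by
        rcases (goodStruct hR.good).1 a z hya hyz with hn | hn
        · exact NR_near hR.g2.NR hR2.g2.NR hn
        · exfalso
          have e1 : 0 ≤ δ + (h * δ + h * δ) := by positivity
          have e2 : δ + (h * δ + h * δ) ≤ 1 / 2 := by linarith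
          have e3 : (δ + (h * δ + h * δ)) ^ 2 ≤ (1 / 2) ^ 2 := pow_le_pow_left₀ e1 e2 2
          linarith
      subst haz
      refine ⟨l1 ++ x :: d' :: a :: l2, ⟨by simp only [List.length_append, List.length_cons] at hlen ⊢; omega, ?_, ?_⟩, ?_⟩
      · rw [List.isChain_split, List.isChain_cons_cons, List.isChain_cons_cons]
        refine ⟨hch'.1, ⟨hR.g1.a1, fun hb => ?_⟩, ⟨C.symm hR.g2.a2, fun hb => ?_⟩, hch'.2.2.2⟩
        · exact hxy.2 (Or.inr ⟨x, y, a, d', hR, Or.inl ⟨rfl, rfl⟩, Or.inr (Or.inr (Or.inl hb))⟩)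
        · exact hxy.2 (Or.inr ⟨x, y, a, d', hR, Or.inl ⟨rfl, rfl⟩, Or.inr (Or.inr (Or.inr hb))⟩)
      · intro e he
        apply hdir
        rw [pdirs_append] at he ⊢
        simp only [pdirs, List.mem_append, List.mem_cons, hR.dir1, hR.dir2] at he ⊢
        tauto
      · rw [pdirs_append, pdirs_append l1 (d' :: a :: l2)]
        simp only [pdirs, hR.dir1, hR.dir2]
        exact invs_swap _ _ _ _ hR.g1.pos

lemma St_mono {u0 : ℝ × ℝ} {δ : ℝ} {h k j : ℕ} {l : List V} (hl : C.St u0 δ h (k + j) l) :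
    C.St u0 δ h k l :=
  ⟨hl.1, hl.2.1.imp fun _ _ hxy => ⟨hxy.1, not_bad_mono hxy.2⟩, hl.2.2⟩

lemma sweep_step [Finite V] {u0 : ℝ × ℝ} {δ : ℝ} {h : ℕ} (h0 : 0 ≤ δ) (hδ : 2 * C.η ≤ δ ^ 2)
    (hs : (2 * h + 1) * δ ≤ 1 / 2) (h1 : 1 ≤ h) : ∀ (N k : ℕ) (l : List V),
    C.St u0 δ h (k + (N + 1)) l → invs (C.pdirs l) ≤ N → ∃ l', C.St u0 δ (h + 1) k l' := by
  intro N
  induction N with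
  | zero =>
    intro k l hl hi
    rcases sweep_one h0 hδ hs h1 l hl with h' | ⟨l', -, e⟩
    · exact h'
    · omega
  | succ N ih =>
    intro k l hl hi
    rcases sweep_one (k := k + (N + 1)) h0 hδ hs h1 l hl with ⟨l', h'⟩ | ⟨l', h', e⟩
    · exact ⟨l', St_mono h'⟩
    · exact ih k l' h' (by omega)

def TT : ℕ → ℕ
  | 0 => 0
  | h + 1 => TT h + ((h + 1) * (h + 1) + 1)

lemma sweep [Finite V] {u0 : ℝ × ℝ} {δ : ℝ} {H : ℕ} (h0 : 0 ≤ δ) (hδ : 2 * C.η ≤ δ ^ 2)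
    (hs : (2 * H + 1) * δ ≤ 1 / 2) : ∀ (h k : ℕ), h ≤ H → (∃ l, C.St u0 δ 1 (k + TT h) l) →
    ∃ l', C.St u0 δ (h + 1) k l' := by
  intro h
  induction h with
  | zero => intro k _ hl; exact hl
  | succ h ih =>
    rintro k hk ⟨l, hl⟩
    obtain ⟨l', hl'⟩ := ih (k + ((h + 1) * (h + 1) + 1)) (by omega) ⟨l, by
      have : k + ((h + 1) * (h + 1) + 1) + TT h = k + TT (h + 1) := by simp only [TT]; omega
      rw [this]; exact hl⟩
    refine sweep_step h0 hδ ?_ (by omega) ((h + 1) * (h + 1)) k l' hl' ?_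
    · refine le_trans (mul_le_mul_of_nonneg_right ?_ h0) hs
      have : ((h + 1 : ℕ) : ℝ) ≤ H := by exact_mod_cast hk
      linarith
    · have h1 := invs_le (C.pdirs l')
      have h2 : (C.pdirs l').length = h + 1 := by
        have := hl'.1
        match l', this with
        | x :: r, this => rw [pdirs_length]; simpa using this
      rwa [h2] at h1

lemma displacement {u0 : ℝ × ℝ} : ∀ (l : List V) (x : V), (∀ e ∈ C.pdirs (x :: l), 1 / 2 ≤ dt u0 e) →
    ∃ y, (l.length : ℝ) / 2 ≤ dt u0 (C.d x y) := by
  intro l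
  induction l with
  | nil => intro x _; exact ⟨x, by simp [dt, d]⟩
  | cons z l ih =>
    intro x hx
    obtain ⟨y, hy⟩ := ih z (fun e he => hx e (by simp only [pdirs, List.mem_cons]; exact Or.inr he))
    refine ⟨y, ?_⟩
    have h1 := hx (C.d x z) (by simp [pdirs])
    have : C.d x y = C.d x z + C.d z y := by simp only [d]; abel
    rw [this, dt_add_r]
    push_cast [List.length_cons]
    linarith

lemma all_bad [Finite V] {δ M : ℝ} {H : ℕ} (h0 : 0 ≤ δ) (hδ : 2 * C.η ≤ δ ^ 2)
    (hs : (2 * H + 1) * δ ≤ 1 / 2) (hM : ∀ v, |(C.P v).1| ≤ M ∧ |(C.P v).2| ≤ M) (hH : 8 * M < H)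
    {x y : V} (hxy : C.adj x y) : C.Bad (TT H) x y := by
  by_contra hb
  obtain ⟨l, hl⟩ := sweep (u0 := C.d x y) h0 hδ hs H 0 le_rfl ⟨[x, y], by
    refine ⟨rfl, ?_, ?_⟩
    · rw [List.isChain_cons_cons, zero_add]
      exact ⟨⟨hxy, hb⟩, by simp⟩
    · intro e he
      simp only [pdirs, List.mem_cons, List.not_mem_nil, or_false] at he
      subst he
      simp [cl, h0]⟩
  match l, hl with
  | z :: l, ⟨hlen, hch, hdir⟩ =>
  have hu := ud hxy
  have hunit : ∀ (l : List V) (z : V), List.IsChain (fun x y => C.adj x y ∧ ¬ C.Bad 0 x y) (z :: l) →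
      ∀ e ∈ C.pdirs (z :: l), dt e e = 1 := by
    intro l
    induction l with
    | nil => intro z _ e he; simp [pdirs] at he
    | cons w l ih =>
      intro z hc e he
      rw [List.isChain_cons_cons] at hc
      simp only [pdirs, List.mem_cons] at he
      rcases he with rfl | he
      · exact ud hc.1.1
      · exact ih w hc.2 e he
  obtain ⟨w, hw⟩ := displacement (C := C) (u0 := C.d x y) l z (by
    intro e he
    have h1 := cl.dt (hunit l z hch e he) hu (hdir e he)
    rw [dt_comm] at h1
    have e1 : 0 ≤ ((H + 1 : ℕ) : ℝ) * δ := by positivity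
    have e2 : ((H + 1 : ℕ) : ℝ) * δ ≤ 1 / 2 := by
      refine le_trans (mul_le_mul_of_nonneg_right ?_ h0) hs
      push_cast
      have : (0 : ℝ) ≤ H := Nat.cast_nonneg _
      linarith
    have e3 := pow_le_pow_left₀ e1 e2 2
    linarith)
  have hl2 : l.length = H + 1 := by simpa using hlen
  rw [hl2] at hw
  push_cast at hw
  have a1 := abs_of_unit hu
  have b1 : |(C.d z w).1| ≤ 2 * M := by
    have := abs_sub (C.P w).1 (C.P z).1
    simp only [d, Prod.fst_sub]
    linarith [(hM w).1, (hM z).1]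
  have b2 : |(C.d z w).2| ≤ 2 * M := by
    have := abs_sub (C.P w).2 (C.P z).2
    simp only [d, Prod.snd_sub]
    linarith [(hM w).2, (hM z).2]
  have c1 : (C.d x y).1 * (C.d z w).1 ≤ 2 * M := by
    refine (le_abs_self _).trans ?_
    rw [abs_mul]
    nlinarith [abs_nonneg (C.d x y).1, abs_nonneg (C.d z w).1, a1.1]
  have c2 : (C.d x y).2 * (C.d z w).2 ≤ 2 * M := by
    refine (le_abs_self _).trans ?_
    rw [abs_mul]
    nlinarith [abs_nonneg (C.d x y).2, abs_nonneg (C.d z w).2, a1.2]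
  simp only [dt] at hw
  linarith

end Cfg
end MS


namespace MS
namespace Cfg
variable {V : Type} {C : Cfg V} {K : ℕ} {κ : ℝ × ℝ → Fin K}

lemma B0_count [Finite V] : {v | C.B0 v}.ncard ≤
    {v | C.X v}.ncard + {v | C.Low v}.ncard + 2 * {x : V × V | C.W x.1 x.2}.ncard := by
  have hsub : {v | C.B0 v} ⊆ ({v | C.X v} ∪ {v | C.Low v}) ∪
      ((Prod.fst '' {x : V × V | C.W x.1 x.2}) ∪ (Prod.snd '' {x : V × V | C.W x.1 x.2})) := by
    rintro v (h | h | ⟨a, h | h⟩)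
    · exact Or.inl (Or.inl h)
    · exact Or.inl (Or.inr h)
    · exact Or.inr (Or.inl ⟨(v, a), h, rfl⟩)
    · exact Or.inr (Or.inr ⟨(a, v), h, rfl⟩)
  have h1 := Set.ncard_le_ncard hsub (Set.toFinite _)
  have h2 := Set.ncard_union_le ({v | C.X v} ∪ {v | C.Low v})
    ((Prod.fst '' {x : V × V | C.W x.1 x.2}) ∪ (Prod.snd '' {x : V × V | C.W x.1 x.2}))
  have h3 := Set.ncard_union_le {v | C.X v} {v | C.Low v}
  have h4 := Set.ncard_union_le (Prod.fst '' {x : V × V | C.W x.1 x.2})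
    (Prod.snd '' {x : V × V | C.W x.1 x.2})
  have h5 : (Prod.fst '' {x : V × V | C.W x.1 x.2}).ncard ≤ _ := Set.ncard_image_le (Set.toFinite _)
  have h6 : (Prod.snd '' {x : V × V | C.W x.1 x.2}).ncard ≤ _ := Set.ncard_image_le (Set.toFinite _)
  omega

lemma B_count [Finite V] (hκ : DirCode C.η K κ) : {v | C.B v}.ncard ≤
    {v | C.B0 v}.ncard * (1 + 2 * K) := by
  have h3 := charge (κ := Fin 2 × Fin K) {v | C.Bent v ∧ ¬ C.B0 v} {v | C.B0 v}
    (fun v b k => (k.1 = 0 ∧ ∃ q, C.Gap q b v ∧ k.2 = κ (C.d b q)) ∨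
      (k.1 = 1 ∧ ∃ t, C.Gap t v b ∧ k.2 = κ (C.d b t))) ?_ ?_
  · have hsub : {v | C.B v} ⊆ {v | C.B0 v} ∪ {v | C.Bent v ∧ ¬ C.B0 v} := by
      rintro v (h | h)
      · exact Or.inl h
      · by_cases h' : C.B0 v
        · exact Or.inl h'
        · exact Or.inr ⟨h, h'⟩
    have h1 := Set.ncard_le_ncard hsub (Set.toFinite _)
    have h2 := Set.ncard_union_le {v | C.B0 v} {v | C.Bent v ∧ ¬ C.B0 v}
    simp only [Fintype.card_prod, Fintype.card_fin] at h3
    rw [mul_add, mul_one]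
    omega
  · rintro v ⟨h, h'⟩
    rcases bent_charge h h' with ⟨q, b, g, hb⟩ | ⟨t, b, g, hb⟩
    · exact ⟨b, hb, (0, κ (C.d b q)), Or.inl ⟨rfl, q, g, rfl⟩⟩
    · exact ⟨b, hb, (1, κ (C.d b t)), Or.inr ⟨rfl, t, g, rfl⟩⟩
  · rintro v v' b ⟨k1, k2⟩ h h'
    rcases h with ⟨z, q, g, e⟩ | ⟨z, q, g, e⟩ <;> rcases h' with ⟨z', q', g', e'⟩ | ⟨z', q', g', e'⟩
    · have := code_NR hκ g.NR g'.NR (by rw [← e, ← e'])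
      subst this
      exact g.right_unique g'
    · exfalso; simp only at z z'; rw [z] at z'; revert z'; decide
    · exfalso; simp only at z z'; rw [z] at z'; revert z'; decide
    · have := code_NL hκ g.NL g'.NL (by rw [← e, ← e'])
      subst this
      exact g.left_unique g'

lemma X_count [Finite V] (hκ : DirCode C.η K κ) {K' : ℕ} {κ' : ℝ × ℝ → Fin K'}
    (hκ' : ∀ v w, κ' (C.P v) = κ' (C.P w) → |(C.P v).1 - (C.P w).1| < C.η / 4 ∧
      |(C.P v).2 - (C.P w).2| < C.η / 4) :
    {v | C.X v}.ncard ≤ K' * (K * (K * K)) := by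
  have h := charge (κ := Fin K' × Fin K × Fin K × Fin K) {v | C.X v} (Set.univ : Set Unit)
    (fun v _ k => κ' (C.P v) = k.1 ∧ ∃ x y z, C.adj v x ∧ C.adj v y ∧ C.adj v z ∧
      ¬ C.near (C.d v x) (C.d v y) ∧ ¬ C.near (C.d v x) (C.d v z) ∧ ¬ C.near (C.d v y) (C.d v z) ∧
      k.2.1 = κ (C.d v x) ∧ k.2.2.1 = κ (C.d v y) ∧ k.2.2.2 = κ (C.d v z)) ?_ ?_
  · simpa [Fintype.card_prod] using h
  · rintro v ⟨x, y, z, h1, h2, h3, h4, h5, h6⟩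
    exact ⟨(), trivial, (κ' (C.P v), κ (C.d v x), κ (C.d v y), κ (C.d v z)), rfl, x, y, z, h1, h2, h3, h4, h5, h6,
      rfl, rfl, rfl⟩
  · rintro v w _ ⟨k0, k1, k2, k3⟩ ⟨e0, x, y, z, h1, h2, h3, h4, h5, h6, e1, e2, e3⟩
      ⟨e0', x', y', z', h1', h2', h3', h4', h5', h6', e1', e2', e3'⟩
    simp only at *
    by_contra hne
    obtain ⟨a, b⟩ := hκ' v w (by rw [e0, e0'])
    unfold near at h4 h5 h6
    push Not at h4 h5 h6
    refine G8 (C := C) (v := v) (w := w) (x1 := x) (x2 := y) (x3 := z) (y1 := x') (y2 := y') (y3 := z')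
      ⟨h1, h2, h3, h1', h2', h3', h4, h5, h6, hκ _ _ (ud h1) (ud h1') (by rw [← e1, ← e1']),
       hκ _ _ (ud h2) (ud h2') (by rw [← e2, ← e2']), hκ _ _ (ud h3) (ud h3') (by rw [← e3, ← e3']), ?_, hne⟩
    have h0 := C.hη0
    have a' := sq_lt_sq' (by linarith [(abs_lt.1 a).1]) (abs_lt.1 a).2
    have b' := sq_lt_sq' (by linarith [(abs_lt.1 b).1]) (abs_lt.1 b).2
    simp only [dt, d, Prod.fst_sub, Prod.snd_sub]
    nlinarith

lemma ncard_pairs [Fintype V] (p : V → V → Prop) :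
    {x : V × V | p x.1 x.2}.ncard = ∑ v, {a | p v a}.ncard := by
  classical
  have h1 : {x : V × V | p x.1 x.2}.ncard = (Finset.univ.filter (fun x : V × V => p x.1 x.2)).card := by
    rw [← Set.ncard_coe_finset]; congr 1; ext; simp
  have h2 : ∀ v, {a | p v a}.ncard = (Finset.univ.filter (fun a : V => p v a)).card := by
    intro v; rw [← Set.ncard_coe_finset]; congr 1; ext; simp
  simp only [h1, h2, Finset.card_filter, Fintype.sum_prod_type]

open Classical in
lemma ncard_ite [Fintype V] (p : V → Prop) : {v | p v}.ncard = ∑ v, if p v then 1 else 0 := by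
  rw [← Finset.card_filter, ← Set.ncard_coe_finset]; congr 1; ext; simp

lemma NR_le [Finite V] (hκ : DirCode C.η K κ) (v : V) : {a | C.NR v a}.ncard ≤ K := by
  have := Set.ncard_le_ncard_of_injOn (s := {a | C.NR v a}) (t := (Set.univ : Set (Fin K)))
    (fun a => κ (C.d v a)) (fun _ _ => trivial) (fun a ha b hb e => code_NR hκ ha hb e)
  simpa [Set.ncard_univ] using this
lemma NL_le [Finite V] (hκ : DirCode C.η K κ) (v : V) : {a | C.NL v a}.ncard ≤ K := by
  have := Set.ncard_le_ncard_of_injOn (s := {a | C.NL v a}) (t := (Set.univ : Set (Fin K)))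
    (fun a => κ (C.d v a)) (fun _ _ => trivial) (fun a ha b hb e => code_NL hκ ha hb e)
  simpa [Set.ncard_univ] using this

lemma NR_le2 [Finite V] {v : V} (hX : ¬ C.X v) : {a | C.NR v a}.ncard ≤ 2 := by
  by_contra hc
  push Not at hc
  rw [Set.two_lt_ncard_iff] at hc
  obtain ⟨a, b, c, ha, hb, hc, h1, h2, h3⟩ := hc
  exact hX ⟨a, b, c, ha.1, hb.1, hc.1, fun h => h1 (NR_near ha hb h), fun h => h2 (NR_near ha hc h),
    fun h => h3 (NR_near hb hc h)⟩
lemma NL_le2 [Finite V] {v : V} (hX : ¬ C.X v) : {a | C.NL v a}.ncard ≤ 2 := by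
  by_contra hc
  push Not at hc
  rw [Set.two_lt_ncard_iff] at hc
  obtain ⟨a, b, c, ha, hb, hc, h1, h2, h3⟩ := hc
  exact hX ⟨a, b, c, ha.1, hb.1, hc.1, fun h => h1 (NL_near ha hb h), fun h => h2 (NL_near ha hc h),
    fun h => h3 (NL_near hb hc h)⟩

lemma le_one_of [Finite V] {p : V → Prop} (h : ¬ ∃ x y, x ≠ y ∧ p x ∧ p y) : {a | p a}.ncard ≤ 1 := by
  by_contra hc
  push Not at hc
  rw [Set.one_lt_ncard_iff] at hc
  obtain ⟨a, b, ha, hb, hab⟩ := hc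
  exact h ⟨a, b, hab, ha, hb⟩

open Classical in
lemma deg_bound [Finite V] (hκ : DirCode C.η K κ) (v : V) :
    {a | C.NR v a}.ncard + {a | C.NL v a}.ncard + (if C.Low v then 1 else 0) ≤
      4 + 2 * K * (if C.X v then 1 else 0) := by
  by_cases hX : C.X v
  · have hL : ¬ C.Low v := fun h => h.1 hX
    have := NR_le hκ v
    have := NL_le hκ v
    simp only [hX, hL, if_true, if_false]
    omega
  · have h1 := NR_le2 hX
    have h2 := NL_le2 hX
    by_cases hL : C.Low v
    · simp only [hX, hL, if_true, if_false]
      rcases hL.2 with h | h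
      · have := le_one_of h; omega
      · have := le_one_of h; omega
    · simp only [hX, hL, if_false]
      omega

lemma I12 [Fintype V] (hκ : DirCode C.η K κ) :
    {x : V × V | C.adj x.1 x.2}.ncard + {x : V × V | C.W x.1 x.2}.ncard + {v | C.Low v}.ncard ≤
      4 * Fintype.card V + 2 * K * {v | C.X v}.ncard := by
  classical
  have e1 : {x : V × V | C.adj x.1 x.2} = {x : V × V | C.NR x.1 x.2} ∪ {x : V × V | C.NL x.2 x.1} := by
    ext ⟨v, a⟩
    constructor
    · intro h
      have h : C.adj v a := h
      by_cases hr : C.R v a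
      · exact Or.inr ⟨C.symm h, fun h' => Zlem h hr h'⟩
      · exact Or.inl ⟨h, hr⟩
    · rintro (h | h)
      · exact h.1
      · exact C.symm h.1
  have e2 : {x : V × V | C.W x.1 x.2} = {x : V × V | C.NR x.1 x.2} ∩ {x : V × V | C.NL x.2 x.1} := by
    ext ⟨v, a⟩
    constructor
    · intro h; exact ⟨⟨h.1, h.2.1⟩, ⟨C.symm h.1, h.2.2⟩⟩
    · rintro ⟨h, h'⟩; exact ⟨h.1, h.2, h'.2⟩
  have e3 : {x : V × V | C.NL x.2 x.1}.ncard = {x : V × V | C.NL x.1 x.2}.ncard := by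
    have : {x : V × V | C.NL x.2 x.1} = Prod.swap '' {x : V × V | C.NL x.1 x.2} := by
      rw [Set.image_swap_eq_preimage_swap]; rfl
    rw [this, Set.ncard_image_of_injective _ Prod.swap_injective]
  have e4 := Set.ncard_union_add_ncard_inter {x : V × V | C.NR x.1 x.2} {x : V × V | C.NL x.2 x.1}
  rw [← e1, ← e2, e3, ncard_pairs C.NR, ncard_pairs C.NL] at e4
  rw [e4, ncard_ite C.Low, ncard_ite C.X, ← Finset.sum_add_distrib, ← Finset.sum_add_distrib, Finset.mul_sum]
  refine (Finset.sum_le_sum fun v _ => deg_bound hκ v).trans ?_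
  rw [Finset.sum_add_distrib]
  simp [mul_comm]

lemma I3 [Finite V] (hκ : DirCode C.η K κ) {δ M : ℝ} {H : ℕ} (h0 : 0 ≤ δ) (hδ : 2 * C.η ≤ δ ^ 2)
    (hs : (2 * H + 1) * δ ≤ 1 / 2) (hM : ∀ v, |(C.P v).1| ≤ M ∧ |(C.P v).2| ≤ M) (hH : 8 * M < H) :
    {x : V × V | C.adj x.1 x.2}.ncard ≤ (2 * 9 ^ TT H * (2 * K + 8 * (K * (K * K))) * (1 + 2 * K)) *
      ({x : V × V | C.W x.1 x.2}.ncard + {v | C.Low v}.ncard + {v | C.X v}.ncard) := by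
  have h1 : {x : V × V | C.adj x.1 x.2}.ncard ≤ {x : V × V | C.Bad (TT H) x.1 x.2}.ncard :=
    Set.ncard_le_ncard (fun x hx => all_bad h0 hδ hs hM hH hx) (Set.toFinite _)
  have h2 := bad_count' (C := C) (TT H)
  have h3 : {x : V × V | C.Bad 0 x.1 x.2}.ncard ≤ _ := bad0_count hκ
  have h4 := B_count hκ
  have h5 := B0_count (C := C)
  calc _ ≤ _ := h1
    _ ≤ _ := h2
    _ ≤ 9 ^ TT H * ((({x : V × V | C.W x.1 x.2}.ncard + {v | C.Low v}.ncard + {v | C.X v}.ncard) * 2 * (1 + 2 * K)) * (2 * K + 8 * (K * (K * K)))) := by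
      apply Nat.mul_le_mul_left
      refine h3.trans (Nat.mul_le_mul_right _ (h4.trans (Nat.mul_le_mul_right _ ?_)))
      omega
    _ = _ := by ring

end Cfg

/-- the numeric conclusion for configurations -/
lemma cfg_bound (M : ℝ) (hM0 : 0 ≤ M) : ∃ η : ℝ, 0 < η ∧ η ≤ 1 / 10000 ∧ ∃ A E : ℝ, 0 < A ∧ 0 ≤ E ∧
    ∀ (V : Type) [Fintype V] (C : Cfg V), C.η = η → (∀ v, |(C.P v).1| ≤ M ∧ |(C.P v).2| ≤ M) →
    (1 + 1 / A) * ({x : V × V | C.adj x.1 x.2}.ncard : ℝ) ≤ 4 * Fintype.card V + E := by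
  obtain ⟨H, hH⟩ := exists_nat_gt (8 * M)
  have hHp : (0 : ℝ) < H := by linarith
  set δ : ℝ := 1 / (100 * (H + 1)) with hδ
  have hδ0 : 0 < δ := by positivity
  have hδ1 : (H + 1) * δ = 1 / 100 := by rw [hδ]; field_simp
  have hδ2 : δ ≤ 1 / 100 := by nlinarith
  set η := δ ^ 2 / 2 with hη
  have hη0 : 0 < η := by positivity
  obtain ⟨K, κ, hκ⟩ := exists_dirCode η hη0
  obtain ⟨K', κ', hκ'⟩ := exists_code M (η / 4) (by linarith)
  refine ⟨η, hη0, by nlinarith, (2 * 9 ^ Cfg.TT H * (2 * K + 8 * (K * (K * K))) * (1 + 2 * K) : ℕ) + 1,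
    ((2 * K + 1) * (K' * (K * (K * K))) : ℕ), by positivity, by positivity, ?_⟩
  intro V _ C hC hM
  have hκC : DirCode C.η K κ := by rw [hC]; exact hκ
  have i12 := Cfg.I12 hκC
  have i3 := Cfg.I3 hκC hδ0.le (by rw [hC, hη]; linarith) (H := H) (by nlinarith) hM hH
  have ix := Cfg.X_count hκC (κ' := κ') (by
    intro v w h
    rw [hC]
    exact hκ' _ _ (hM v).1 (hM v).2 (hM w).1 (hM w).2 h)
  generalize (2 * 9 ^ Cfg.TT H * (2 * K + 8 * (K * (K * K))) * (1 + 2 * K)) = A at *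
  generalize {x : V × V | C.adj x.1 x.2}.ncard = D at *
  generalize {x : V × V | C.W x.1 x.2}.ncard = W at *
  generalize {v | C.Low v}.ncard = S at *
  generalize {v | C.X v}.ncard = X at *
  have j : D + (W + S + X) ≤ 4 * Fintype.card V + (2 * K + 1) * (K' * (K * (K * K))) := by
    have : (2 * K + 1) * X ≤ (2 * K + 1) * (K' * (K * (K * K))) := Nat.mul_le_mul_left _ ix
    have e : (2 * K + 1) * X = 2 * K * X + X := by ring
    omega
  have j' : (D : ℝ) + (W + S + X) ≤ 4 * Fintype.card V + ((2 * K + 1) * (K' * (K * (K * K))) : ℕ) := by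
    exact_mod_cast j
  have i3' : (D : ℝ) ≤ A * (W + S + X) := by exact_mod_cast i3
  have hA : (0 : ℝ) < (A : ℝ) + 1 := by positivity
  have : 1 / ((A : ℝ) + 1) * D ≤ W + S + X := by
    rw [one_div, inv_mul_le_iff₀ hA]
    have : (0 : ℝ) ≤ W + S + X := by positivity
    linarith
  linarith

end MS

namespace MS

def planeCoord (o p : EuclideanSpace ℝ (Fin 2)) : ℝ × ℝ := (p 0 - o 0, p 1 - o 1)

lemma planeCoord_lin {o p q w : EuclideanSpace ℝ (Fin 2)} {s : ℝ}
    (h : planeCoord o w = planeCoord o p + s • (planeCoord o q - planeCoord o p)) :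
    w = p + s • (q - p) := by
  have h1 := congrArg Prod.fst h
  have h2 := congrArg Prod.snd h
  simp [planeCoord] at h1 h2
  ext i
  fin_cases i
  · simp; linarith
  · simp; linarith

lemma planeCoord_lin2 {o p q a b : EuclideanSpace ℝ (Fin 2)} {s t : ℝ}
    (h : planeCoord o p + s • (planeCoord o q - planeCoord o p)
      = planeCoord o a + t • (planeCoord o b - planeCoord o a)) :
    p + s • (q - p) = a + t • (b - a) := by
  have h1 := congrArg Prod.fst h
  have h2 := congrArg Prod.snd h
  simp [planeCoord] at h1 h2
  ext i
  fin_cases i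
  · simp; linarith
  · simp; linarith

lemma endpoint_param {p q : EuclideanSpace ℝ (Fin 2)} (hpq : p ≠ q) {s : ℝ}
    (h : p + s • (q - p) = p ∨ p + s • (q - p) = q) : s = 0 ∨ s = 1 := by
  have hne : q - p ≠ 0 := sub_ne_zero.mpr (Ne.symm hpq)
  rcases h with h | h
  · left
    have : s • (q - p) = 0 := by simpa using h
    exact (smul_eq_zero.mp this).resolve_right hne
  · right
    have : (s - 1) • (q - p) = 0 := by
      rw [sub_smul, one_smul]
      have h' : s • (q - p) = q - p := eq_sub_of_add_eq' h
      rw [h', sub_self]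
    have := (smul_eq_zero.mp this).resolve_right hne
    linarith

noncomputable def toCfg {n : ℕ} {G : SimpleGraph (Fin n)} (emb : MatchstickEmbedding G)
    (o : EuclideanSpace ℝ (Fin 2)) (η : ℝ) (h0 : 0 < η) (h1 : η ≤ 1/10000) : Cfg (Fin n) where
  P v := planeCoord o (emb.pos v)
  adj := G.Adj
  η := η
  hη0 := h0
  hη1 := h1
  symm h := h.symm
  unit := by
    intro u v h
    have := emb.unit u v h
    rw [EuclideanSpace.dist_eq, Real.sqrt_eq_one, Fin.sum_univ_two, Real.dist_eq, Real.dist_eq,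
      sq_abs, sq_abs] at this
    simp only [dt, planeCoord, Prod.fst_sub, Prod.snd_sub]
    linarith
  inj := by
    intro u v h
    apply emb.inj
    have h1 := congrArg Prod.fst h
    have h2 := congrArg Prod.snd h
    simp [planeCoord] at h1 h2
    ext i
    fin_cases i
    · simpa using h1
    · simpa using h2
  nv := by
    intro w u v h s hs0 hs1 he
    refine emb.noVertexInterior w u v h ?_
    rw [planeCoord_lin he, openSegment_eq_image']
    exact ⟨s, ⟨hs0, hs1⟩, rfl⟩
  nc := by
    intro u v a b huv hab hn1 hn2 s t hs0 hs1 ht0 ht1 he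
    have he' := planeCoord_lin2 he
    have hne : s(u, v) ≠ s(a, b) := by
      intro hh
      rcases Sym2.eq_iff.mp hh with hh | hh
      · exact hn1 hh
      · exact hn2 hh
    have hm := emb.noncross u v a b huv hab hne
      (show emb.pos u + s • (emb.pos v - emb.pos u) ∈ _ from ⟨by
        rw [segment_eq_image']; exact ⟨s, ⟨hs0, hs1⟩, rfl⟩, by
        rw [he', segment_eq_image']; exact ⟨t, ⟨ht0, ht1⟩, rfl⟩⟩)
    obtain ⟨hm1, hm2⟩ := hm
    rw [he'] at hm2
    exact ⟨endpoint_param (fun e => huv.ne (emb.inj e)) hm1,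
      endpoint_param (fun e => hab.ne (emb.inj e)) hm2⟩

lemma planeCoord_bound {o p : EuclideanSpace ℝ (Fin 2)} {r : ℝ} (hr : 0 < r)
    (h : p ∈ Metric.closedBall o r) : |(planeCoord o p).1| ≤ r ∧ |(planeCoord o p).2| ≤ r := by
  rw [Metric.mem_closedBall, EuclideanSpace.dist_eq, Real.sqrt_le_left hr.le, Fin.sum_univ_two,
    Real.dist_eq, Real.dist_eq, sq_abs, sq_abs] at h
  constructor
  · apply abs_le_of_sq_le_sq _ hr.le
    simp only [planeCoord]; nlinarith [sq_nonneg (p 1 - o 1)]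
  · apply abs_le_of_sq_le_sq _ hr.le
    simp only [planeCoord]; nlinarith [sq_nonneg (p 0 - o 0)]

lemma dart_count {n : ℕ} (G : SimpleGraph (Fin n)) :
    {x : Fin n × Fin n | G.Adj x.1 x.2}.ncard = 2 * G.edgeSet.ncard := by
  classical
  rw [Cfg.ncard_pairs (fun a b => G.Adj a b)]
  have h := G.sum_degrees_eq_twice_card_edges
  rw [← SimpleGraph.coe_edgeFinset, Set.ncard_coe_finset, ← h]
  refine Finset.sum_congr rfl fun v _ => ?_
  rw [← SimpleGraph.card_neighborFinset_eq_degree, ← Set.ncard_coe_finset]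
  congr 1
  ext a; simp

end MS

theorem matchstick_in_disk_upper_bound_asymptotic (r : ℝ) (hr : 0 < r) :
    ∃ ε : ℝ, 0 < ε ∧ ∃ n₀ : ℕ, ∀ n : ℕ, n₀ ≤ n →
      ∀ (G : SimpleGraph (Fin n)) (emb : MatchstickEmbedding G)
        (o : EuclideanSpace ℝ (Fin 2)),
        (∀ v, emb.pos v ∈ Metric.closedBall o r) →
        (G.edgeSet.ncard : ℝ) ≤ (2 - ε) * n := by
  obtain ⟨η, h0, h1, A, E, hA, hE, key⟩ := MS.cfg_bound r hr.le
  refine ⟨1 / (A + 1), by positivity, ⌈A * E⌉₊ + 1, ?_⟩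
  intro n hn G emb o hb
  have hk := key (Fin n) (MS.toCfg emb o η h0 h1) rfl (fun v => MS.planeCoord_bound hr (hb v))
  have hd : {x : Fin n × Fin n | (MS.toCfg emb o η h0 h1).adj x.1 x.2}.ncard
      = 2 * G.edgeSet.ncard := MS.dart_count G
  rw [hd, Fintype.card_fin] at hk
  push_cast at hk
  have hn' : A * E ≤ n := by
    have h2 : A * E ≤ (⌈A * E⌉₊ : ℝ) := Nat.le_ceil _
    have h3 : ((⌈A * E⌉₊ : ℕ) : ℝ) ≤ n := by exact_mod_cast (by omega)
    linarith
  have hn0 : (0 : ℝ) ≤ n := Nat.cast_nonneg n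
  set m : ℝ := (G.edgeSet.ncard : ℝ)
  have e1 : (1 + 1 / A) * (2 * m) = (A + 1) * (2 * m) / A := by field_simp
  rw [e1, div_le_iff₀ hA] at hk
  have e2 : (2 - 1 / (A + 1)) * (n : ℝ) = ((2 * A + 1) * n) / (A + 1) := by field_simp; ring
  rw [e2, le_div_iff₀ (by positivity)]
  nlinarith
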